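/- There exists an absolute constant c such that for every primitive polynomial f ∈ ℤ[x_1,x_2] of degree d ≥ 1 that is irreducible over ℚ, with degree-d homogeneous part f_d, and every real B ≥ 1, one has N_aff(f,B) ≤ c·B^{1/d}·min(d^2·log‖f_d‖ + d^3·log B + d^4, d^4·b(f))/‖f_d‖^{1/d^2} + c·d·log B + c·d^4. -/

import Mathlib

/-- The number of integer points `x ∈ ℤ^N` with `|x_i| ≤ B` for all `i` and `f(x) = 0`. -/
noncomputable def Naff {N : ℕ} (f : MvPolynomial (Fin N) ℤ) (B : ℝ) : ℕ :=
  Set.ncard {x : Fin N → ℤ | (∀ i, |(x i : ℝ)| ≤ B) ∧ MvPolynomial.eval x f = 0}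

/-- The maximum of the absolute values of the coefficients of `f`, as a real number. -/
noncomputable def normMax {σ : Type*} (f : MvPolynomial σ ℤ) : ℝ :=
  ((f.support.sup fun m => (f.coeff m).natAbs : ℕ) : ℝ)

open Classical in
/-- The badness `b(f)`: `0` if `f` is not absolutely irreducible, and otherwise the
product of `exp(log p / p)` over the primes `p > 27 d^4` (where `d = deg f`) modulo
which `f` is not irreducible over the algebraic closure of `F_p`. -/
noncomputable def badness {σ : Type*} (f : MvPolynomial σ ℤ) : ℝ :=
  if Irreducible (MvPolynomial.map (Int.castRingHom (AlgebraicClosure ℚ)) f) then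
    ∏ᶠ p ∈ {p : ℕ | ∃ hp : Nat.Prime p,
        27 * f.totalDegree ^ 4 < p ∧
        ¬ Irreducible (letI : Fact (Nat.Prime p) := ⟨hp⟩;
          MvPolynomial.map (Int.castRingHom (AlgebraicClosure (ZMod p))) f)},
      Real.exp (Real.log p / p)
  else 0


-- part A1
section
open MvPolynomial
namespace PAC

/-- exponents of total degree at most `n` in two variables -/
noncomputable def TT (n : ℕ) : Finset (Fin 2 →₀ ℕ) :=
  (Finset.range (n + 1)).sup (fun e => Finset.finsuppAntidiag Finset.univ e)

lemma mem_TT {n : ℕ} {m : Fin 2 →₀ ℕ} : m ∈ TT n ↔ m 0 + m 1 ≤ n := by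
  simp [TT, Finset.mem_sup, Fin.sum_univ_two]

lemma mem_TT' {n : ℕ} {m : Fin 2 →₀ ℕ} : m ∈ TT n ↔ m.degree ≤ n := by
  rw [mem_TT, Finsupp.degree_eq_sum, Fin.sum_univ_two]

lemma TT_mono {a b : ℕ} (h : a ≤ b) : TT a ⊆ TT b := by
  intro m hm
  rw [mem_TT] at *
  omega

noncomputable def ex (i j : ℕ) : Fin 2 →₀ ℕ := Finsupp.single 0 i + Finsupp.single 1 j
@[simp] lemma ex_zero (i j : ℕ) : ex i j 0 = i := by simp [ex]
@[simp] lemma ex_one (i j : ℕ) : ex i j 1 = j := by simp [ex]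
lemma ex_eta (m : Fin 2 →₀ ℕ) : ex (m 0) (m 1) = m := by
  ext i; fin_cases i <;> simp
lemma ext2 {m n : Fin 2 →₀ ℕ} (h0 : m 0 = n 0) (h1 : m 1 = n 1) : m = n := by
  ext i; fin_cases i <;> assumption

lemma sum_TT {M : Type*} [AddCommMonoid M] (n : ℕ) (F : (Fin 2 →₀ ℕ) → M) :
    ∑ m ∈ TT n, F m = ∑ e ∈ Finset.range (n + 1), ∑ i ∈ Finset.range (e + 1), F (ex i (e - i)) := by
  rw [Finset.sum_sigma']
  symm
  refine Finset.sum_bij (fun x _ => ex x.2 (x.1 - x.2)) ?_ ?_ ?_ ?_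
  · rintro ⟨a, b⟩ h
    simp only [Finset.mem_sigma, Finset.mem_range] at h
    rw [mem_TT]; simp; omega
  · rintro ⟨a, b⟩ h ⟨a', b'⟩ h' e
    simp only [Finset.mem_sigma, Finset.mem_range] at h h'
    have h0 := DFunLike.congr_fun e 0
    have h1 := DFunLike.congr_fun e 1
    simp at h0 h1
    obtain rfl : b = b' := h0
    have : a = a' := by omega
    subst this; rfl
  · intro m hm
    rw [mem_TT] at hm
    refine ⟨⟨m 0 + m 1, m 0⟩, ?_, ?_⟩
    · simp; omega
    · apply ext2 <;> simp
  · intros; rfl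

lemma card_TT (n : ℕ) : 2 * (TT n).card = (n + 1) * (n + 2) := by
  rw [Finset.card_eq_sum_ones, sum_TT]
  simp only [Finset.sum_const, Finset.card_range, smul_eq_mul, mul_one]
  induction n with
  | zero => simp
  | succ n ih => rw [Finset.sum_range_succ, mul_add, ih]; ring

variable {k : Type*} [Field k]

noncomputable abbrev RR (k : Type*) [CommSemiring k] (n : ℕ) := restrictTotalDegree (Fin 2) k n

lemma mem_RR {k : Type*} [CommSemiring k] {n : ℕ} {p : MvPolynomial (Fin 2) k} :
    p ∈ RR k n ↔ p.totalDegree ≤ n :=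
  mem_restrictTotalDegree _ _ _

lemma finrank_RR (n : ℕ) : Module.finrank k (RR k n) = (TT n).card := by
  refine (Module.finrank_eq_nat_card_basis (basisRestrictSupport k {n_1 : Fin 2 →₀ ℕ | (n_1.sum fun _ e => e) ≤ n})).trans ?_
  rw [← Nat.card_eq_finsetCard]
  apply Nat.card_congr
  apply Equiv.subtypeEquivRight
  intro x
  rw [mem_TT', Finsupp.degree_eq_sum]
  simp only [Set.mem_setOf_eq]
  rw [Finsupp.sum_fintype]
  simp

/-- multiplication by `f` from degree `a` to degree `b`. -/
noncomputable def mulR (f : MvPolynomial (Fin 2) k) (a b : ℕ) (h : f.totalDegree + a ≤ b) :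
    RR k a →ₗ[k] RR k b :=
  (LinearMap.mulLeft k f).restrict (fun g hg => by
    rw [mem_RR] at *
    exact (totalDegree_mul _ _).trans (by omega))

@[simp] lemma mulR_coe (f : MvPolynomial (Fin 2) k) (a b : ℕ) (h : f.totalDegree + a ≤ b)
    (g : RR k a) : ((mulR f a b h g : RR k b) : MvPolynomial (Fin 2) k) = f * g := rfl

lemma mulR_injective (f : MvPolynomial (Fin 2) k) (a b : ℕ) (h : f.totalDegree + a ≤ b) (hf : f ≠ 0) :
    Function.Injective (mulR f a b h) := by
  intro x y hxy
  have := congrArg Subtype.val hxy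
  simp only [mulR_coe] at this
  exact Subtype.ext (mul_left_cancel₀ hf this)

lemma bezout_arith (n d m e a b c : ℕ) (hn : d + m ≤ n) (r1 : e + a = (TT n).card)
    (r2 : b + c = (TT (n - d)).card + (TT (n - m)).card) (r3 : b ≤ a)
    (r4 : c ≤ (TT (n - d - m)).card) : e ≤ d * m := by
  have c1 := card_TT n
  have c2 := card_TT (n - d)
  have c3 := card_TT (n - m)
  have c4 := card_TT (n - d - m)
  obtain ⟨t, rfl⟩ := Nat.exists_eq_add_of_le hn
  have e1 : d + m + t - d = m + t := by omega
  have e2 : d + m + t - m = d + t := by omega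
  have e3 : m + t - m = t := by omega
  simp only [e1, e2, e3] at *
  nlinarith

theorem bezout_functional {f h : MvPolynomial (Fin 2) k} (hf : Irreducible f) (hfh : ¬ f ∣ h)
    {E : Type*} [AddCommGroup E] [Module k E] [FiniteDimensional k E]
    (φ : MvPolynomial (Fin 2) k →ₗ[k] E) (hφ : Function.Surjective φ)
    (h1 : ∀ g, φ (f * g) = 0) (h2 : ∀ g, φ (h * g) = 0) :
    Module.finrank k E ≤ f.totalDegree * h.totalDegree := by
  set d := f.totalDegree with hd
  set m := h.totalDegree with hm
  have hf0 : f ≠ 0 := hf.ne_zero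
  have hh0 : h ≠ 0 := fun h0 => hfh (h0 ▸ dvd_zero f)
  let b := Module.finBasis k E
  choose G hG using fun i => hφ (b i)
  set n := d + m + Finset.univ.sup (fun i => (G i).totalDegree) with hn
  have hGn : ∀ i, (G i).totalDegree ≤ n := fun i =>
    (Finset.le_sup (f := fun i => (G i).totalDegree) (Finset.mem_univ i)).trans (by omega)
  let φ' : RR k n →ₗ[k] E := φ ∘ₗ (RR k n).subtype
  have hφ' : LinearMap.range φ' = ⊤ := by
    rw [eq_top_iff, ← b.span_eq, Submodule.span_le]
    rintro _ ⟨i, rfl⟩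
    exact ⟨⟨G i, mem_RR.2 (hGn i)⟩, hG i⟩
  let ψ : (RR k (n - d) × RR k (n - m)) →ₗ[k] RR k n :=
    (mulR f (n - d) n (by omega)).coprod (mulR h (n - m) n (by omega))
  have hψ : LinearMap.range ψ ≤ LinearMap.ker φ' := by
    rintro _ ⟨⟨a, c⟩, rfl⟩
    simp [ψ, φ', h1, h2]
  let χ : RR k (n - d - m) →ₗ[k] (RR k (n - d) × RR k (n - m)) :=
    (-(mulR h (n - d - m) (n - d) (by omega))).prod (mulR f (n - d - m) (n - m) (by omega))
  have hχ : LinearMap.ker ψ ≤ LinearMap.range χ := by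
    rintro ⟨a, c⟩ hac
    have e : f * (a : MvPolynomial (Fin 2) k) + h * c = 0 := by
      have := congrArg Subtype.val (LinearMap.mem_ker.1 hac)
      simpa [ψ] using this
    have hdv : f ∣ h * c := by
      rw [eq_neg_of_add_eq_zero_right e]; exact (dvd_mul_right _ _).neg_right
    obtain ⟨q, hq⟩ := (hf.prime.dvd_or_dvd hdv).resolve_left hfh
    have hqd : q.totalDegree ≤ n - d - m := by
      by_cases hq0 : q = 0
      · simp [hq0]
      · have := mem_RR.1 c.2
        rw [hq, totalDegree_mul_of_isDomain hf0 hq0] at this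
        omega
    refine ⟨⟨q, mem_RR.2 hqd⟩, ?_⟩
    have ha : (a : MvPolynomial (Fin 2) k) = - (h * q) := by
      apply mul_left_cancel₀ hf0
      rw [eq_neg_of_add_eq_zero_left e, hq]; ring
    ext1
    · apply Subtype.ext; simp [χ, ha]
    · apply Subtype.ext; simp [χ, hq]
  have r1 := φ'.finrank_range_add_finrank_ker
  have r2 := ψ.finrank_range_add_finrank_ker
  have r3 := Submodule.finrank_mono hψ
  have r4 := (Submodule.finrank_mono hχ).trans (LinearMap.finrank_range_le χ)
  rw [hφ', finrank_top, finrank_RR] at r1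
  rw [Module.finrank_prod, finrank_RR, finrank_RR] at r2
  rw [finrank_RR] at r4
  exact bezout_arith n d m _ _ _ _ (by omega) r1 r2 r3 r4

lemma exists_linear_sep {P Q : Fin 2 → k} (h : P ≠ Q) :
    ∃ l : MvPolynomial (Fin 2) k, eval P l ≠ 0 ∧ eval Q l = 0 := by
  obtain ⟨i, hi⟩ := Function.ne_iff.1 h
  exact ⟨X i - C (Q i), by simpa [sub_eq_zero] using hi, by simp⟩

lemma exists_sep (S : Finset (Fin 2 → k)) (P : Fin 2 → k) :
    ∃ l : MvPolynomial (Fin 2) k, eval P l ≠ 0 ∧ ∀ Q ∈ S, Q ≠ P → eval Q l = 0 := by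
  classical
  choose l hl hl' using fun (Q : {Q : Fin 2 → k // Q ≠ P}) => exists_linear_sep Q.2.symm
  refine ⟨∏ Q ∈ S.subtype (fun Q => Q ≠ P), l Q, ?_, ?_⟩
  · rw [map_prod, Finset.prod_ne_zero_iff]
    exact fun Q _ => hl Q
  · intro Q hQ hQP
    rw [map_prod]
    exact Finset.prod_eq_zero (i := ⟨Q, hQP⟩) (by simpa using hQ) (hl' ⟨Q, hQP⟩)

theorem bezout_points {f h : MvPolynomial (Fin 2) k} (hf : Irreducible f) (hfh : ¬ f ∣ h)
    (S : Finset (Fin 2 → k)) (hS : ∀ P ∈ S, eval P f = 0 ∧ eval P h = 0) :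
    S.card ≤ f.totalDegree * h.totalDegree := by
  classical
  let φ : MvPolynomial (Fin 2) k →ₗ[k] (S → k) :=
    LinearMap.pi (fun P => (aeval (P : Fin 2 → k)).toLinearMap)
  have hφ : ∀ g P, φ g P = eval (P : Fin 2 → k) g := fun g P => by
    simp [φ, coe_aeval_eq_eval]
  have := bezout_functional hf hfh φ ?_ ?_ ?_
  · simpa using this
  · intro v
    choose l hl hl' using fun P : S => exists_sep S P
    refine ⟨∑ P : S, C (v P / eval (P : Fin 2 → k) (l P)) * l P, ?_⟩
    ext Q
    rw [hφ, map_sum, Finset.sum_eq_single Q]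
    · simp [hl Q]
    · intro P _ hPQ
      rw [map_mul, hl' P Q Q.2 (fun e => hPQ (Subtype.ext e.symm)), mul_zero]
    · simp
  · intro g; ext P; rw [hφ]; simp [(hS P P.2).1]
  · intro g; ext P; rw [hφ]; simp [(hS P P.2).2]
end PAC
end

-- part A2
section
open MvPolynomial
namespace PAC

section der
variable {k : Type*} [Field k] (D : Derivation k (MvPolynomial (Fin 2) k) (MvPolynomial (Fin 2) k))

/-- vanishing to order `n` at `P` along the derivation -/
def Van (P : Fin 2 → k) (n : ℕ) (g : MvPolynomial (Fin 2) k) : Prop :=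
  ∀ j < n, eval P (D^[j] g) = 0

lemma iter_add (j : ℕ) (g h : MvPolynomial (Fin 2) k) : D^[j] (g + h) = D^[j] g + D^[j] h := by
  induction j generalizing g h with
  | zero => rfl
  | succ j ih => simp only [Function.iterate_succ_apply, map_add, ih]

lemma iter_smul (j : ℕ) (c : k) (g : MvPolynomial (Fin 2) k) : D^[j] (c • g) = c • D^[j] g := by
  induction j generalizing g with
  | zero => rfl
  | succ j ih => simp only [Function.iterate_succ_apply, Derivation.map_smul, ih]

/-- iterate of the derivation as a linear map -/
noncomputable def iterL (j : ℕ) : MvPolynomial (Fin 2) k →ₗ[k] MvPolynomial (Fin 2) k where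
  toFun := D^[j]
  map_add' := iter_add D j
  map_smul' := iter_smul D j

variable {D}

lemma Van.add {P : Fin 2 → k} {n : ℕ} {g h : MvPolynomial (Fin 2) k} (hg : Van D P n g)
    (hh : Van D P n h) : Van D P n (g + h) := fun j hj => by
  rw [iter_add, map_add, hg j hj, hh j hj, add_zero]

lemma Van.mono {P : Fin 2 → k} {n m : ℕ} {g : MvPolynomial (Fin 2) k} (hg : Van D P n g)
    (h : m ≤ n) : Van D P m g := fun j hj => hg j (hj.trans_le h)

lemma van_succ {P : Fin 2 → k} {n : ℕ} {g : MvPolynomial (Fin 2) k} :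
    Van D P (n + 1) g ↔ eval P g = 0 ∧ Van D P n (D g) := by
  constructor
  · intro h
    refine ⟨h 0 (by omega), fun j hj => ?_⟩
    have := h (j + 1) (by omega)
    rwa [Function.iterate_succ_apply] at this
  · rintro ⟨h0, h1⟩ j hj
    cases j with
    | zero => exact h0
    | succ j => rw [Function.iterate_succ_apply]; exact h1 j (by omega)

lemma Van.mul {P : Fin 2 → k} {n : ℕ} : ∀ {a b : ℕ} {g h : MvPolynomial (Fin 2) k},
    n = a + b → Van D P a g → Van D P b h → Van D P n (g * h) := by
  induction n with
  | zero => intro a b g h _ _ _ j hj; omega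
  | succ n ih =>
    intro a b g h hn hg hh
    rw [van_succ]
    constructor
    · rw [map_mul]
      rcases Nat.eq_zero_or_pos a with rfl | ha
      · have := hh 0 (by omega)
        simp only [Function.iterate_zero, id] at this
        rw [this, mul_zero]
      · have := hg 0 (by omega)
        simp only [Function.iterate_zero, id] at this
        rw [this, zero_mul]
    · rw [Derivation.leibniz, smul_eq_mul, smul_eq_mul]
      refine Van.add ?_ ?_
      · rcases Nat.eq_zero_or_pos b with rfl | hb
        · exact ih (a := n) (b := 0) (by omega) (hg.mono (by omega)) (fun j hj => by omega)
        · obtain ⟨b, rfl⟩ := Nat.exists_eq_succ_of_ne_zero hb.ne'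
          exact ih (by omega) hg (van_succ.1 hh).2
      · rcases Nat.eq_zero_or_pos a with rfl | ha
        · exact ih (a := n) (b := 0) (by omega) (hh.mono (by omega)) (fun j hj => by omega)
        · obtain ⟨a, rfl⟩ := Nat.exists_eq_succ_of_ne_zero ha.ne'
          exact ih (a := b) (b := a) (by omega) hh (van_succ.1 hg).2

lemma Van.pow {P : Fin 2 → k} {g : MvPolynomial (Fin 2) k} (hg : eval P g = 0) (n : ℕ) :
    Van D P n (g ^ n) := by
  induction n with
  | zero => intro j hj; omega
  | succ n ih =>
    rw [pow_succ]
    refine Van.mul rfl ih ?_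
    intro j hj
    obtain rfl : j = 0 := by omega
    exact hg

lemma Van.mul_right {P : Fin 2 → k} {n : ℕ} {g : MvPolynomial (Fin 2) k} (hg : Van D P n g)
    (h : MvPolynomial (Fin 2) k) : Van D P n (g * h) :=
  Van.mul (a := n) (b := 0) rfl hg (fun j hj => by omega)

lemma eval_iter_pow {P : Fin 2 → k} {l : MvPolynomial (Fin 2) k} (hl : eval P l = 0) (i : ℕ)
    (c : MvPolynomial (Fin 2) k) :
    eval P (D^[i] (l ^ i * c)) = (i.factorial : k) * (eval P (D l)) ^ i * eval P c := by
  induction i generalizing c with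
  | zero => simp
  | succ i ih =>
    have e : D (l ^ (i + 1) * c) = ((i + 1 : ℕ) : k) • (l ^ i * (D l * c)) + l ^ i * (l * D c) := by
      rw [Derivation.leibniz, Derivation.leibniz_pow]
      simp only [smul_eq_mul, nsmul_eq_mul, Nat.add_sub_cancel, MvPolynomial.smul_eq_C_mul]
      push_cast
      simp only [map_add, map_natCast, map_one]
      ring
    rw [Function.iterate_succ_apply, e, iter_add, iter_smul, map_add, smul_eval, ih, ih]
    simp only [map_mul, hl, Nat.factorial_succ]
    push_cast
    ring

lemma iter_mul_of_const {f : MvPolynomial (Fin 2) k} (hf : D f = 0) (i : ℕ)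
    (g : MvPolynomial (Fin 2) k) : D^[i] (f * g) = f * D^[i] g := by
  induction i generalizing g with
  | zero => rfl
  | succ i ih =>
    rw [Function.iterate_succ_apply, Derivation.leibniz, hf, smul_zero, add_zero, smul_eq_mul, ih,
      Function.iterate_succ_apply]

theorem bezout_mult_der {f h : MvPolynomial (Fin 2) k} (hf : Irreducible f) (hfh : ¬ f ∣ h)
    (hD : D f = 0) (M : ℕ) (hM : ∀ n : ℕ, 0 < n → n < M → (n : k) ≠ 0)
    (S : Finset (Fin 2 → k))
    (hS : ∀ P ∈ S, eval P f = 0 ∧ (∃ j, eval P (D (X j)) ≠ 0) ∧ Van D P M h) :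
    S.card * M ≤ f.totalDegree * h.totalDegree := by
  classical
  let φ : MvPolynomial (Fin 2) k →ₗ[k] (S × Fin M → k) :=
    LinearMap.pi (fun q => (aeval (q.1 : Fin 2 → k)).toLinearMap ∘ₗ iterL D (q.2 : ℕ))
  have hφ : ∀ g q, φ g q = eval (q.1 : Fin 2 → k) (D^[(q.2 : ℕ)] g) := fun g P => by
    simp [φ, iterL]
  have hfac : ∀ n < M, (n.factorial : k) ≠ 0 := by
    intro n
    induction n with
    | zero => simp
    | succ n ih =>
      intro hn
      rw [Nat.factorial_succ, Nat.cast_mul]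
      exact mul_ne_zero (hM _ (by omega) hn) (ih (by omega))
  have := bezout_functional hf hfh φ ?_ ?_ ?_
  · simpa using this
  · rw [← LinearMap.range_eq_top, eq_top_iff]
    have key : ∀ n : ℕ, ∀ q : S × Fin M, M ≤ n + (q.2 : ℕ) →
        Pi.single q (1 : k) ∈ LinearMap.range φ := by
      intro n
      induction n with
      | zero => intro q hq; have := q.2.2; omega
      | succ n ih =>
        rintro ⟨P, i⟩ hq
        simp only at hq
        obtain ⟨hP0, ⟨j, hj⟩, -⟩ := hS P P.2
        obtain ⟨L, hL, hL'⟩ := exists_sep S (P : Fin 2 → k)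
        set l : MvPolynomial (Fin 2) k := X j - C ((P : Fin 2 → k) j) with hl
        have hDl : D l = D (X j) := by
          rw [hl, map_sub, MvPolynomial.derivation_C, sub_zero]
        have hlP : eval (P : Fin 2 → k) l = 0 := by simp [hl]
        set g := l ^ (i : ℕ) * L ^ M with hg
        have h1 : ∀ q : S × Fin M, q.1 ≠ P → φ g q = 0 := by
          intro q hq
          rw [hφ, hg, mul_comm]
          exact (Van.pow (hL' q.1 q.1.2 (fun e => hq (Subtype.ext e))) M).mul_right _ _ q.2.2
        have h2 : ∀ q : S × Fin M, q.1 = P → q.2 < i → φ g q = 0 := by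
          rintro ⟨q, j⟩ rfl hj
          rw [hφ, hg]
          exact (Van.pow hlP (i : ℕ)).mul_right _ _ hj
        have h3 : φ g (P, i) ≠ 0 := by
          rw [hφ, hg]
          simp only
          rw [eval_iter_pow hlP, hDl, map_pow]
          exact mul_ne_zero (mul_ne_zero (hfac _ i.2) (pow_ne_zero _ hj)) (pow_ne_zero _ hL)
        have h4 : φ g = (φ g (P, i)) • Pi.single (P, i) (1 : k) +
            ∑ j ∈ Finset.univ.filter (fun j => i < j), (φ g (P, j)) • Pi.single (P, j) (1 : k) := by
          ext ⟨Q, j⟩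
          simp only [Pi.add_apply, Pi.smul_apply, Finset.sum_apply, smul_eq_mul, Pi.single_apply,
            Prod.mk.injEq]
          by_cases hQ : Q = P
          · subst hQ
            rcases lt_trichotomy j i with hji | hji | hji
            · rw [h2 (Q, j) rfl hji, Finset.sum_eq_zero, if_neg (by simp [hji.ne])]
              · simp
              · intro x hx
                rw [if_neg, mul_zero]
                simp only [Finset.mem_filter] at hx
                rintro ⟨_, rfl⟩
                exact absurd hx.2 (not_lt.2 hji.le)
            · subst hji
              rw [Finset.sum_eq_zero]
              · simp
              · intro x hx
                rw [if_neg, mul_zero]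
                simp only [Finset.mem_filter] at hx
                rintro ⟨_, rfl⟩
                exact absurd hx.2 (lt_irrefl _)
            · rw [if_neg (by simp [hji.ne']), Finset.sum_eq_single j]
              · simp
              · intro b _ hb
                rw [if_neg (by simp [hb.symm]), mul_zero]
              · intro hn; simp [hji] at hn
          · rw [h1 (Q, j) hQ]
            simp [hQ]
        have h5 : Pi.single (P, i) (1 : k) = (φ g (P, i))⁻¹ • (φ g -
            ∑ j ∈ Finset.univ.filter (fun j => i < j), (φ g (P, j)) • Pi.single (P, j) (1 : k)) := by
          rw [sub_eq_of_eq_add h4, smul_smul, inv_mul_cancel₀ h3, one_smul]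
        rw [h5]
        refine Submodule.smul_mem _ _ (Submodule.sub_mem _ ⟨g, rfl⟩ (Submodule.sum_mem _ ?_))
        intro j hj
        simp only [Finset.mem_filter, Finset.mem_univ, true_and] at hj
        refine Submodule.smul_mem _ _ (ih (P, j) ?_)
        have : (i : ℕ) < j := hj
        simp only; omega
    intro v _
    rw [pi_eq_sum_univ' v]
    refine Submodule.sum_mem _ (fun q _ => Submodule.smul_mem _ _ ?_)
    have := key M q (by omega)
    convert this using 1
  · intro g; ext q; rw [hφ, iter_mul_of_const hD]; simp [(hS q.1 q.1.2).1]
  · intro g; ext q; rw [hφ]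
    exact (hS q.1 q.1.2).2.2.mul_right g _ q.2.2

end der

section delta
variable {R : Type*} [CommRing R]

/-- the tangential derivation -/
noncomputable def delta (f : MvPolynomial (Fin 2) R) :
    Derivation R (MvPolynomial (Fin 2) R) (MvPolynomial (Fin 2) R) :=
  (pderiv 1 f) • pderiv 0 - (pderiv 0 f) • pderiv 1

lemma delta_apply (f g : MvPolynomial (Fin 2) R) :
    delta f g = pderiv 1 f * pderiv 0 g - pderiv 0 f * pderiv 1 g := rfl

lemma delta_self (f : MvPolynomial (Fin 2) R) : delta f f = 0 := by
  rw [delta_apply]; ring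

lemma delta_X0 (f : MvPolynomial (Fin 2) R) : delta f (X 0) = pderiv 1 f := by
  rw [delta_apply, pderiv_X_self, pderiv_X_of_ne (by decide)]; ring

lemma delta_X1 (f : MvPolynomial (Fin 2) R) : delta f (X 1) = - pderiv 0 f := by
  rw [delta_apply, pderiv_X_self, pderiv_X_of_ne (by decide)]; ring

lemma totalDegree_pderiv_le (i : Fin 2) (f : MvPolynomial (Fin 2) R) :
    (pderiv i f).totalDegree ≤ f.totalDegree - 1 := by
  classical
  rw [f.as_sum, map_sum]
  refine (totalDegree_finsetSum _ _).trans (Finset.sup_le fun m hm => ?_)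
  rw [pderiv_monomial]
  have h1 := le_totalDegree hm
  rw [← f.as_sum]
  by_cases h0 : m i = 0
  · simp [h0]
  · refine (totalDegree_monomial_le _ _).trans ?_
    rw [Finsupp.sum_fintype _ _ (by simp)] at h1 ⊢
    simp only [Fin.sum_univ_two] at *
    fin_cases i <;> simp at * <;> omega

/-- a nonzero partial exists -/
lemma exists_pderiv_ne_zero {k : Type*} [Field k] {f : MvPolynomial (Fin 2) k}
    (hd : f.totalDegree ≠ 0) (hn : ∀ n : ℕ, 0 < n → n ≤ f.totalDegree → (n : k) ≠ 0) :
    ∃ i, pderiv i f ≠ 0 := by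
  classical
  by_contra hcon
  push Not at hcon
  apply hd
  have : ∀ m ∈ f.support, m = 0 := by
    intro m hm
    by_contra h0
    obtain ⟨i, hi⟩ : ∃ i, m i ≠ 0 := by
      by_contra h; push Not at h; exact h0 (Finsupp.ext h)
    have h1 := congrArg (coeff (m - Finsupp.single i 1)) (hcon i)
    rw [coeff_zero, MvPolynomial.coeff_pderiv] at h1
    have h2 : m - Finsupp.single i 1 + Finsupp.single i 1 = m :=
      tsub_add_cancel_of_le (by
        rw [Finsupp.single_le_iff]; omega)
    rw [h2] at h1
    rcases mul_eq_zero.1 h1 with h | h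
    · exact mem_support_iff.1 hm h
    · refine hn (m i) (by omega) ?_ ?_
      · refine le_trans ?_ (le_totalDegree hm)
        rw [Finsupp.sum_fintype _ _ (by simp)]
        exact Finset.single_le_sum (f := fun i => m i) (fun _ _ => Nat.zero_le _) (Finset.mem_univ i)
      · rw [← h]
        have : m i = (m i - 1) + 1 := by omega
        conv_lhs => rw [this]
        push_cast
        simp
  rw [totalDegree_eq_zero_iff]
  intro m hm i
  rw [this m hm]; rfl

lemma totalDegree_delta_le (f g : MvPolynomial (Fin 2) R) :
    (delta f g).totalDegree ≤ (f.totalDegree - 1) + (g.totalDegree - 1) := by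
  rw [delta_apply]
  refine (totalDegree_sub _ _).trans (max_le ?_ ?_) <;>
  exact (totalDegree_mul _ _).trans (add_le_add (totalDegree_pderiv_le _ _) (totalDegree_pderiv_le _ _))

lemma totalDegree_delta_iter_le (f g : MvPolynomial (Fin 2) R) (i : ℕ) :
    ((delta f)^[i] g).totalDegree ≤ g.totalDegree + i * f.totalDegree := by
  induction i with
  | zero => simp
  | succ i ih =>
    rw [Function.iterate_succ_apply']
    refine (totalDegree_delta_le _ _).trans ?_
    rw [Nat.succ_mul]; omega

end delta

theorem bezout_mult {k : Type*} [Field k] {f h : MvPolynomial (Fin 2) k} (hf : Irreducible f)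
    (hfh : ¬ f ∣ h) (M : ℕ) (hM : ∀ n : ℕ, 0 < n → n < M → (n : k) ≠ 0)
    (S : Finset (Fin 2 → k))
    (hS : ∀ P ∈ S, eval P f = 0 ∧ (∃ j, eval P (pderiv j f) ≠ 0) ∧ Van (delta f) P M h) :
    S.card * M ≤ f.totalDegree * h.totalDegree := by
  refine bezout_mult_der hf hfh (delta_self f) M hM S (fun P hP => ?_)
  obtain ⟨h1, ⟨j, hj⟩, h2⟩ := hS P hP
  refine ⟨h1, ?_, h2⟩
  fin_cases j
  · exact ⟨1, by rw [delta_X1]; simpa using hj⟩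
  · exact ⟨0, by rw [delta_X0]; simpa using hj⟩
end PAC
end

-- part W1
section
open MvPolynomial
namespace PAC

/-- dimension of the degree `n` part of the coordinate ring of a curve of degree `e` -/
noncomputable def AA (e n : ℕ) : ℕ := (TT n).card - (TT (n - e)).card

lemma AA_eq {e n : ℕ} (h : e ≤ n) : 2 * AA e n + e * e = e * (2 * n + 3) := by
  have c1 := card_TT n
  have c2 := card_TT (n - e)
  have c3 := Finset.card_le_card (TT_mono (Nat.sub_le n e))
  unfold AA
  obtain ⟨t, rfl⟩ := Nat.exists_eq_add_of_le h
  simp only [Nat.add_sub_cancel_left] at *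
  zify [c3]
  zify at c1 c2
  nlinarith

lemma totalDegree_map_le' {R S : Type*} [CommSemiring R] [CommSemiring S] (g : R →+* S)
    (f : MvPolynomial (Fin 2) R) : (map g f).totalDegree ≤ f.totalDegree :=
  Finset.sup_mono (support_map_subset _ _)

section
variable {k : Type*} [Field k] (f : MvPolynomial (Fin 2) k)

/-- the quotient -/
abbrev QQ (n : ℕ) (h : f.totalDegree ≤ n) : Type _ :=
  RR k n ⧸ LinearMap.range (mulR f (n - f.totalDegree) n (by omega))

lemma finrank_QQ (hf : f ≠ 0) (n : ℕ) (h : f.totalDegree ≤ n) :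
    Module.finrank k (QQ f n h) = AA f.totalDegree n := by
  rw [Submodule.finrank_quotient, LinearMap.finrank_range_of_inj (mulR_injective _ _ _ _ hf),
    finrank_RR, finrank_RR, AA]

lemma QQ_mk_eq_zero_iff (hf : f ≠ 0) (n : ℕ) (h : f.totalDegree ≤ n) (g : RR k n) :
    (Submodule.Quotient.mk g : QQ f n h) = 0 ↔ f ∣ (g : MvPolynomial (Fin 2) k) := by
  rw [Submodule.Quotient.mk_eq_zero]
  constructor
  · rintro ⟨x, rfl⟩
    exact ⟨x, rfl⟩
  · rintro ⟨q, hq⟩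
    have hqd : q.totalDegree ≤ n - f.totalDegree := by
      by_cases hq0 : q = 0
      · simp [hq0]
      · have := mem_RR.1 g.2
        rw [hq, totalDegree_mul_of_isDomain hf hq0] at this
        omega
    exact ⟨⟨q, mem_RR.2 hqd⟩, Subtype.ext hq.symm⟩

lemma exists_indep_mod (hf : f ≠ 0) (n : ℕ) (h : f.totalDegree ≤ n) :
    ∃ u : Fin (AA f.totalDegree n) → MvPolynomial (Fin 2) k, (∀ a, (u a).totalDegree ≤ n) ∧
      ∀ c : Fin (AA f.totalDegree n) → k, f ∣ ∑ a, c a • u a → c = 0 := by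
  let b : Module.Basis (Fin (AA f.totalDegree n)) k (QQ f n h) :=
    (Module.finBasisOfFinrankEq k (QQ f n h) (finrank_QQ f hf n h))
  choose u hu using fun a => Submodule.Quotient.mk_surjective _ (b a)
  refine ⟨fun a => u a, fun a => mem_RR.1 (u a).2, fun c hc => ?_⟩
  have h1 : (Submodule.Quotient.mk (∑ a, c a • u a) : QQ f n h) = 0 := by
    rw [QQ_mk_eq_zero_iff f hf n h]
    simpa using hc
  have h2 : ∑ a, c a • b a = 0 := by
    rw [← h1]
    rw [← Submodule.mkQ_apply, map_sum]
    refine Finset.sum_congr rfl (fun a _ => ?_)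
    rw [map_smul, Submodule.mkQ_apply, hu]
  funext a
  exact Fintype.linearIndependent_iff.1 b.linearIndependent c h2 a

end

section
variable {k : Type*} [Field k] [IsAlgClosed k] {p : ℕ} [Fact p.Prime] [CharP k p]

lemma dvd_of_vanish {f w : MvPolynomial (Fin 2) k} (hf : Irreducible f)
    (h : ∀ P, eval P f = 0 → eval P w = 0) : f ∣ w := by
  have hp : (Ideal.span {f}).IsPrime := (Ideal.span_singleton_prime hf.ne_zero).2 hf.prime
  have h1 := MvPolynomial.IsPrime.vanishingIdeal_zeroLocus (K := k) (Ideal.span {f})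
  rw [← Ideal.mem_span_singleton, ← h1, mem_vanishingIdeal_iff]
  intro P hP
  have := (mem_zeroLocus_iff.1 hP) f (Ideal.mem_span_singleton_self f)
  simpa using h P (by simpa using this)

lemma delta_pow_char (f g h : MvPolynomial (Fin 2) k) : delta f (g * h ^ p) = delta f g * h ^ p := by
  rw [Derivation.leibniz, Derivation.leibniz_pow]
  have : (p : MvPolynomial (Fin 2) k) = 0 := by
    rw [← map_natCast (C : k →+* MvPolynomial (Fin 2) k), CharP.cast_eq_zero, map_zero]
  simp [smul_eq_mul, nsmul_eq_mul, this, mul_comm]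

lemma delta_iter_pow_char (f g h : MvPolynomial (Fin 2) k) (i : ℕ) :
    (delta f)^[i] (g * h ^ p) = (delta f)^[i] g * h ^ p := by
  induction i generalizing g with
  | zero => rfl
  | succ i ih => rw [Function.iterate_succ_apply, delta_pow_char, ih, Function.iterate_succ_apply]

lemma not_dvd_pderiv {k : Type*} [Field k] {f : MvPolynomial (Fin 2) k} (hd : f.totalDegree ≠ 0) {j : Fin 2}
    (hj : pderiv j f ≠ 0) : ¬ f ∣ pderiv j f := by
  rintro ⟨q, hq⟩
  have hf0 : f ≠ 0 := by rintro rfl; simp at hd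
  have hq0 : q ≠ 0 := by rintro rfl; simp [hq] at hj
  have := totalDegree_pderiv_le j f
  rw [hq, totalDegree_mul_of_isDomain hf0 hq0] at this
  omega

lemma exists_relation {k : Type*} [Field k] {ι : Type*} [Fintype ι] {M : ℕ} (E : Fin M → Type*)
    [∀ i, AddCommGroup (E i)] [∀ i, Module k (E i)] [∀ i, FiniteDimensional k (E i)]
    (w : ∀ i, ι → E i) (h : ∑ i, Module.finrank k (E i) < Fintype.card ι) :
    ∃ c : ι → k, c ≠ 0 ∧ ∀ i, ∑ a, c a • w i a = 0 := by
  let Ψ : (ι → k) →ₗ[k] (∀ i, E i) := Fintype.linearCombination k (fun a i => w i a)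
  have hker : LinearMap.ker Ψ ≠ ⊥ := by
    apply LinearMap.ker_ne_bot_of_finrank_lt
    rw [Module.finrank_pi_fintype k]
    simpa using h
  obtain ⟨c, hc, hc0⟩ := Submodule.exists_mem_ne_zero_of_ne_bot hker
  refine ⟨c, hc0, fun i => ?_⟩
  have h1 := congrFun (LinearMap.mem_ker.1 hc) i
  simpa [Ψ, Fintype.linearCombination_apply, Finset.sum_apply] using h1

set_option maxHeartbeats 1000000 in
theorem stepanov_core {f : MvPolynomial (Fin 2) k} (hf : Irreducible f) (hd0 : f.totalDegree ≠ 0)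
    (hdp : f.totalDegree < p) (m l M : ℕ) (hm : f.totalDegree ≤ m) (hl : f.totalDegree ≤ l)
    (hme : f.totalDegree * m < p) (hM : M ≤ p)
    (hdim : ∑ i : Fin M, AA f.totalDegree (m + l + (i : ℕ) * f.totalDegree) <
      AA f.totalDegree m * AA f.totalDegree l)
    (S : Finset (Fin 2 → k))
    (hS : ∀ P ∈ S, eval P f = 0 ∧ (∃ j, eval P (pderiv j f) ≠ 0) ∧ ∀ i, P i ^ p = P i) :
    S.card * M ≤ f.totalDegree * (m + p * l) := by
  classical
  have hcast : ∀ n : ℕ, 0 < n → n < p → (n : k) ≠ 0 := fun n h1 h2 h3 =>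
    absurd (Nat.le_of_dvd h1 ((CharP.cast_eq_zero_iff k p n).1 h3)) (by omega)
  obtain ⟨u, hu, hu'⟩ := exists_indep_mod f hf.ne_zero m hm
  obtain ⟨v, hv, hv'⟩ := exists_indep_mod f hf.ne_zero l hl
  let fr : k →+* k := frobenius k p
  let t : (i : Fin M) → (Fin (AA f.totalDegree m) × Fin (AA f.totalDegree l)) →
      RR k (m + l + (i : ℕ) * f.totalDegree) := fun i ab =>
    ⟨(delta f)^[(i : ℕ)] (u ab.1) * map fr (v ab.2), mem_RR.2 <| by
      refine (totalDegree_mul _ _).trans ?_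
      have h1 := totalDegree_delta_iter_le f (u ab.1) (i : ℕ)
      have h2 := hu ab.1
      have h3 := hv ab.2
      have h4 : (map fr (v ab.2)).totalDegree ≤ (v ab.2).totalDegree :=
        totalDegree_map_le' _ _
      omega⟩
  obtain ⟨c, hc0, hc⟩ := exists_relation (k := k)
    (fun i : Fin M => QQ f (m + l + (i : ℕ) * f.totalDegree) (by omega))
    (fun i ab => (Submodule.Quotient.mk (t i ab) :
      QQ f (m + l + (i : ℕ) * f.totalDegree) (by omega))) (by
        simp only [finrank_QQ f hf.ne_zero]
        simpa using hdim)
  have hcd : ∀ i : Fin M, f ∣ ∑ ab, c ab • ((delta f)^[(i : ℕ)] (u ab.1) * map fr (v ab.2)) := by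
    intro i
    have h2 : (Submodule.Quotient.mk (∑ ab, c ab • t i ab) :
      QQ f (m + l + (i : ℕ) * f.totalDegree) (by omega)) = 0 := by
      rw [← Submodule.mkQ_apply, map_sum]
      refine Eq.trans ?_ (hc i)
      refine Finset.sum_congr rfl (fun a _ => ?_)
      rw [map_smul, Submodule.mkQ_apply]
    rw [QQ_mk_eq_zero_iff f hf.ne_zero _ (by omega)] at h2
    simpa [t] using h2
  set G : MvPolynomial (Fin 2) k := ∑ ab, c ab • (u ab.1 * v ab.2 ^ p) with hG
  have hGdeg : G.totalDegree ≤ m + p * l := by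
    refine totalDegree_finsetSum_le (fun ab _ => (totalDegree_smul_le _ _).trans ?_)
    refine (totalDegree_mul _ _).trans (add_le_add (hu _) ((totalDegree_pow _ _).trans ?_))
    exact Nat.mul_le_mul_left _ (hv _)
  have hiter : ∀ i : ℕ, (delta f)^[i] G = ∑ ab, c ab • ((delta f)^[i] (u ab.1) * v ab.2 ^ p) := by
    intro i
    have := map_sum (iterL (delta f) i) (fun ab => c ab • (u ab.1 * v ab.2 ^ p)) Finset.univ
    refine this.trans (Finset.sum_congr rfl (fun ab _ => ?_))
    rw [map_smul]
    congr 1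
    exact delta_iter_pow_char f _ _ i
  have hnd : ¬ f ∣ G := by
    rintro ⟨G', hG'⟩
    obtain ⟨j, hj⟩ := exists_pderiv_ne_zero hd0 (fun n h1 h2 => hcast n h1 (by omega))
    have key : ∀ P, eval P f = 0 → eval P (pderiv j f) ≠ 0 → ∀ a,
        ∑ b, c (a, b) * eval P (v b) ^ p = 0 := by
      intro P hP hPj
      have hdv : f ∣ ∑ a, (∑ b, c (a, b) * eval P (v b) ^ p) • u a := by
        by_contra hnd
        have hb := bezout_mult hf hnd p hcast {P} ?_
        · rw [Finset.card_singleton, one_mul] at hb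
          have : (∑ a, (∑ b, c (a, b) * eval P (v b) ^ p) • u a).totalDegree ≤ m :=
            totalDegree_finsetSum_le (fun a _ => (totalDegree_smul_le _ _).trans (hu a))
          have := Nat.mul_le_mul_left f.totalDegree this
          omega
        · intro Q hQ
          rw [Finset.mem_singleton] at hQ
          subst hQ
          refine ⟨hP, ⟨j, hPj⟩, fun i _ => ?_⟩
          have e1 : eval Q ((delta f)^[i] G) = 0 := by
            rw [hG', iter_mul_of_const (delta_self f), map_mul, hP, zero_mul]
          rw [hiter] at e1
          have e2 := map_sum (iterL (delta f) i)
            (fun a => (∑ b, c (a, b) * eval Q (v b) ^ p) • u a) Finset.univ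
          have e3 : (delta f)^[i] (∑ a, (∑ b, c (a, b) * eval Q (v b) ^ p) • u a) =
             ∑ a, (∑ b, c (a, b) * eval Q (v b) ^ p) • (delta f)^[i] (u a) := by
            refine e2.trans (Finset.sum_congr rfl (fun ab _ => ?_))
            rw [map_smul]; rfl
          rw [e3, ← e1, map_sum, map_sum, Fintype.sum_prod_type]
          refine Finset.sum_congr rfl (fun a _ => ?_)
          rw [smul_eval, Finset.sum_mul]
          refine Finset.sum_congr rfl (fun b _ => ?_)
          simp only [smul_eval, map_mul, map_pow]
          ring
      intro a
      exact congrFun (hu' _ hdv) a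
    choose c' hc' using fun ab => IsAlgClosed.exists_pow_nat_eq (c ab) (Nat.Prime.pos (Fact.out : p.Prime))
    have hw : ∀ a, f ∣ ∑ b, c' (a, b) • v b := by
      intro a
      have h1 : f ∣ (∑ b, c' (a, b) • v b) * pderiv j f := by
        apply dvd_of_vanish hf
        intro P hP
        rw [map_mul]
        by_cases hPj : eval P (pderiv j f) = 0
        · rw [hPj, mul_zero]
        · have h2 := key P hP hPj a
          have h3 : (eval P (∑ b, c' (a, b) • v b)) ^ p = 0 := by
            rw [← h2, map_sum, sum_pow_char]
            refine Finset.sum_congr rfl (fun b _ => ?_)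
            rw [smul_eval, mul_pow, hc']
          rw [pow_eq_zero_iff (Nat.Prime.ne_zero (Fact.out : p.Prime))] at h3
          rw [h3, zero_mul]
      exact (hf.prime.dvd_or_dvd h1).resolve_right (not_dvd_pderiv hd0 hj)
    apply hc0
    funext ⟨a, b⟩
    have := congrFun (hv' (fun b => c' (a, b)) (hw a)) b
    rw [← hc' (a, b)]
    simp only [Pi.zero_apply] at this ⊢
    rw [this, zero_pow (Nat.Prime.ne_zero (Fact.out : p.Prime))]
  refine (bezout_mult hf hnd M (fun n h1 h2 => hcast n h1 (by omega)) S ?_).trans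
    (Nat.mul_le_mul_left _ hGdeg)
  intro P hP
  obtain ⟨h1, h2, h3⟩ := hS P hP
  refine ⟨h1, h2, fun i hi => ?_⟩
  obtain ⟨q, hq⟩ := hcd ⟨i, hi⟩
  have h4 : eval P (∑ ab, c ab • ((delta f)^[i] (u ab.1) * map fr (v ab.2))) = 0 := by
    have := congrArg (eval P) hq
    rw [map_mul, h1, zero_mul] at this
    exact this
  rw [hiter, ← h4, map_sum, map_sum]
  refine Finset.sum_congr rfl (fun ab _ => ?_)
  simp only [smul_eval, map_mul, map_pow]
  congr 2
  have h5 : eval P (map fr (v ab.2)) = fr (eval P (v ab.2)) := by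
    have h6 : fr ∘ P = P := funext (fun i => h3 i)
    have h7 := map_eval fr P (v ab.2)
    rw [h6] at h7
    exact h7.symm
  rw [h5]; rfl

end
end PAC
end

-- part W2
section
open MvPolynomial
namespace PAC

lemma sum_AA (e n M : ℕ) (h : e ≤ n) :
    2 * (∑ i : Fin M, (AA e (n + (i : ℕ) * e) : ℤ)) = e * M * (2 * n + 3 - e) + e * e * (M * (M - 1)) := by
  rw [Fin.sum_univ_eq_sum_range (fun i => (AA e (n + i * e) : ℤ))]
  induction M with
  | zero => simp
  | succ M ih =>
    rw [Finset.sum_range_succ, mul_add, ih]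
    have := AA_eq (e := e) (n := n + M * e) (by nlinarith)
    zify at this
    push_cast
    nlinarith

lemma weil_arith (e t m l p q : ℤ) (he1 : 1 ≤ e) (ht0 : 0 ≤ t) (hq1 : q * q ≤ p) (hl1 : l * e ≤ q)
    (hm1 : m * (2 * e) ≤ p) (hm2 : p < (m + 1) * (2 * e)) (ht : l = 7 * e + t)
    (hpe : 10 ^ 6 * e ^ 2 ≤ p) (hml : e ≤ m) :
    2 * (e * (e * t) * (2 * (m + l) + 3 - e) + e * e * (e * t * (e * t - 1))) <
      e * (2 * m + 3 - e) * (e * (2 * l + 3 - e)) := by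
  have hee : (0 : ℤ) < e * e := by positivity
  have hl0 : 0 ≤ l := by omega
  have b1 : p ≤ e * (2 * m + 3 - e) * 2 := by nlinarith
  have ha0 : 0 < 2 * m + 3 - e := by omega
  have b2 : l ^ 2 * e ^ 2 ≤ p := by
    have : (l * e) ^ 2 ≤ q ^ 2 := pow_le_pow_left₀ (by positivity) hl1 2
    nlinarith
  have b3 : l ^ 2 ≤ l ^ 2 * e ^ 2 := by
    have : 1 ≤ e ^ 2 := by nlinarith
    nlinarith [sq_nonneg l]
  have b4 : e * t * (e * t - 1) ≤ l ^ 2 * e ^ 2 := by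
    have h1 : e * t ≤ e * l := by nlinarith
    have h0 : 0 ≤ e * t := by positivity
    have h2 : e * t * (e * t) ≤ e * l * (e * l) := mul_le_mul h1 h1 h0 (by positivity)
    linarith [show e * l * (e * l) = l ^ 2 * e ^ 2 by ring, mul_sub (e * t) (e * t) 1]
  have b5 : t * l ≤ l ^ 2 := by nlinarith
  have hp0 : 0 < p := by nlinarith
  have key : 2 * t * (2 * m + 2 * l + 3 - e) + 2 * (e * t * (e * t - 1)) <
      (2 * m + 3 - e) * (2 * l + 3 - e) := by
    generalize ha : 2 * m + 3 - e = a at *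
    have b6 : 2 * t * (2 * m + 2 * l + 3 - e) = 2 * t * a + 4 * (t * l) := by rw [← ha]; ring
    have b7 : a * (2 * l + 3 - e) = 2 * t * a + 3 * a + 13 * (e * a) := by rw [ht]; ring
    rw [b6, b7]
    linarith
  have := mul_lt_mul_of_pos_left key hee
  linarith [this]

set_option maxHeartbeats 1000000 in
theorem weil {k : Type*} [Field k] [IsAlgClosed k] {p : ℕ} [Fact p.Prime] [CharP k p]
    {f : MvPolynomial (Fin 2) k} (hf : Irreducible f) (hd0 : f.totalDegree ≠ 0)
    (hp : 10 ^ 6 * f.totalDegree ^ 4 ≤ p) (S : Finset (Fin 2 → k))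
    (hS : ∀ P ∈ S, eval P f = 0 ∧ (∃ j, eval P (pderiv j f) ≠ 0) ∧ ∀ i, P i ^ p = P i) :
    S.card ≤ p + 64 * f.totalDegree ^ 2 * Nat.sqrt p := by
  have core := fun m l M h1 h2 h3 h4 h5 h6 => stepanov_core hf hd0 h1 m l M h2 h3 h4 h5 h6 S hS
  set e := f.totalDegree with he
  set q := Nat.sqrt p with hq
  have he1 : 1 ≤ e := Nat.one_le_iff_ne_zero.2 hd0
  have hq1 : q * q ≤ p := Nat.sqrt_le p
  have hq2 : p < (q + 1) * (q + 1) := Nat.lt_succ_sqrt p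
  have hq3 : 1000 * e ^ 2 ≤ q := by
    rw [hq, Nat.le_sqrt]
    calc _ = 10 ^ 6 * e ^ 4 := by ring
      _ ≤ p := hp
  obtain ⟨l, hl⟩ : ∃ l, l = q / e := ⟨_, rfl⟩
  have hl1 : l * e ≤ q := by rw [hl]; exact Nat.div_mul_le_self q e
  have hl2 : q < (l + 1) * e := by rw [hl, mul_comm]; exact Nat.lt_mul_div_succ q he1
  have hl3 : 1000 * e ≤ l := by
    rw [hl, Nat.le_div_iff_mul_le he1]; nlinarith
  obtain ⟨m, hm⟩ : ∃ m, m = p / (2 * e) := ⟨_, rfl⟩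
  have hm1 : m * (2 * e) ≤ p := by rw [hm]; exact Nat.div_mul_le_self _ _
  have hm2 : p < (m + 1) * (2 * e) := by rw [hm, mul_comm]; exact Nat.lt_mul_div_succ p (by omega)
  obtain ⟨t, ht⟩ : ∃ t, l = 7 * e + t := ⟨l - 7 * e, by omega⟩
  have e4 : e ^ 2 ≤ e ^ 4 := Nat.pow_le_pow_right he1 (by norm_num)
  have e2 : e ≤ e ^ 2 := by nlinarith
  have hpe : 10 ^ 6 * e ^ 2 ≤ p := by omega
  have hml : e ≤ m := by
    by_contra hcon
    push Not at hcon
    have : (m + 1) * (2 * e) ≤ e * (2 * e) := Nat.mul_le_mul_right _ hcon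
    nlinarith
  have h := core m l (e * t) (by nlinarith) hml (by omega) (by nlinarith) (by nlinarith) ?_
  · -- conclusion
    have h' : S.card * t ≤ m + p * l := by
      have : e * (S.card * t) ≤ e * (m + p * l) := by linarith [h, mul_left_comm e S.card t]
      exact Nat.le_of_mul_le_mul_left this (by omega)
    have hmp : m ≤ p := by nlinarith
    by_contra hcon
    push Not at hcon
    have h1 : (p + 64 * e ^ 2 * q + 1) * t ≤ m + p * l := (Nat.mul_le_mul_right t hcon).trans h'
    have h2 : 64 * e ^ 2 * q * t ≤ 8 * e * p := by rw [ht] at h1; nlinarith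
    have h3 : 8 * e * q * t ≤ p := by
      have : (8 * e) * (8 * e * q * t) ≤ (8 * e) * p := by nlinarith
      exact Nat.le_of_mul_le_mul_left this (by omega)
    have h4 : q ≤ 2 * (t * e) := by
      have a1 : l + 1 ≤ 2 * t := by omega
      have a2 := Nat.mul_le_mul_right e a1
      have a3 : 2 * t * e = 2 * (t * e) := by ring
      omega
    have h5 : 8 * e * q * t ≥ 4 * (q * q) := by
      have a1 := Nat.mul_le_mul_left q h4
      have a2 : 8 * e * q * t = 4 * (q * (2 * (t * e))) := by ring
      omega
    have h6 : 4 * (q * q) < (q + 1) * (q + 1) := by omega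
    have h7 : 2 ≤ q := by omega
    clear * - h6 h7
    nlinarith
  · -- dimension count
    have s1 := sum_AA e (m + l) (e * t) (by omega)
    have s2 := AA_eq (e := e) (n := m) hml
    have s3 := AA_eq (e := e) (n := l) (by omega)
    zify at s2 s3 ⊢
    have s2' : 2 * (AA e m : ℤ) = e * (2 * m + 3 - e) := by linarith
    have s3' : 2 * (AA e l : ℤ) = e * (2 * l + 3 - e) := by linarith
    have goal4 : 2 * (2 * (∑ i : Fin (e * t), (AA e (m + l + (i : ℕ) * e) : ℤ))) <
        (2 * (AA e m : ℤ)) * (2 * (AA e l : ℤ)) := by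
      rw [s1, s2', s3']
      push_cast
      zify at he1 hq1 hq2 hq3 hl1 hl2 hl3 hm1 hm2 ht hpe hml
      exact weil_arith e t m l p q he1 (by positivity) hq1 hl1 hm1 hm2 ht hpe hml
    linarith
end PAC
end

-- part R1
section
open MvPolynomial
namespace PAC

section
variable {R : Type*} [CommRing R]

/-- Ruppert's operator -/
noncomputable def rup (i j : Fin 2) (f g h : MvPolynomial (Fin 2) R) : MvPolynomial (Fin 2) R :=
  f * (pderiv i h - pderiv j g) - h * pderiv i f + g * pderiv j f

lemma rup_swap (i j : Fin 2) (f g h : MvPolynomial (Fin 2) R) : rup i j f g h = - rup j i f h g := by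
  unfold rup; ring

lemma rup_add (i j : Fin 2) (f g h g' h' : MvPolynomial (Fin 2) R) :
    rup i j f (g + g') (h + h') = rup i j f g h + rup i j f g' h' := by
  unfold rup; simp only [map_add]; ring

lemma rup_smul (i j : Fin 2) (c : R) (f g h : MvPolynomial (Fin 2) R) :
    rup i j f (c • g) (c • h) = c • rup i j f g h := by
  unfold rup; simp only [Derivation.map_smul]; simp only [MvPolynomial.smul_eq_C_mul]; ring

lemma pderiv_comm' (i j : Fin 2) (f : MvPolynomial (Fin 2) R) :
    pderiv i (pderiv j f) = pderiv j (pderiv i f) := by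
  have : ⁅(pderiv i : Derivation R (MvPolynomial (Fin 2) R) (MvPolynomial (Fin 2) R)),
      (pderiv j : Derivation R (MvPolynomial (Fin 2) R) (MvPolynomial (Fin 2) R))⁆ = 0 := by
    apply MvPolynomial.derivation_ext
    intro l
    rw [Derivation.commutator_apply]
    simp only [pderiv_X, Derivation.zero_apply]
    rcases eq_or_ne j l with rfl | h1 <;> rcases eq_or_ne i j with rfl | h2 <;> simp [Pi.single_apply] 
    all_goals (try split_ifs) <;> simp
  have h2 := Derivation.congr_fun this f
  rw [Derivation.commutator_apply] at h2
  simpa [sub_eq_zero] using h2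

lemma rup_grad (i j : Fin 2) (f : MvPolynomial (Fin 2) R) :
    rup i j f (pderiv i f) (pderiv j f) = 0 := by
  unfold rup; rw [pderiv_comm' i j]; ring

lemma rup_log (i j : Fin 2) (q w : MvPolynomial (Fin 2) R) :
    rup i j (q * w) (w * pderiv i q) (w * pderiv j q) = 0 := by
  unfold rup
  simp only [Derivation.leibniz, smul_eq_mul, pderiv_comm' i j]
  ring

lemma rup_sq (i j : Fin 2) (q w : MvPolynomial (Fin 2) R) :
    rup i j (q * (q * w)) (w * pderiv i q) (w * pderiv j q) = 0 := by
  unfold rup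
  simp only [Derivation.leibniz, smul_eq_mul, pderiv_comm' i j]
  ring

lemma rup_map {S : Type*} [CommRing S] (φ : R →+* S) (i j : Fin 2) (f g h : MvPolynomial (Fin 2) R) :
    map φ (rup i j f g h) = rup i j (map φ f) (map φ g) (map φ h) := by
  unfold rup; simp only [map_add, map_sub, map_mul, pderiv_map]

end

section
variable {k : Type*} [Field k] {D : Derivation k (MvPolynomial (Fin 2) k) (MvPolynomial (Fin 2) k)}

lemma Van.neg {P : Fin 2 → k} {n : ℕ} {g : MvPolynomial (Fin 2) k} (hg : Van D P n g) :
    Van D P n (-g) := fun j hj => by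
  have := iter_smul D j (-1) g
  rw [neg_one_smul, neg_one_smul] at this
  rw [this, map_neg, hg j hj, neg_zero]

lemma Van.of_mul {P : Fin 2 → k} {n : ℕ} : ∀ {b g : MvPolynomial (Fin 2) k},
    eval P b ≠ 0 → Van D P n (b * g) → Van D P n g := by
  induction n with
  | zero => intro b g _ _ j hj; omega
  | succ n ih =>
    intro b g hb h
    have h1 := ih hb (h.mono (Nat.le_succ n))
    rw [van_succ] at h ⊢
    refine ⟨?_, ih hb ?_⟩
    · have := h.1
      rw [map_mul] at this
      exact (mul_eq_zero.1 this).resolve_left hb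
    · have h2 := h.2.add (h1.mul_right (D b)).neg
      rw [Derivation.leibniz, smul_eq_mul, smul_eq_mul, add_neg_cancel_right] at h2
      exact h2

lemma van_const_mul {P : Fin 2 → k} (n : ℕ) {f : MvPolynomial (Fin 2) k} (hf : D f = 0)
    (hP : eval P f = 0) (e : MvPolynomial (Fin 2) k) : Van D P n (f * e) := fun j _ => by
  rw [iter_mul_of_const hf, map_mul, hP, zero_mul]

lemma eq_zero_of_dvd {f g : MvPolynomial (Fin 2) k} (h : f ∣ g) (hd : g.totalDegree < f.totalDegree) :
    g = 0 := by
  obtain ⟨q, rfl⟩ := h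
  by_contra h0
  have h1 : f ≠ 0 := left_ne_zero_of_mul h0
  have h2 : q ≠ 0 := right_ne_zero_of_mul h0
  rw [totalDegree_mul_of_isDomain h1 h2] at hd
  omega

theorem ruppert_ker [CharZero k] {i j : Fin 2} (hij : i ≠ j) {f g h : MvPolynomial (Fin 2) k} (hf : Irreducible f)
    {P : Fin 2 → k} (hP : eval P f = 0) (hj : eval P (pderiv j f) ≠ 0)
    (hr : rup i j f g h = 0) (hg : g.totalDegree < f.totalDegree) (hh : h.totalDegree < f.totalDegree) :
    ∃ c : k, g = c • pderiv i f ∧ h = c • pderiv j f := by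
  have hpd : ∀ l, (pderiv l f).totalDegree < f.totalDegree := fun l =>
    (totalDegree_pderiv_le l f).trans_lt (by omega)
  set c := eval P h / eval P (pderiv j f) with hc
  set g' := g + (-c) • pderiv i f with hg'
  set h' := h + (-c) • pderiv j f with hh'
  have hr' : rup i j f g' h' = 0 := by
    rw [hg', hh', rup_add, rup_smul, rup_grad, hr, smul_zero, add_zero]
  have hdeg : ∀ u l, u.totalDegree < f.totalDegree → (u + (-c) • pderiv l f).totalDegree < f.totalDegree := by
    intro u l hu
    exact (totalDegree_add _ _).trans_lt (max_lt hu ((totalDegree_smul_le _ _).trans_lt (hpd l)))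
  have hg'd := hdeg g i hg
  have hh'd := hdeg h j hh
  have hj0 : pderiv j f ≠ 0 := by intro h0; rw [h0] at hj; simp at hj
  have hh'P : eval P h' = 0 := by
    rw [hh', map_add, smul_eval, hc]; field_simp; ring
  let D : Derivation k (MvPolynomial (Fin 2) k) (MvPolynomial (Fin 2) k) :=
    (pderiv j f) • pderiv i - (pderiv i f) • pderiv j
  have hDa : ∀ u, D u = pderiv j f * pderiv i u - pderiv i f * pderiv j u := fun u => rfl
  have hDf : D f = 0 := by rw [hDa]; ring
  have hDX : D (X i) = pderiv j f := by
    rw [hDa, pderiv_X_self, pderiv_X_of_ne hij]; ring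
  have hkey : ∃ e, pderiv j f * D h' = h' * D (pderiv j f) + f * e := by
    have e1 : f * (pderiv i h' - pderiv j g') = h' * pderiv i f - g' * pderiv j f := by
      unfold rup at hr'; linear_combination hr'
    have e2 := congrArg (pderiv j) e1
    simp only [Derivation.leibniz, smul_eq_mul, map_sub] at e2
    rw [hDa, hDa, pderiv_comm' i j f]
    refine ⟨- pderiv j f * (pderiv j (pderiv i h') - pderiv j (pderiv j g')) +
      pderiv j (pderiv j f) * (pderiv i h' - pderiv j g'), ?_⟩
    linear_combination (pderiv j f) * e2 - (pderiv j (pderiv j f)) * e1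
  obtain ⟨e, he⟩ := hkey
  have hvan : ∀ n, Van D P n h' := by
    intro n
    induction n with
    | zero => intro j hj; omega
    | succ n ih =>
      rw [van_succ]
      refine ⟨hh'P, Van.of_mul hj ?_⟩
      rw [he]
      exact (ih.mul_right _).add (van_const_mul n hDf hP e)
  have hfh : f ∣ h' := by
    by_contra hnd
    have := bezout_mult_der (D := D) hf hnd hDf (f.totalDegree * h'.totalDegree + 1)
      (fun n hn _ => by exact_mod_cast hn.ne') {P} (by
        intro Q hQ
        rw [Finset.mem_singleton] at hQ
        subst hQ
        exact ⟨hP, ⟨i, by rw [hDX]; exact hj⟩, hvan _⟩)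
    simp at this
  have hh0 : h' = 0 := eq_zero_of_dvd hfh hh'd
  have hfg : f ∣ g' := by
    have : f ∣ g' * pderiv j f := by
      unfold rup at hr'
      rw [hh0] at hr'
      refine ⟨pderiv j g', ?_⟩
      simp only [map_zero] at hr'
      linear_combination hr'
    exact (hf.prime.dvd_or_dvd this).resolve_right (not_dvd_pderiv (by omega) hj0)
  have hg0 : g' = 0 := eq_zero_of_dvd hfg hg'd
  refine ⟨c, ?_, ?_⟩
  · rw [hg', neg_smul, add_neg_eq_zero] at hg0; exact hg0
  · rw [hh', neg_smul, add_neg_eq_zero] at hh0; exact hh0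

lemma isUnit_of_totalDegree_zero {f : MvPolynomial (Fin 2) k} (h0 : f ≠ 0) (h : f.totalDegree = 0) :
    IsUnit f := by
  rw [totalDegree_eq_zero_iff_eq_C] at h
  rw [h]
  refine (isUnit_iff_ne_zero.2 ?_).map C
  intro h1; rw [h1] at h; simp at h; exact h0 h

theorem ruppert_red {f : MvPolynomial (Fin 2) k} (d : ℕ) (hd1 : 1 ≤ d) (hd : f.totalDegree ≤ d) (hf0 : f ≠ 0)
    (hn : ∀ n : ℕ, 0 < n → n ≤ d → (n : k) ≠ 0) (hf : ¬ Irreducible f) :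
    ∃ g h : Fin 2 → MvPolynomial (Fin 2) k, (∀ a, (g a).totalDegree ≤ d - 1) ∧
      (∀ a, (h a).totalDegree ≤ d - 1) ∧ (∀ a, rup 0 1 f (g a) (h a) = 0) ∧
      ∀ a b : k, a • g 0 + b • g 1 = 0 → a • h 0 + b • h 1 = 0 → a = 0 ∧ b = 0 := by
  classical
  by_cases hfd : f.totalDegree = 0
  · rw [totalDegree_eq_zero_iff_eq_C] at hfd
    refine ⟨![1, 0], ![0, 1], ?_, ?_, ?_, ?_⟩
    · intro a; fin_cases a <;> simp
    · intro a; fin_cases a <;> simp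
    · intro a; rw [hfd]; fin_cases a <;> simp [rup]
    · intro a b h1 h2
      simp [MvPolynomial.smul_eq_C_mul] at h1 h2
      exact ⟨h1, h2⟩
  have hnu : ¬ IsUnit f := by
    intro h
    apply hfd
    obtain ⟨g, hg⟩ := h.exists_right_inv
    have hg0 : g ≠ 0 := by rintro rfl; simp at hg
    have := totalDegree_mul_of_isDomain hf0 hg0
    rw [hg] at this; simp at this; omega
  obtain ⟨q, hq, hqf⟩ := WfDvdMonoid.exists_irreducible_factor hnu hf0
  obtain ⟨n, u, hqu, hfu⟩ := WfDvdMonoid.max_power_factor hf0 hq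
  have hq0 := hq.ne_zero
  have hu0 : u ≠ 0 := by rintro rfl; simp at hqu
  have hqd : q.totalDegree ≠ 0 := fun h => hq.not_isUnit (isUnit_of_totalDegree_zero hq0 h)
  have hdegf : f.totalDegree = n * q.totalDegree + u.totalDegree := by
    rw [hfu, totalDegree_mul_of_isDomain (pow_ne_zero _ hq0) hu0]
    congr 1
    clear hfu
    induction n with
    | zero => simp
    | succ n ih => rw [pow_succ, totalDegree_mul_of_isDomain (pow_ne_zero _ hq0) hq0, ih]; ring
  have hn1 : n ≠ 0 := by
    rintro rfl
    rw [pow_zero, one_mul] at hfu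
    exact hqu (hfu ▸ hqf)
  obtain ⟨n, rfl⟩ := Nat.exists_eq_succ_of_ne_zero hn1
  rw [Nat.succ_eq_add_one] at *
  have hqdd : q.totalDegree ≤ f.totalDegree := by nlinarith
  obtain ⟨j, hj⟩ := exists_pderiv_ne_zero hqd (fun n h1 h2 => hn n h1 (by omega))
  have hdegb : ∀ (a w : MvPolynomial (Fin 2) k) (l : Fin 2), a ≠ 0 → w ≠ 0 → a.totalDegree ≠ 0 →
      (a * w).totalDegree ≤ d → (w * pderiv l a).totalDegree ≤ d - 1 := by
    intro a w l ha hw ha1 hle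
    rw [totalDegree_mul_of_isDomain ha hw] at hle
    have := totalDegree_pderiv_le l a
    exact (totalDegree_mul _ _).trans (by omega)
  have hf1 : f = q * (q ^ n * u) := by rw [hfu]; ring
  by_cases hud : u.totalDegree = 0
  · have huu := isUnit_of_totalDegree_zero hu0 hud
    have hn0 : n ≠ 0 := by
      rintro rfl
      apply hf
      rw [hf1, pow_zero, one_mul]
      exact (irreducible_mul_isUnit huu).2 hq
    obtain ⟨n, rfl⟩ := Nat.exists_eq_succ_of_ne_zero hn0
    rw [Nat.succ_eq_add_one] at *
    set w := q ^ n * u with hw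
    have hw0 : w ≠ 0 := mul_ne_zero (pow_ne_zero _ hq0) hu0
    have hf2 : f = q * (q * w) := by rw [hf1, hw]; ring
    refine ⟨![(q * w) * pderiv 0 q, w * pderiv 0 q], ![(q * w) * pderiv 1 q, w * pderiv 1 q], ?_, ?_, ?_, ?_⟩
    · intro a; fin_cases a
      · exact hdegb q (q * w) 0 hq0 (mul_ne_zero hq0 hw0) hqd (hf2 ▸ hd)
      · refine hdegb q w 0 hq0 hw0 hqd ?_
        rw [hf2, totalDegree_mul_of_isDomain hq0 (mul_ne_zero hq0 hw0)] at hd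
        omega
    · intro a; fin_cases a
      · exact hdegb q (q * w) 1 hq0 (mul_ne_zero hq0 hw0) hqd (hf2 ▸ hd)
      · refine hdegb q w 1 hq0 hw0 hqd ?_
        rw [hf2, totalDegree_mul_of_isDomain hq0 (mul_ne_zero hq0 hw0)] at hd
        omega
    · intro a; rw [hf2]; fin_cases a
      · exact rup_log 0 1 q (q * w)
      · exact rup_sq 0 1 q w
    · intro a b h1 h2
      have h3 : ∀ l, (C a * q + C b) * (w * pderiv l q) = 0 := by
        intro l
        simp only [MvPolynomial.smul_eq_C_mul] at h1 h2
        fin_cases l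
        · have h1' : C a * (q * w * pderiv 0 q) + C b * (w * pderiv 0 q) = 0 := h1
          change (C a * q + C b) * (w * pderiv 0 q) = 0
          linear_combination h1'
        · have h2' : C a * (q * w * pderiv 1 q) + C b * (w * pderiv 1 q) = 0 := h2
          change (C a * q + C b) * (w * pderiv 1 q) = 0
          linear_combination h2'
      have h4 : C a * q + C b = 0 := (mul_eq_zero.1 (h3 j)).resolve_right (mul_ne_zero hw0 hj)
      have ha : a = 0 := by
        by_contra ha
        apply hqd
        have h5 : q = C (- (a⁻¹ * b)) := by
          have : C a⁻¹ * (C a * q + C b) = 0 := by rw [h4, mul_zero]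
          rw [mul_add, ← mul_assoc, ← C_mul, ← C_mul, inv_mul_cancel₀ ha, C_1, one_mul] at this
          rw [C_neg]; exact eq_neg_of_add_eq_zero_left this
        rw [h5, totalDegree_C]
      subst ha
      refine ⟨rfl, ?_⟩
      simpa using h4
  · obtain ⟨j', hj'⟩ := exists_pderiv_ne_zero hud (fun n h1 h2 => hn n h1 (by omega))
    set w := q ^ n with hw
    have hw0 : w ≠ 0 := pow_ne_zero _ hq0
    have hf2 : f = q * (w * u) := hf1
    have hf3 : f = u * (w * q) := by rw [hf2]; ring
    refine ⟨![(w * u) * pderiv 0 q, (w * q) * pderiv 0 u], ![(w * u) * pderiv 1 q, (w * q) * pderiv 1 u], ?_, ?_, ?_, ?_⟩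
    · intro a; fin_cases a
      · exact hdegb q (w * u) 0 hq0 (mul_ne_zero hw0 hu0) hqd (hf2 ▸ hd)
      · exact hdegb u (w * q) 0 hu0 (mul_ne_zero hw0 hq0) hud (hf3 ▸ hd)
    · intro a; fin_cases a
      · exact hdegb q (w * u) 1 hq0 (mul_ne_zero hw0 hu0) hqd (hf2 ▸ hd)
      · exact hdegb u (w * q) 1 hu0 (mul_ne_zero hw0 hq0) hud (hf3 ▸ hd)
    · intro a; fin_cases a
      · rw [hf2]; exact rup_log 0 1 q (w * u)
      · rw [hf3]; exact rup_log 0 1 u (w * q)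
    · intro a b h1 h2
      have h3 : ∀ l, C a * (u * pderiv l q) + C b * (q * pderiv l u) = 0 := by
        intro l
        apply mul_left_cancel₀ hw0
        rw [mul_zero]
        simp only [MvPolynomial.smul_eq_C_mul] at h1 h2
        fin_cases l
        · have h1' : C a * (w * u * pderiv 0 q) + C b * (w * q * pderiv 0 u) = 0 := h1
          change w * (C a * (u * pderiv 0 q) + C b * (q * pderiv 0 u)) = 0
          linear_combination h1'
        · have h2' : C a * (w * u * pderiv 1 q) + C b * (w * q * pderiv 1 u) = 0 := h2
          change w * (C a * (u * pderiv 1 q) + C b * (q * pderiv 1 u)) = 0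
          linear_combination h2'
      have ha : a = 0 := by
        by_contra ha
        have h4 : q ∣ C a * (u * pderiv j q) := by
          refine ⟨- (C b * pderiv j u), ?_⟩
          linear_combination h3 j
        rcases hq.prime.dvd_or_dvd h4 with h | h
        · exact hq.not_isUnit (isUnit_of_dvd_unit h ((isUnit_iff_ne_zero.2 ha).map C))
        · rcases hq.prime.dvd_or_dvd h with h | h
          · exact hqu h
          · exact not_dvd_pderiv hqd hj h
      subst ha
      refine ⟨rfl, ?_⟩
      have h5 := h3 j'
      rw [C_0, zero_mul, zero_add] at h5
      have h6 := (mul_eq_zero.1 h5).resolve_right (mul_ne_zero hq0 hj')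
      simpa using h6

end
end PAC
end

-- part R2
section
open MvPolynomial
namespace PAC

lemma exists_minor {k : Type*} [Field k] {I J : Type*} [Fintype J] [DecidableEq J] (A : Matrix I J k)
    (h : ∀ v : J → k, (∀ i, ∑ j, A i j * v j = 0) → v = 0) :
    ∃ r : J → I, (A.submatrix r id).det ≠ 0 := by
  have hspan : Submodule.span k (Set.range A) = ⊤ := by
    by_contra hne
    obtain ⟨φ, hφ, hle⟩ := Submodule.exists_le_ker_of_lt_top _ (lt_top_iff_ne_top.2 hne)
    apply hφ
    have h1 := h (fun j => φ (Pi.single j 1)) (fun i => by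
      have h2 : φ (A i) = 0 := hle (Submodule.subset_span ⟨i, rfl⟩)
      rw [← h2]
      conv_rhs => rw [pi_eq_sum_univ' (A i), map_sum]
      refine Finset.sum_congr rfl (fun j _ => ?_)
      rw [map_smul, smul_eq_mul])
    apply LinearMap.pi_ext'
    intro j
    ext
    exact congrFun h1 j
  obtain ⟨b, hb, hbs, hbl⟩ := exists_linearIndependent k (Set.range A)
  rw [hspan] at hbs
  have hbl' : LinearIndependent k (fun x : b => (x : J → k)) := hbl
  let B : Module.Basis b k (J → k) := Module.Basis.mk hbl' (by rw [Subtype.range_coe]; exact hbs.ge)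
  let e : J ≃ b := (Pi.basisFun k J).indexEquiv B
  choose r hr using fun x : b => hb x.2
  refine ⟨fun j => r (e j), ?_⟩
  have h3 : LinearIndependent k (A.submatrix (fun j => r (e j)) id).row := by
    have h4 := hbl'.comp e e.injective
    convert h4 using 1
    funext j
    exact hr (e j)
  rw [Matrix.linearIndependent_rows_iff_isUnit, Matrix.isUnit_iff_isUnit_det] at h3
  exact h3.ne_zero

section
variable {R : Type*} [CommRing R]

lemma rup_coeff_le {f : MvPolynomial (Fin 2) ℤ} {d : ℕ} (hd : f.totalDegree = d) {H : ℕ}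
    (hH : ∀ m, |f.coeff m| ≤ H) {a : Fin 2 →₀ ℕ} (ha : a ∈ TT (d - 1)) (i : Fin 2) (m : Fin 2 →₀ ℕ) :
    |coeff m (f * pderiv i (monomial a (1 : ℤ)) - monomial a (1 : ℤ) * pderiv i f)| ≤ 2 * d * H := by
  classical
  have hH0 : (0 : ℤ) ≤ H := by positivity
  rw [coeff_sub]
  have h1 : |coeff m (f * pderiv i (monomial a (1 : ℤ)))| ≤ d * H := by
    rw [pderiv_monomial, coeff_mul_monomial', one_mul]
    split_ifs with hle
    · rw [abs_mul, mul_comm]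
      have : (|(a i : ℤ)|) ≤ d := by
        rw [mem_TT] at ha
        rw [Nat.abs_cast]
        have : a i ≤ d := by fin_cases i <;> simp <;> omega
        exact_mod_cast this
      exact mul_le_mul this (hH _) (abs_nonneg _) (by positivity)
    · simp; positivity
  have h2 : |coeff m (monomial a (1 : ℤ) * pderiv i f)| ≤ d * H := by
    rw [coeff_monomial_mul']
    split_ifs with hle
    · rw [one_mul, coeff_pderiv, abs_mul, mul_comm]
      by_cases h0 : f.coeff (m - a + Finsupp.single i 1) = 0
      · rw [h0]; simp; positivity
      · have h3 := le_totalDegree (mem_support_iff.2 h0)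
        rw [hd, Finsupp.sum_fintype _ _ (by simp)] at h3
        have h4 := (Finset.single_le_sum (f := fun l => (m - a + Finsupp.single i 1 : Fin 2 →₀ ℕ) l)
          (fun _ _ => Nat.zero_le _) (Finset.mem_univ i)).trans h3
        simp only [Finsupp.add_apply, Finsupp.single_eq_same] at h4
        refine mul_le_mul ?_ (hH _) (abs_nonneg _) (by positivity)
        rw [abs_of_nonneg (by positivity)]
        exact_mod_cast h4
    · simp; positivity
  rw [abs_le] at *
  constructor <;> linarith [h1.1, h1.2, h2.1, h2.2]

lemma rmat_aux1 (f g : MvPolynomial (Fin 2) ℤ) : rup 0 1 f g 0 = -(f * pderiv 1 g - g * pderiv 1 f) := by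
  unfold rup; simp; try ring

lemma rmat_aux2 (f g : MvPolynomial (Fin 2) ℤ) : rup 0 1 f 0 g = (f * pderiv 0 g - g * pderiv 0 f) := by
  unfold rup; simp; try ring

/-- index set of Ruppert's matrix -/
abbrev JJ (d : ℕ) := Fin 2 × {m // m ∈ TT (d - 1)}

/-- the polynomial with given coefficient vector -/
noncomputable def pv (d : ℕ) (v : JJ d → R) (c : Fin 2) : MvPolynomial (Fin 2) R :=
  ∑ a : {m // m ∈ TT (d - 1)}, v (c, a) • monomial (a : Fin 2 →₀ ℕ) 1

lemma coeff_pv (d : ℕ) (v : JJ d → R) (c : Fin 2) (a : {m // m ∈ TT (d - 1)}) :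
    coeff (a : Fin 2 →₀ ℕ) (pv d v c) = v (c, a) := by
  classical
  unfold pv
  rw [coeff_sum, Finset.sum_eq_single a]
  · simp
  · intro b _ hb
    rw [coeff_smul, coeff_monomial, if_neg (fun h => hb (Subtype.ext h)), smul_zero]
  · simp

lemma totalDegree_pv (d : ℕ) (v : JJ d → R) (c : Fin 2) : (pv d v c).totalDegree ≤ d - 1 := by
  refine totalDegree_finsetSum_le (fun a _ => (totalDegree_smul_le _ _).trans
    ((totalDegree_monomial_le _ _).trans ?_))
  have := mem_TT.1 a.2
  rw [Finsupp.sum_fintype _ _ (by simp), Fin.sum_univ_two]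
  exact this

lemma pv_of_coeff (d : ℕ) (g : MvPolynomial (Fin 2) R) (hg : g.totalDegree ≤ d - 1) (v : JJ d → R)
    (c : Fin 2) (hv : ∀ a, v (c, a) = coeff (a : Fin 2 →₀ ℕ) g) : pv d v c = g := by
  classical
  ext m
  by_cases hm : m ∈ TT (d - 1)
  · rw [coeff_pv d v c ⟨m, hm⟩, hv]
  · have h0 : ∀ g : MvPolynomial (Fin 2) R, g.totalDegree ≤ d - 1 → coeff m g = 0 := by
      intro g hg
      apply coeff_eq_zero_of_totalDegree_lt
      rw [mem_TT] at hm
      refine lt_of_le_of_lt hg ?_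
      have : ∑ i ∈ m.support, m i = m 0 + m 1 := by
        rw [Finset.sum_subset (Finset.subset_univ _) (by intro x _ hx; simpa using hx), Fin.sum_univ_two]
      omega
    rw [h0 _ (totalDegree_pv d v c), h0 g hg]

/-- the columns -/
noncomputable def col (f : MvPolynomial (Fin 2) R) (d : ℕ) (x : JJ d) : MvPolynomial (Fin 2) R :=
  if x.1 = 0 then rup 0 1 f (monomial (x.2 : Fin 2 →₀ ℕ) 1) 0
  else rup 0 1 f 0 (monomial (x.2 : Fin 2 →₀ ℕ) 1)

/-- rup as linear map -/
noncomputable def rupL (f : MvPolynomial (Fin 2) R) :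
    (MvPolynomial (Fin 2) R × MvPolynomial (Fin 2) R) →ₗ[R] MvPolynomial (Fin 2) R where
  toFun x := rup 0 1 f x.1 x.2
  map_add' _ _ := rup_add _ _ _ _ _ _ _
  map_smul' _ _ := rup_smul _ _ _ _ _ _

lemma sum_col (f : MvPolynomial (Fin 2) R) (d : ℕ) (v : JJ d → R) :
    ∑ x, v x • col f d x = rup 0 1 f (pv d v 0) (pv d v 1) := by
  rw [Fintype.sum_prod_type, Fin.sum_univ_two]
  have h1 : ∑ a, v (0, a) • col f d (0, a) = rupL f (pv d v 0, 0) := by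
    have : (pv d v 0, (0 : MvPolynomial (Fin 2) R)) =
        ∑ a, v (0, a) • (monomial (a : Fin 2 →₀ ℕ) (1 : R), (0 : MvPolynomial (Fin 2) R)) := by
      ext1
      · rw [Prod.fst_sum]; rfl
      · rw [Prod.snd_sum]; simp
    rw [this, map_sum]
    refine Finset.sum_congr rfl (fun a _ => ?_)
    rw [map_smul]
    rfl
  have h2 : ∑ a, v (1, a) • col f d (1, a) = rupL f (0, pv d v 1) := by
    have : ((0 : MvPolynomial (Fin 2) R), pv d v 1) =
        ∑ a, v (1, a) • ((0 : MvPolynomial (Fin 2) R), monomial (a : Fin 2 →₀ ℕ) (1 : R)) := by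
      ext1
      · rw [Prod.fst_sum]; simp
      · rw [Prod.snd_sum]; rfl
    rw [this, map_sum]
    refine Finset.sum_congr rfl (fun a _ => ?_)
    rw [map_smul]
    rfl
  rw [h1, h2, ← map_add]
  simp [rupL]

lemma col_map {S : Type*} [CommRing S] (φ : R →+* S) (f : MvPolynomial (Fin 2) R) (d : ℕ) (x : JJ d) :
    map φ (col f d x) = col (map φ f) d x := by
  unfold col
  split_ifs <;> rw [rup_map] <;> simp

/-- Ruppert's matrix with an extra coordinate row -/
noncomputable def rmat (f : MvPolynomial (Fin 2) R) (d : ℕ) (x0 : JJ d) :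
    Matrix (Option (Fin 2 →₀ ℕ)) (JJ d) R := fun i x =>
  match i with
  | none => if x = x0 then 1 else 0
  | some m => coeff m (col f d x)

lemma rmat_map {S : Type*} [CommRing S] (φ : R →+* S) (f : MvPolynomial (Fin 2) R) (d : ℕ) (x0 : JJ d) :
    (rmat f d x0).map φ = rmat (map φ f) d x0 := by
  ext i x
  cases i with
  | none => simp only [Matrix.map_apply, rmat]; split_ifs <;> simp
  | some m => simp only [Matrix.map_apply, rmat]; rw [← col_map, coeff_map]

lemma rmat_mulVec (f : MvPolynomial (Fin 2) R) (d : ℕ) (x0 : JJ d) (v : JJ d → R) :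
    (∀ i, ∑ x, rmat f d x0 i x * v x = 0) ↔ v x0 = 0 ∧ rup 0 1 f (pv d v 0) (pv d v 1) = 0 := by
  rw [← sum_col]
  have h1 : ∑ x, rmat f d x0 none x * v x = v x0 := by simp [rmat]
  have h2 : ∀ m, ∑ x, rmat f d x0 (some m) x * v x = coeff m (∑ x, v x • col f d x) := by
    intro m
    rw [coeff_sum]
    refine Finset.sum_congr rfl (fun x _ => ?_)
    rw [coeff_smul, smul_eq_mul, mul_comm]; rfl
  constructor
  · intro h
    refine ⟨by rw [← h1]; exact h none, ?_⟩
    ext m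
    rw [← h2, h (some m), coeff_zero]
  · rintro ⟨h3, h4⟩ i
    cases i with
    | none => rw [h1, h3]
    | some m => rw [h2, h4, coeff_zero]

end

lemma rmat_le {f : MvPolynomial (Fin 2) ℤ} {d : ℕ} (hd1 : 1 ≤ d) (hd : f.totalDegree = d) {H : ℕ}
    (hH : ∀ m, |f.coeff m| ≤ H) (hf : f ≠ 0) (x0 : JJ d) (i) (x : JJ d) : |rmat f d x0 i x| ≤ 2 * d * H := by
  obtain ⟨m0, hm0⟩ := MvPolynomial.ne_zero_iff.1 hf
  have h1 : (1 : ℤ) ≤ H := (Int.one_le_abs hm0).trans (hH m0)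
  have hd1' : (1 : ℤ) ≤ d := by exact_mod_cast hd1
  cases i with
  | none =>
    simp only [rmat]
    split_ifs
    · simp; nlinarith
    · simp; positivity
  | some m =>
    simp only [rmat, col]
    split_ifs
    · rw [rmat_aux1, coeff_neg, abs_neg]
      exact rup_coeff_le hd hH x.2.2 1 m
    · rw [rmat_aux2]
      exact rup_coeff_le hd hH x.2.2 0 m

lemma rmat_det_zero {L : Type} [Field L] {f : MvPolynomial (Fin 2) L} {d : ℕ} (hd1 : 1 ≤ d)
    (hd : f.totalDegree ≤ d) (hf0 : f ≠ 0) (hn : ∀ n : ℕ, 0 < n → n ≤ d → (n : L) ≠ 0)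
    (hirr : ¬ Irreducible f) (x0 : JJ d) (r : JJ d → Option (Fin 2 →₀ ℕ)) :
    ((rmat f d x0).submatrix r id).det = 0 := by
  classical
  obtain ⟨g, h, hg, hh, hrup, hind⟩ := ruppert_red d hd1 hd hf0 hn hirr
  let V : Fin 2 → JJ d → L := fun a x => if x.1 = 0 then coeff (x.2 : Fin 2 →₀ ℕ) (g a)
    else coeff (x.2 : Fin 2 →₀ ℕ) (h a)
  have hV0 : ∀ a, pv d (V a) 0 = g a := fun a => pv_of_coeff d _ (hg a) _ _ (fun _ => rfl)
  have hV1 : ∀ a, pv d (V a) 1 = h a := fun a => pv_of_coeff d _ (hh a) _ _ (fun _ => rfl)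
  have hpvadd : ∀ (s t : L) (c : Fin 2), pv d (s • V 0 + t • V 1) c =
      s • pv d (V 0) c + t • pv d (V 1) c := by
    intro s t c
    simp only [pv, Finset.smul_sum, ← Finset.sum_add_distrib]
    refine Finset.sum_congr rfl (fun x _ => ?_)
    simp [add_smul, smul_smul]
  obtain ⟨s, t, hst, hst0⟩ : ∃ s t : L, (s ≠ 0 ∨ t ≠ 0) ∧ s * V 0 x0 + t * V 1 x0 = 0 := by
    by_cases h0 : V 0 x0 = 0
    · exact ⟨1, 0, by simp, by simp [h0]⟩
    · exact ⟨- V 1 x0, V 0 x0, Or.inr h0, by ring⟩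
  set v := s • V 0 + t • V 1 with hv
  have hvne : v ≠ 0 := by
    intro h0
    have e0 := hpvadd s t 0
    have e1 := hpvadd s t 1
    rw [← hv, h0, hV0, hV0] at e0
    rw [← hv, h0, hV1, hV1] at e1
    have := hind s t (by rw [← e0]; simp [pv]) (by rw [← e1]; simp [pv])
    tauto
  have hker := (rmat_mulVec f d x0 v).2 ⟨by simpa [hv] using hst0, by
    rw [hv, hpvadd, hpvadd, rup_add, rup_smul, rup_smul]
    simp only [hV0, hV1, hrup, smul_zero, add_zero]⟩
  rw [← Matrix.exists_mulVec_eq_zero_iff]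
  exact ⟨v, hvne, funext fun i => hker (r i)⟩

theorem ruppert {f : MvPolynomial (Fin 2) ℤ} {d : ℕ} (hd1 : 1 ≤ d) (hd : f.totalDegree = d)
    (hf : Irreducible (map (Int.castRingHom ℚ) f)) {H : ℕ} (hH : ∀ m, |f.coeff m| ≤ H)
    {P : Fin 2 → ℤ} (hP : eval P f = 0) {j : Fin 2} (hj : eval P (pderiv j f) ≠ 0) :
    ∃ Δ : ℤ, Δ ≠ 0 ∧ |Δ| ≤ (d * (d + 1)).factorial * (2 * d * H : ℤ) ^ (d * (d + 1)) ∧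
      ∀ (L : Type) [Field L], (∀ n : ℕ, 0 < n → n ≤ d → (n : L) ≠ 0) →
        map (Int.castRingHom L) f ≠ 0 → ¬ Irreducible (map (Int.castRingHom L) f) → (Δ : L) = 0 := by
  classical
  set φ := Int.castRingHom ℚ with hφ
  have hinj : Function.Injective φ := Int.cast_injective
  have hdQ : (map φ f).totalDegree = d := by
    rw [← hd]; unfold totalDegree; rw [support_map_of_injective _ hinj]
  have hPQ : eval (φ ∘ P) (map φ f) = 0 := by rw [← map_eval, hP, map_zero]
  have hjQ : eval (φ ∘ P) (pderiv j (map φ f)) ≠ 0 := by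
    rw [pderiv_map, ← map_eval]; exact fun h => hj (hinj (by rw [h, map_zero]))
  have hpd : pderiv j f ≠ 0 := by rintro h; rw [h] at hj; simp at hj
  obtain ⟨m0, hm0⟩ := MvPolynomial.ne_zero_iff.1 hpd
  have hm0T : m0 ∈ TT (d - 1) := by
    have h1 := le_totalDegree (mem_support_iff.2 hm0)
    have h2 := totalDegree_pderiv_le j f
    rw [Finsupp.sum_fintype _ _ (by simp), Fin.sum_univ_two] at h1
    rw [mem_TT]; omega
  let x0 : JJ d := (j, ⟨m0, hm0T⟩)
  obtain ⟨r, hr⟩ := exists_minor (rmat (map φ f) d x0) (by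
    intro v hv
    rw [rmat_mulVec] at hv
    obtain ⟨hv0, hv1⟩ := hv
    have hdeg : ∀ c, (pv d v c).totalDegree < (map φ f).totalDegree := fun c =>
      (totalDegree_pv d v c).trans_lt (by omega)
    have hc : ∃ c : ℚ, pv d v 0 = c • pderiv 0 (map φ f) ∧ pv d v 1 = c • pderiv 1 (map φ f) := by
      fin_cases j
      · rw [rup_swap, neg_eq_zero] at hv1
        obtain ⟨c, h1, h2⟩ := ruppert_ker (i := 1) (j := 0) (by decide) hf hPQ hjQ hv1 (hdeg 1) (hdeg 0)
        exact ⟨c, h2, h1⟩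
      · exact ruppert_ker (i := 0) (j := 1) (by decide) hf hPQ hjQ hv1 (hdeg 0) (hdeg 1)
    obtain ⟨c, hc0, hc1⟩ := hc
    have hcl : ∀ l, pv d v l = c • pderiv l (map φ f) := by
      intro l; fin_cases l
      · exact hc0
      · exact hc1
    have hcz : c = 0 := by
      have h1 := coeff_pv d v j ⟨m0, hm0T⟩
      change _ = v x0 at h1
      rw [hv0, hcl j, coeff_smul, smul_eq_mul, pderiv_map, coeff_map] at h1
      refine (mul_eq_zero.1 h1).resolve_right (fun h => hm0 (hinj (by rw [map_zero]; exact h)))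
    funext ⟨l, a⟩
    rw [← coeff_pv d v l a, hcl l, hcz, zero_smul, coeff_zero]; rfl)
  have hf00 : f ≠ 0 := by rintro rfl; simp at hpd
  set A := (rmat f d x0).submatrix r id with hA
  have hdetmap : ∀ (L : Type) [Field L], ((A.det : ℤ) : L) =
      ((rmat (map (Int.castRingHom L) f) d x0).submatrix r id).det := by
    intro L _
    rw [← rmat_map, Matrix.submatrix_map]
    exact (Int.castRingHom L).map_det A
  have hcard : Fintype.card (JJ d) = d * (d + 1) := by
    simp only [JJ, Fintype.card_prod, Fintype.card_fin, Fintype.card_coe]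
    rw [card_TT]
    obtain ⟨d, rfl⟩ := Nat.exists_eq_succ_of_ne_zero (by omega : d ≠ 0)
    simp
  refine ⟨A.det, ?_, ?_, ?_⟩
  · intro h0
    apply hr
    have := hdetmap ℚ
    rw [h0, Int.cast_zero] at this
    exact this.symm
  · have hb : ∀ i x, |A i x| ≤ 2 * d * H := fun i x => rmat_le hd1 hd hH hf00 x0 (r i) x
    have := Matrix.det_le (A := A) (abv := AbsoluteValue.abs) (x := (2 * d * H : ℤ)) hb
    rw [hcard] at this
    simpa using this
  · intro L _ hn hf0 hirr
    have hdL : (map (Int.castRingHom L) f).totalDegree ≤ d := hd ▸ totalDegree_map_le' _ _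
    rw [hdetmap L]
    exact rmat_det_zero hd1 hdL hf0 hn hirr x0 r
end PAC
end

-- part P1
section
open MvPolynomial
namespace PAC

lemma log_factorial_eq (n : ℕ) : Real.log (n.factorial) =
    ∑ p ∈ Nat.primesLE n, (padicValNat p n.factorial : ℝ) * Real.log p := by
  have h1 := Nat.prod_factorization_pow_eq_self (Nat.factorial_ne_zero n)
  have h2 : (n.factorial.factorization).prod (fun p k => p ^ k) =
      ∏ p ∈ Nat.primesLE n, p ^ n.factorial.factorization p := by
    apply Finsupp.prod_of_support_subset
    · intro p hp
      rw [Nat.support_factorization, Nat.mem_primeFactors] at hp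
      rw [Nat.mem_primesLE]
      exact ⟨(hp.1.dvd_factorial).1 hp.2.1, hp.1⟩
    · simp
  rw [h2] at h1
  conv_lhs => rw [← h1]
  push_cast
  rw [Real.log_prod]
  · refine Finset.sum_congr rfl (fun p hp => ?_)
    rw [Real.log_pow, Nat.factorization_def _ (Nat.mem_primesLE.1 hp).2]
  · intro p hp
    have := (Nat.mem_primesLE.1 hp).2.pos
    positivity

lemma padic_fact_ge {n p : ℕ} (hp : p.Prime) : (n : ℝ) / p - 1 ≤ padicValNat p n.factorial := by
  have := Fact.mk hp
  have h1 : n / p ≤ padicValNat p n.factorial := by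
    rw [padicValNat_factorial (b := Nat.log p n + 2) (by omega)]
    have := Finset.single_le_sum (f := fun i => n / p ^ i) (fun _ _ => Nat.zero_le _)
      (show 1 ∈ Finset.Ico 1 (Nat.log p n + 2) by simp)
    simpa using this
  have h2 : (n : ℝ) / p < (n / p : ℕ) + 1 := by
    rw [div_lt_iff₀ (by exact_mod_cast hp.pos)]
    have := Nat.lt_div_mul_add hp.pos (a := n)
    have h3 : n < (n / p + 1) * p := by linarith
    exact_mod_cast h3
  have h3 : ((n / p : ℕ) : ℝ) ≤ padicValNat p n.factorial := by exact_mod_cast h1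
  linarith

lemma padic_fact_le {n p : ℕ} (hp : p.Prime) : (padicValNat p n.factorial : ℝ) ≤ n / (p - 1) := by
  have := Fact.mk hp
  have h1 := sub_one_mul_padicValNat_factorial (p := p) n
  have h2 : (p - 1) * padicValNat p n.factorial ≤ n := by rw [h1]; omega
  have h3 : (1 : ℝ) < p := by exact_mod_cast hp.one_lt
  rw [le_div_iff₀ (by linarith)]
  have h4 : (((p - 1) * padicValNat p n.factorial : ℕ) : ℝ) ≤ n := by exact_mod_cast h2
  rw [Nat.cast_mul, Nat.cast_sub hp.one_le] at h4
  push_cast at h4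
  linarith

lemma mertens_upper (n : ℕ) (hn : 1 ≤ n) :
    ∑ p ∈ Nat.primesLE n, Real.log p / p ≤ Real.log n + 2 := by
  have hn' : (0 : ℝ) < n := by exact_mod_cast hn
  have h1 : (n : ℝ) * ∑ p ∈ Nat.primesLE n, Real.log p / p - Chebyshev.theta n ≤ Real.log n.factorial := by
    rw [log_factorial_eq, Chebyshev.theta_eq_sum_primesLE_log, Finset.mul_sum, ← Finset.sum_sub_distrib]
    refine Finset.sum_le_sum (fun p hp => ?_)
    have hp' := (Nat.mem_primesLE.1 hp).2
    have := padic_fact_ge (n := n) hp'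
    have h2 : 0 ≤ Real.log p := Real.log_natCast_nonneg p
    calc _ = ((n : ℝ) / p - 1) * Real.log p := by ring
      _ ≤ _ := mul_le_mul_of_nonneg_right this h2
  have h2 := Chebyshev.theta_le_log4_mul_x hn'.le
  have h3 : Real.log n.factorial ≤ n * Real.log n := by
    rw [← Real.log_pow]
    apply Real.log_le_log (by positivity)
    exact_mod_cast Nat.factorial_le_pow n
  have h4 : Real.log 4 ≤ 2 := by
    have : (4 : ℝ) = 2 ^ 2 := by norm_num
    rw [this, Real.log_pow]
    have := Real.log_two_lt_d9
    norm_num; linarith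
  have h5 : (n : ℝ) * ∑ p ∈ Nat.primesLE n, Real.log p / p ≤ n * (Real.log n + 2) := by nlinarith
  exact le_of_mul_le_mul_left h5 hn'

lemma sum_log_sq : ∃ C : ℝ, 0 ≤ C ∧ ∀ s : Finset ℕ, ∑ p ∈ s, Real.log p / (p * (p - 1)) ≤ C := by
  have hs : Summable (fun n : ℕ => 4 * ((n : ℝ) ^ (3 / 2 : ℝ))⁻¹) :=
    (Real.summable_nat_rpow_inv.2 (by norm_num)).mul_left 4
  refine ⟨∑' n : ℕ, 4 * ((n : ℝ) ^ (3 / 2 : ℝ))⁻¹, tsum_nonneg (fun n => by positivity), fun s => ?_⟩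
  refine le_trans (Finset.sum_le_sum (fun n _ => ?_)) (hs.sum_le_tsum s (fun n _ => by positivity))
  by_cases hn : n ≤ 1
  · interval_cases n <;> simp
  have hn2 : (2 : ℝ) ≤ n := by exact_mod_cast (by omega : 2 ≤ n)
  have hl : Real.log n ≤ 2 * (n : ℝ) ^ (1 / 2 : ℝ) := by
    have := Real.log_le_rpow_div (x := n) (by linarith) (ε := 1 / 2) (by norm_num)
    linarith
  have hpw : (n : ℝ) ^ (1 / 2 : ℝ) * (n : ℝ) ^ (3 / 2 : ℝ) = n ^ 2 := by
    rw [← Real.rpow_add (by linarith), ← Real.rpow_natCast]; norm_num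
  have h0 : 0 < (n : ℝ) ^ (3 / 2 : ℝ) := Real.rpow_pos_of_pos (by linarith) _
  rw [div_le_iff₀ (by nlinarith)]
  have h6 : ((n : ℝ) ^ (3 / 2 : ℝ))⁻¹ * ((n : ℝ) ^ (1 / 2 : ℝ) * (n : ℝ) ^ (3 / 2 : ℝ)) = (n : ℝ) ^ (1 / 2 : ℝ) := by
    field_simp
  calc Real.log n ≤ 2 * (n : ℝ) ^ (1 / 2 : ℝ) := hl
    _ = 2 * (((n : ℝ) ^ (3 / 2 : ℝ))⁻¹ * n ^ 2) := by rw [← hpw, h6]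
    _ ≤ 2 * (((n : ℝ) ^ (3 / 2 : ℝ))⁻¹ * (2 * (n * (n - 1)))) := by
      gcongr; nlinarith
    _ = _ := by ring

lemma mertens_lower : ∃ C : ℝ, 0 ≤ C ∧ ∀ n : ℕ, 1 ≤ n →
    Real.log n - C ≤ ∑ p ∈ Nat.primesLE n, Real.log p / p := by
  obtain ⟨C, hC0, hC⟩ := sum_log_sq
  refine ⟨C + 1, by linarith, fun n hn => ?_⟩
  have hn' : (0 : ℝ) < n := by exact_mod_cast hn
  have h1 : Real.log n.factorial ≤ n * ∑ p ∈ Nat.primesLE n, Real.log p / (p - 1) := by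
    rw [log_factorial_eq, Finset.mul_sum]
    refine Finset.sum_le_sum (fun p hp => ?_)
    have := padic_fact_le (n := n) (Nat.mem_primesLE.1 hp).2
    have h2 : 0 ≤ Real.log p := Real.log_natCast_nonneg p
    calc _ ≤ (n : ℝ) / (p - 1) * Real.log p := mul_le_mul_of_nonneg_right this h2
      _ = _ := by ring
  have h2 : n * Real.log n - n ≤ Real.log n.factorial := by
    have := Stirling.le_log_factorial_stirling (n := n) (by omega)
    have h3 : 0 ≤ Real.log n := Real.log_natCast_nonneg n
    have h4 : 0 ≤ Real.log (2 * Real.pi) := Real.log_nonneg (by linarith [Real.pi_gt_three])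
    linarith
  have h3 : ∑ p ∈ Nat.primesLE n, Real.log p / ((p : ℝ) - 1) =
      ∑ p ∈ Nat.primesLE n, Real.log p / p + ∑ p ∈ Nat.primesLE n, Real.log p / (p * (p - 1)) := by
    rw [← Finset.sum_add_distrib]
    refine Finset.sum_congr rfl (fun p hp => ?_)
    have h3 : (1 : ℝ) < p := by exact_mod_cast (Nat.mem_primesLE.1 hp).2.one_lt
    have : (p : ℝ) - 1 ≠ 0 := by linarith
    field_simp
    ring
  have h4 := hC (Nat.primesLE n)
  have h5 : (n : ℝ) * (Real.log n - 1) ≤ n * ∑ p ∈ Nat.primesLE n, Real.log p / (p - 1) := by linarith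
  have := le_of_mul_le_mul_left h5 hn'
  linarith

lemma sum_log_tail (k : ℕ) : ∀ (X : ℝ) (s : Finset ℕ), 1 ≤ X →
    (∀ p ∈ s, p.Prime ∧ X < p ∧ (p : ℝ) ≤ 2 ^ k * X) →
    ∑ p ∈ s, Real.log p / (p * Real.sqrt p) ≤ 16 / Real.sqrt X := by
  induction k with
  | zero =>
    intro X s hX hs
    have : s = ∅ := by
      apply Finset.eq_empty_of_forall_notMem
      intro p hp
      have := hs p hp
      linarith [this.2.1, this.2.2]
    rw [this, Finset.sum_empty]; positivity
  | succ k ih =>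
    intro X s hX hs
    have hX0 : 0 < X := by linarith
    have hsX : 0 < Real.sqrt X := Real.sqrt_pos.2 hX0
    rw [← Finset.sum_filter_add_sum_filter_not s (fun p => 2 * X < (p : ℝ))]
    have h1 := ih (2 * X) (s.filter (fun p => 2 * X < (p : ℝ))) (by linarith) (by
      intro p hp
      rw [Finset.mem_filter] at hp
      have := hs p hp.1
      refine ⟨this.1, hp.2, ?_⟩
      have h2 := this.2.2
      rw [pow_succ] at h2
      linarith)
    have h2 : ∑ p ∈ s.filter (fun p : ℕ => ¬ 2 * X < (p : ℝ)), Real.log (p : ℝ) / ((p : ℝ) * Real.sqrt (p : ℝ)) ≤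
        (1 / (X * Real.sqrt X)) * Chebyshev.theta (2 * X) := by
      rw [Chebyshev.theta_eq_sum_primesLE, Finset.mul_sum]
      refine le_trans (Finset.sum_le_sum (g := fun p : ℕ => 1 / (X * Real.sqrt X) * Real.log p) ?_)
        (Finset.sum_le_sum_of_subset_of_nonneg ?_ ?_)
      · intro p hp
        rw [Finset.mem_filter] at hp
        have h3 := hs p hp.1
        have : 0 ≤ Real.log p := Real.log_natCast_nonneg p
        rw [div_eq_mul_one_div, mul_comm]
        apply mul_le_mul_of_nonneg_right _ this
        apply one_div_le_one_div_of_le (by positivity)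
        exact mul_le_mul h3.2.1.le (Real.sqrt_le_sqrt h3.2.1.le) hsX.le (by positivity)
      · intro p hp
        rw [Finset.mem_filter] at hp
        have h3 := hs p hp.1
        rw [Nat.mem_primesLE]
        exact ⟨Nat.le_floor (by linarith [hp.2]), h3.1⟩
      · intro p _ _
        have : 0 ≤ Real.log p := Real.log_natCast_nonneg p
        positivity
    have h3 := Chebyshev.theta_le_log4_mul_x (x := 2 * X) (by linarith)
    have h4 : Real.log 4 ≤ 2 := by
      have : (4 : ℝ) = 2 ^ 2 := by norm_num
      rw [this, Real.log_pow]
      have := Real.log_two_lt_d9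
      norm_num; linarith
    have h5 : (1 / (X * Real.sqrt X)) * Chebyshev.theta (2 * X) ≤ 4 / Real.sqrt X := by
      calc _ ≤ (1 / (X * Real.sqrt X)) * (2 * (2 * X)) := by
            apply mul_le_mul_of_nonneg_left _ (by positivity)
            exact h3.trans (mul_le_mul_of_nonneg_right h4 (by linarith))
        _ = _ := by field_simp; norm_num
    have h6 : 16 / Real.sqrt (2 * X) ≤ 12 / Real.sqrt X := by
      rw [Real.sqrt_mul (by norm_num)]
      have : (4 / 3 : ℝ) ≤ Real.sqrt 2 := Real.le_sqrt_of_sq_le (by norm_num)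
      rw [div_le_div_iff₀ (by positivity) hsX]
      nlinarith
    have h7 : 12 / Real.sqrt X + 4 / Real.sqrt X = 16 / Real.sqrt X := by ring
    linarith

lemma good_sum : ∃ C : ℝ, 0 ≤ C ∧ ∀ (d s : ℕ) (Bd : Finset ℕ) (n : ℕ → ℝ), 1 ≤ d → 1 ≤ s →
    (∀ p ∈ Bd, p.Prime) →
    (∀ p : ℕ, p.Prime → 10 ^ 6 * d ^ 4 < p → p ∉ Bd → 0 < n p ∧ n p ≤ p + 65 * d ^ 2 * Real.sqrt p) →
    Real.log s - 4 * Real.log d - ∑ p ∈ Bd, Real.log p / p - C ≤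
      ∑ p ∈ (Nat.primesLE s).filter (fun p => 10 ^ 6 * d ^ 4 < p ∧ p ∉ Bd), Real.log p / n p := by
  obtain ⟨C, hC0, hC⟩ := mertens_lower
  refine ⟨C + 2 + Real.log 1000000 + 2, by have := Real.log_nonneg (x := 1000000) (by norm_num); linarith,
    fun d s Bd n hd hs hB hn => ?_⟩
  classical
  set K := 10 ^ 6 * d ^ 4 with hK
  set G := (Nat.primesLE s).filter (fun p => K < p ∧ p ∉ Bd) with hG
  have hlog : ∀ p : ℕ, 0 ≤ Real.log p / p := fun p => by
    have : 0 ≤ Real.log p := Real.log_natCast_nonneg p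
    positivity
  have hd0 : (0 : ℝ) < d := by exact_mod_cast hd
  have h1 : ∑ p ∈ Nat.primesLE s, Real.log p / p ≤
      ∑ p ∈ G, Real.log p / p + ∑ p ∈ Nat.primesLE K, Real.log p / p + ∑ p ∈ Bd, Real.log p / p := by
    have hsub : Nat.primesLE s ⊆ (G ∪ Nat.primesLE K) ∪ Bd := by
      intro p hp
      simp only [Finset.mem_union, hG, Finset.mem_filter, hp, true_and, Nat.mem_primesLE]
      have := (Nat.mem_primesLE.1 hp).2
      by_cases h : p ∈ Bd
      · tauto
      · by_cases h' : K < p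
        · tauto
        · exact Or.inl (Or.inr ⟨by omega, this⟩)
    have hun : ∀ A B : Finset ℕ, ∑ p ∈ A ∪ B, Real.log p / p ≤
        ∑ p ∈ A, Real.log p / p + ∑ p ∈ B, Real.log p / p := by
      intro A B
      rw [← Finset.sum_union_inter]
      have := Finset.sum_nonneg (s := A ∩ B) (fun p _ => hlog p)
      linarith
    calc _ ≤ _ := Finset.sum_le_sum_of_subset_of_nonneg hsub (fun p _ _ => hlog p)
      _ ≤ _ := (hun _ _).trans (by linarith [hun G (Nat.primesLE K)])
  have h2 := mertens_upper K (Nat.one_le_iff_ne_zero.2 (by positivity))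
  have h3 := hC s hs
  have h4 : Real.log K = Real.log 1000000 + 4 * Real.log d := by
    rw [hK]; push_cast
    rw [Real.log_mul (by norm_num) (by positivity), Real.log_pow (d : ℝ)]; norm_num
  have h5 : ∑ p ∈ G, Real.log p / p - 65 * d ^ 2 * ∑ p ∈ G, Real.log p / (p * Real.sqrt p) ≤
      ∑ p ∈ G, Real.log p / n p := by
    rw [Finset.mul_sum, ← Finset.sum_sub_distrib]
    refine Finset.sum_le_sum (fun p hp => ?_)
    rw [hG, Finset.mem_filter] at hp
    have hpp := (Nat.mem_primesLE.1 hp.1).2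
    obtain ⟨hn0, hn1⟩ := hn p hpp hp.2.1 hp.2.2
    have hp0 : (0 : ℝ) < p := by exact_mod_cast hpp.pos
    have hl : 0 ≤ Real.log p := Real.log_natCast_nonneg p
    have hsq : Real.sqrt p * Real.sqrt p = p := Real.mul_self_sqrt hp0.le
    have hsp : 0 < Real.sqrt p := Real.sqrt_pos.2 hp0
    have key : 1 / (p : ℝ) - 65 * d ^ 2 * (1 / (p * Real.sqrt p)) ≤ 1 / n p := by
      have h6 : 1 / ((p : ℝ) + 65 * d ^ 2 * Real.sqrt p) ≤ 1 / n p := one_div_le_one_div_of_le hn0 hn1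
      refine le_trans ?_ h6
      rw [le_div_iff₀ (by positivity)]
      set q := Real.sqrt p
      rw [← hsq]
      have : (1 / (q * q) - 65 * (d : ℝ) ^ 2 * (1 / (q * q * q))) * (q * q + 65 * d ^ 2 * q)
        = 1 - (65 * d ^ 2) ^ 2 / (q * q) := by field_simp; ring
      rw [this]
      have : 0 ≤ (65 * (d : ℝ) ^ 2) ^ 2 / (q * q) := by positivity
      linarith
    calc _ = Real.log p * (1 / (p : ℝ) - 65 * d ^ 2 * (1 / (p * Real.sqrt p))) := by ring
      _ ≤ Real.log p * (1 / n p) := mul_le_mul_of_nonneg_left key hl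
      _ = _ := by ring
  have h6 : ∑ p ∈ G, Real.log p / (p * Real.sqrt p) ≤ 16 / Real.sqrt K := by
    obtain ⟨k, hk⟩ := pow_unbounded_of_one_lt (s : ℝ) (by norm_num : (1 : ℝ) < 2)
    have hK1 : (1 : ℝ) ≤ K := by
      have : 1 ≤ K := by rw [hK]; exact Nat.one_le_iff_ne_zero.2 (by positivity)
      exact_mod_cast this
    refine sum_log_tail k K G hK1 (fun p hp => ?_)
    rw [hG, Finset.mem_filter] at hp
    refine ⟨(Nat.mem_primesLE.1 hp.1).2, by exact_mod_cast hp.2.1, ?_⟩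
    have : (p : ℝ) ≤ s := by exact_mod_cast (Nat.mem_primesLE.1 hp.1).1
    nlinarith [pow_pos (by norm_num : (0 : ℝ) < 2) k]
  have h7 : Real.sqrt K = 1000 * d ^ 2 := by
    rw [hK]; push_cast
    rw [show (1000000 : ℝ) * d ^ 4 = (1000 * d ^ 2) ^ 2 by ring]
    exact Real.sqrt_sq (by positivity)
  have h8 : 65 * (d : ℝ) ^ 2 * ∑ p ∈ G, Real.log p / (p * Real.sqrt p) ≤ 2 := by
    calc _ ≤ 65 * (d : ℝ) ^ 2 * (16 / Real.sqrt K) := mul_le_mul_of_nonneg_left h6 (by positivity)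
      _ = 65 * 16 / 1000 := by rw [h7]; field_simp
      _ ≤ 2 := by norm_num
  linarith

lemma b_upper : ∃ C : ℝ, 0 ≤ C ∧ ∀ (d : ℕ) (Bd : Finset ℕ) (T : ℝ), 1 ≤ d →
    (∀ p ∈ Bd, p.Prime ∧ d ^ 4 < p) → ∑ p ∈ Bd, Real.log p ≤ T →
    Real.exp (∑ p ∈ Bd, Real.log p / p) ≤ C * (1 + T / d ^ 4) := by
  obtain ⟨C, hC0, hC⟩ := mertens_lower
  refine ⟨2 * Real.exp (C + 3), by positivity, fun d Bd T hd hB hT => ?_⟩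
  classical
  have hd0 : (0 : ℝ) < d := by exact_mod_cast hd
  have hlog0 : ∀ p : ℕ, 0 ≤ Real.log p := fun p => Real.log_natCast_nonneg p
  have hlog : ∀ p : ℕ, 0 ≤ Real.log p / p := fun p => by
    have := hlog0 p
    positivity
  have hT0 : 0 ≤ T := (Finset.sum_nonneg (fun p _ => hlog0 p)).trans hT
  set X := d ^ 4 + ⌈T⌉₊ with hX
  have hX1 : 1 ≤ d ^ 4 := Nat.one_le_pow _ _ hd
  have hXT : T ≤ X := by
    rw [hX]; push_cast
    have := Nat.le_ceil T
    have : 0 ≤ (d : ℝ) ^ 4 := by positivity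
    linarith
  have hX0 : (0 : ℝ) < X := by exact_mod_cast (by omega : 0 < X)
  have hXu : (X : ℝ) ≤ 2 * d ^ 4 + T := by
    have := (Nat.ceil_lt_add_one hT0).le
    have h1 : (1 : ℝ) ≤ d ^ 4 := by exact_mod_cast hX1
    rw [hX]; push_cast; linarith
  have h1 : ∑ p ∈ Bd.filter (fun p => p ≤ X), Real.log p / p + ∑ p ∈ Nat.primesLE (d ^ 4), Real.log p / p
      ≤ ∑ p ∈ Nat.primesLE X, Real.log p / p := by
    rw [← Finset.sum_union]
    · refine Finset.sum_le_sum_of_subset_of_nonneg ?_ (fun p _ _ => hlog p)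
      intro p hp
      rw [Finset.mem_union, Finset.mem_filter, Nat.mem_primesLE] at hp
      rw [Nat.mem_primesLE]
      rcases hp with hp | hp
      · exact ⟨hp.2, (hB p hp.1).1⟩
      · exact ⟨by omega, hp.2⟩
    · rw [Finset.disjoint_left]
      intro p hp hp'
      have := (hB p (Finset.mem_filter.1 hp).1).2
      have := (Nat.mem_primesLE.1 hp').1
      omega
  have h2 : ∑ p ∈ Bd.filter (fun p => ¬ p ≤ X), Real.log p / p ≤ 1 := by
    calc _ ≤ ∑ p ∈ Bd.filter (fun p => ¬ p ≤ X), Real.log p / X := by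
          refine Finset.sum_le_sum (fun p hp => ?_)
          have h3 : X ≤ p := by have := (Finset.mem_filter.1 hp).2; omega
          exact div_le_div_of_nonneg_left (hlog0 p) hX0 (by exact_mod_cast h3)
      _ = (∑ p ∈ Bd.filter (fun p => ¬ p ≤ X), Real.log p) / X := by rw [Finset.sum_div]
      _ ≤ T / X := by
        apply div_le_div_of_nonneg_right _ hX0.le
        exact (Finset.sum_le_sum_of_subset_of_nonneg (Finset.filter_subset _ _) (fun p _ _ => hlog0 p)).trans hT
      _ ≤ 1 := by rw [div_le_one hX0]; exact hXT
  have h3 := mertens_upper X (by omega)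
  have h4 := hC (d ^ 4) hX1
  have h5 := Finset.sum_filter_add_sum_filter_not Bd (fun p => p ≤ X) (fun p : ℕ => Real.log p / p)
  have h6 : ∑ p ∈ Bd, Real.log p / p ≤ Real.log X - Real.log ((d : ℝ) ^ 4) + (C + 3) := by
    push_cast at h4
    linarith
  calc _ ≤ Real.exp (Real.log X - Real.log ((d : ℝ) ^ 4) + (C + 3)) := Real.exp_le_exp.2 h6
    _ = X / d ^ 4 * Real.exp (C + 3) := by
      rw [Real.exp_add, Real.exp_sub, Real.exp_log hX0, Real.exp_log (by positivity)]
    _ ≤ (2 * d ^ 4 + T) / d ^ 4 * Real.exp (C + 3) := by gcongr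
    _ ≤ (2 * (1 + T / d ^ 4)) * Real.exp (C + 3) := by
      gcongr
      rw [add_div, mul_div_assoc, div_self (by positivity)]
      have : 0 ≤ T / (d : ℝ) ^ 4 := by positivity
      linarith
    _ = _ := by ring
end PAC
end

-- part R3
section
open MvPolynomial
namespace PAC

lemma map_ne_zero_of_prim {f : MvPolynomial (Fin 2) ℤ} (hprim : Finset.gcd f.support f.coeff = 1)
    {L : Type*} [Field L] {p : ℕ} [CharP L p] (hp : p.Prime) : map (Int.castRingHom L) f ≠ 0 := by
  intro h
  have h1 : ∀ m ∈ f.support, (p : ℤ) ∣ f.coeff m := by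
    intro m _
    have := congrArg (coeff m) h
    rw [coeff_map, coeff_zero] at this
    exact (CharP.intCast_eq_zero_iff L p _).1 this
  have h2 := Finset.dvd_gcd h1
  rw [hprim] at h2
  exact hp.one_lt.ne' (by have := Int.eq_one_of_dvd_one (by positivity) h2; exact_mod_cast this)

lemma log_aux {d H : ℕ} (hd1 : 1 ≤ d) (hH1 : 1 ≤ H) :
    Real.log ((d * (d + 1)).factorial * (2 * d * H : ℝ) ^ (d * (d + 1))) ≤ 10 * d ^ 4 + 2 * d ^ 2 * Real.log H := by
  have hd0 : (1 : ℝ) ≤ d := by exact_mod_cast hd1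
  have hH0 : (1 : ℝ) ≤ H := by exact_mod_cast hH1
  set n := d * (d + 1) with hn
  have hn1 : 1 ≤ n := by rw [hn]; exact Nat.one_le_iff_ne_zero.2 (by positivity)
  have hnr : (n : ℝ) ≤ 2 * d ^ 2 := by rw [hn]; push_cast; nlinarith
  have hn0 : (1 : ℝ) ≤ n := by exact_mod_cast hn1
  have h1 : Real.log n.factorial ≤ n * Real.log n := by
    rw [← Real.log_pow]
    apply Real.log_le_log (by positivity)
    exact_mod_cast Nat.factorial_le_pow n
  have h2 : Real.log n ≤ 1 + 2 * d := by
    have := Real.log_le_log (by linarith) hnr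
    rw [Real.log_mul (by norm_num) (by positivity), Real.log_pow] at this
    have h3 := Real.log_le_sub_one_of_pos (show (0 : ℝ) < d by linarith)
    have h4 := Real.log_two_lt_d9
    push_cast at this
    linarith
  have h3 : Real.log (2 * d * H) ≤ 1 + d + Real.log H := by
    rw [Real.log_mul (by positivity) (by positivity), Real.log_mul (by norm_num) (by positivity)]
    have h3 := Real.log_le_sub_one_of_pos (show (0 : ℝ) < d by linarith)
    have h4 := Real.log_two_lt_d9
    linarith
  rw [Real.log_mul (by positivity) (by positivity), Real.log_pow]
  have h4 : 0 ≤ Real.log H := Real.log_nonneg hH0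
  calc _ ≤ (n : ℝ) * (1 + 2 * d) + n * (1 + d + Real.log H) := by
        refine add_le_add (h1.trans ?_) ?_
        · exact mul_le_mul_of_nonneg_left h2 (by positivity)
        · exact mul_le_mul_of_nonneg_left h3 (by positivity)
    _ = (n : ℝ) * (2 + 3 * d + Real.log H) := by ring
    _ ≤ (2 * d ^ 2) * (2 + 3 * d + Real.log H) := mul_le_mul_of_nonneg_right hnr (by positivity)
    _ ≤ _ := by
      have : 2 + 3 * (d : ℝ) ≤ 5 * d ^ 2 := by nlinarith
      nlinarith [sq_nonneg (d : ℝ)]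

theorem bad_primes {f : MvPolynomial (Fin 2) ℤ} {d : ℕ} (hd1 : 1 ≤ d) (hd : f.totalDegree = d)
    (hprim : Finset.gcd f.support f.coeff = 1)
    (hf : Irreducible (map (Int.castRingHom ℚ) f)) {H : ℕ} (hH : ∀ m, |f.coeff m| ≤ H)
    {P : Fin 2 → ℤ} (hP : eval P f = 0) {j : Fin 2} (hj : eval P (pderiv j f) ≠ 0) :
    ∃ Bd : Finset ℕ, (∀ p ∈ Bd, p.Prime ∧ 27 * d ^ 4 < p) ∧
      (∀ (p : ℕ) [Fact p.Prime], 27 * d ^ 4 < p → p ∉ Bd →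
        Irreducible (map (Int.castRingHom (AlgebraicClosure (ZMod p))) f)) ∧
      badness f = Real.exp (∑ p ∈ Bd, Real.log p / p) ∧
      ∑ p ∈ Bd, Real.log p ≤ 10 * d ^ 4 + 2 * d ^ 2 * Real.log H := by
  classical
  obtain ⟨Δ, hΔ0, hΔ, hΔL⟩ := ruppert hd1 hd hf hH hP hj
  have hf0 : f ≠ 0 := by rintro rfl; simp at hj
  have hH1 : 1 ≤ H := by
    obtain ⟨m0, hm0⟩ := MvPolynomial.ne_zero_iff.1 hf0
    exact_mod_cast (Int.one_le_abs hm0).trans (hH m0)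
  have habs : Irreducible (map (Int.castRingHom (AlgebraicClosure ℚ)) f) := by
    by_contra h
    have := hΔL (AlgebraicClosure ℚ) (fun n hn _ => by exact_mod_cast hn.ne')
      (fun h => hf0 (map_injective _ (RingHom.injective_int _) (by rw [h, map_zero]))) h
    exact hΔ0 (by exact_mod_cast this)
  set S := {p : ℕ | ∃ hp : Nat.Prime p, 27 * f.totalDegree ^ 4 < p ∧
        ¬ Irreducible (letI : Fact (Nat.Prime p) := ⟨hp⟩;
          MvPolynomial.map (Int.castRingHom (AlgebraicClosure (ZMod p))) f)} with hS
  have hdvd : ∀ p ∈ S, p.Prime ∧ p ∣ Δ.natAbs := by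
    rintro p ⟨hp, h1, h2⟩
    haveI : Fact p.Prime := ⟨hp⟩
    refine ⟨hp, ?_⟩
    haveI : CharP (AlgebraicClosure (ZMod p)) p :=
      charP_of_injective_algebraMap (algebraMap (ZMod p) (AlgebraicClosure (ZMod p))).injective p
    have := hΔL (AlgebraicClosure (ZMod p)) (fun n hn hnd h => by
      rw [CharP.cast_eq_zero_iff _ p] at h
      have h3 := Nat.le_of_dvd hn h
      rw [hd] at h1
      have : d ≤ d ^ 4 := Nat.le_self_pow (by norm_num) d
      omega) (map_ne_zero_of_prim hprim hp) h2
    rw [CharP.intCast_eq_zero_iff _ p] at this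
    exact Int.natCast_dvd.1 this
  have hΔn : Δ.natAbs ≠ 0 := by simpa using hΔ0
  have hfin : S.Finite := by
    refine Set.Finite.subset (Δ.natAbs.primeFactors.finite_toSet) (fun p hp => ?_)
    obtain ⟨h1, h2⟩ := hdvd p hp
    exact Nat.mem_primeFactors.2 ⟨h1, h2, hΔn⟩
  refine ⟨hfin.toFinset, ?_, ?_, ?_, ?_⟩
  · intro p hp
    rw [Set.Finite.mem_toFinset] at hp
    obtain ⟨h1, h2, _⟩ := hp
    exact ⟨h1, hd ▸ h2⟩
  · intro p hpf h27 hp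
    rw [Set.Finite.mem_toFinset] at hp
    by_contra h
    exact hp ⟨hpf.out, hd.symm ▸ h27, h⟩
  · unfold badness
    rw [if_pos habs, ← hS, Real.exp_sum, finprod_mem_eq_finite_toFinset_prod _ hfin]
  · have h1 : (∏ p ∈ hfin.toFinset, p) ∣ Δ.natAbs := by
      apply Finset.prod_primes_dvd
      · intro p hp
        rw [Set.Finite.mem_toFinset] at hp
        exact (hdvd p hp).1.prime
      · intro p hp
        rw [Set.Finite.mem_toFinset] at hp
        exact (hdvd p hp).2
    have h2 := Nat.le_of_dvd (Nat.pos_of_ne_zero hΔn) h1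
    have h3 : ∑ p ∈ hfin.toFinset, Real.log p = Real.log ((∏ p ∈ hfin.toFinset, p : ℕ) : ℝ) := by
      rw [Nat.cast_prod, Real.log_prod]
      intro p hp
      rw [Set.Finite.mem_toFinset] at hp
      exact_mod_cast (hdvd p hp).1.ne_zero
    have hpos : 0 < ∏ p ∈ hfin.toFinset, p := by
      apply Finset.prod_pos
      intro p hp
      rw [Set.Finite.mem_toFinset] at hp
      exact (hdvd p hp).1.pos
    rw [h3]
    refine le_trans (Real.log_le_log (by exact_mod_cast hpos) ?_) (log_aux hd1 hH1)
    have h4 : ((Δ.natAbs : ℤ)) ≤ (d * (d + 1)).factorial * (2 * d * H : ℤ) ^ (d * (d + 1)) := by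
      rw [Int.natCast_natAbs]; exact hΔ
    have h5 : (((∏ p ∈ hfin.toFinset, p : ℕ) : ℤ)) ≤
      (d * (d + 1)).factorial * (2 * d * H : ℤ) ^ (d * (d + 1)) := le_trans (by exact_mod_cast h2) h4
    exact_mod_cast h5
end PAC
end

-- part L1
section
open MvPolynomial
namespace PAC

lemma det_dvd {ι T : Type*} [Fintype ι] [DecidableEq ι] [Fintype T] [DecidableEq T]
    (A : Matrix ι ι ℤ) (D : ι → ℤ) (W : T → ℤ) (U : Matrix T ι ℤ)
    (hU : ∀ t i, D i ∣ W t * U t i) (hA : ∀ r, ∃ a : T → ℤ, ∀ i, D i ∣ A r i - ∑ t, a t * U t i) :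
    (∏ i, D i) ∣ (∏ t, W t) * A.det := by
  choose V hV using hU
  choose a ha using hA
  choose E hE using ha
  have key : Matrix.fromBlocks (Matrix.diagonal W) (-(Matrix.of V)) (Matrix.of a) (Matrix.of E) *
      Matrix.fromBlocks 1 U 0 (Matrix.diagonal D) =
      Matrix.fromBlocks (Matrix.diagonal W) 0 (Matrix.of a) A := by
    rw [Matrix.fromBlocks_multiply]
    congr 1
    · simp
    · ext t i
      simp only [Matrix.add_apply, Matrix.diagonal_mul, Matrix.mul_diagonal, Matrix.neg_apply,
        Matrix.of_apply, Matrix.zero_apply]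
      linear_combination hV t i
    · simp
    · ext r i
      rw [Matrix.add_apply, Matrix.mul_diagonal, Matrix.mul_apply]
      simp only [Matrix.of_apply]
      linear_combination - hE r i
  have h := congrArg Matrix.det key
  rw [Matrix.det_mul, Matrix.det_fromBlocks_zero₂₁, Matrix.det_fromBlocks_zero₁₂, Matrix.det_diagonal,
    Matrix.det_diagonal, Matrix.det_one, one_mul] at h
  exact ⟨_, by rw [← h, mul_comm]⟩

section
variable {R : Type*} [CommRing R]

/-- restriction to a line through `c` -/
noncomputable def tau (j : Fin 2) (c : Fin 2 → R) : MvPolynomial (Fin 2) R →ₐ[R] Polynomial R :=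
  aeval (fun i => if i = j then Polynomial.X + Polynomial.C (c i) else Polynomial.C (c i))

/-- section of `tau` -/
noncomputable def rho (j : Fin 2) (c : Fin 2 → R) : Polynomial R →ₐ[R] MvPolynomial (Fin 2) R :=
  Polynomial.aeval (X j - C (c j))

lemma eval_rho (j : Fin 2) (c : Fin 2 → R) (g : Polynomial R) (P : Fin 2 → R) :
    eval P (rho j c g) = g.eval (P j - c j) := by
  unfold rho
  induction g using Polynomial.induction_on' with
  | add p q hp hq => simp [hp, hq]
  | monomial n a => simp [Polynomial.aeval_monomial, MvPolynomial.algebraMap_eq]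

lemma tau_spec {j j' : Fin 2} (hjj : j ≠ j') (c : Fin 2 → R) (g : MvPolynomial (Fin 2) R) :
    ∃ g2, g = rho j c (tau j c g) + (X j' - C (c j')) * g2 := by
  induction g using MvPolynomial.induction_on with
  | C a => exact ⟨0, by simp [tau, rho, MvPolynomial.algebraMap_eq]⟩
  | add p q hp hq =>
    obtain ⟨a, ha⟩ := hp
    obtain ⟨b, hb⟩ := hq
    refine ⟨a + b, ?_⟩
    rw [map_add, map_add]
    linear_combination ha + hb
  | mul_X p i hp =>
    obtain ⟨a, ha⟩ := hp
    by_cases hi : i = j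
    · refine ⟨a * X i, ?_⟩
      rw [map_mul, map_mul]
      have : rho j c (tau j c (X i)) = X i := by simp [tau, rho, hi, MvPolynomial.algebraMap_eq]
      rw [this]
      linear_combination (X i) * ha
    · have hi' : i = j' := by omega
      refine ⟨rho j c (tau j c p) + a * X i, ?_⟩
      rw [map_mul, map_mul]
      have : rho j c (tau j c (X i)) = C (c j') := by
        simp [tau, rho, hi, hi', hjj.symm, MvPolynomial.algebraMap_eq]
      rw [this, ← hi']
      rw [← hi'] at ha
      linear_combination (X i) * ha

lemma tau_map {S : Type*} [CommRing S] (φ : R →+* S) (j : Fin 2) (c : Fin 2 → R) (g : MvPolynomial (Fin 2) R) :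
    (tau j c g).map φ = tau j (φ ∘ c) (map φ g) := by
  induction g using MvPolynomial.induction_on with
  | C a => simp [tau, Polynomial.algebraMap_eq]
  | add p q hp hq => simp [hp, hq]
  | mul_X p i hp =>
    simp only [map_mul, Polynomial.map_mul, hp, map_X]
    congr 1
    simp only [tau, aeval_X]
    split_ifs <;> simp

end

/-- step lemma -/
lemma local_step {p : ℕ} [Fact p.Prime] {f : MvPolynomial (Fin 2) ℤ} {j j' : Fin 2} (hjj : j ≠ j') (c : Fin 2 → ℤ)
    {m : ℕ} {u : Polynomial (ZMod p)} (hu : u.eval 0 ≠ 0)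
    (hfu : (tau j c f).map (Int.castRingHom (ZMod p)) = Polynomial.X ^ m * u) (k : ℕ)
    (g : MvPolynomial (Fin 2) ℤ) : ∃ (a : ℕ → ℤ) (g1 g2 : MvPolynomial (Fin 2) ℤ),
      ∀ P : Fin 2 → ℤ, eval P f = 0 → (p : ℤ) ∣ P j - c j →
        (p : ℤ) ^ k ∣ eval P g - (∑ i ∈ Finset.range m, a i * (P j - c j) ^ i + p * eval P g1 +
          (P j' - c j') * eval P g2) := by
  obtain ⟨f2, hf2⟩ := tau_spec hjj c f
  obtain ⟨g2, hg2⟩ := tau_spec hjj c g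
  have hcop : IsCoprime u (Polynomial.X ^ k) := by
    apply IsCoprime.pow_right
    rw [isCoprime_comm, (Polynomial.irreducible_X).coprime_iff_not_dvd, Polynomial.X_dvd_iff,
      Polynomial.coeff_zero_eq_eval_zero]
    exact hu
  obtain ⟨α, β, hαβ⟩ := hcop
  have hsurj : Function.Surjective (Polynomial.map (Int.castRingHom (ZMod p))) :=
    Polynomial.map_surjective _ (ZMod.intCast_surjective)
  obtain ⟨α', rfl⟩ := hsurj α
  obtain ⟨β', rfl⟩ := hsurj β
  have hker : ∃ r : Polynomial ℤ, Polynomial.X ^ m - α' * tau j c f - β' * Polynomial.X ^ (k + m) =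
      Polynomial.C (p : ℤ) * r := by
    rw [← dvd_def, Polynomial.C_dvd_iff_dvd_coeff]
    intro i
    rw [← ZMod.intCast_zmod_eq_zero_iff_dvd]
    have h0 : (Polynomial.X ^ m - α' * tau j c f - β' * Polynomial.X ^ (k + m)).map
        (Int.castRingHom (ZMod p)) = 0 := by
      simp only [Polynomial.map_sub, Polynomial.map_mul, Polynomial.map_pow, Polynomial.map_X, hfu]
      rw [pow_add]
      linear_combination (- Polynomial.X ^ m) * hαβ
    have := congrArg (fun q => Polynomial.coeff q i) h0
    rwa [Polynomial.coeff_map, Polynomial.coeff_zero] at this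
  obtain ⟨r, hr⟩ := hker
  set G := tau j c g with hG
  have hmon : (Polynomial.X ^ m : Polynomial ℤ).Monic := Polynomial.monic_X_pow m
  set q := G /ₘ (Polynomial.X ^ m) with hq
  set rem := G %ₘ (Polynomial.X ^ m) with hrem
  have hdiv : rem + Polynomial.X ^ m * q = G := Polynomial.modByMonic_add_div G _
  have hremdeg : rem.degree < m := by
    have := Polynomial.degree_modByMonic_lt G hmon
    rwa [Polynomial.degree_X_pow] at this
  have hremsum : rem = ∑ i ∈ Finset.range m, Polynomial.C (rem.coeff i) * Polynomial.X ^ i := by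
    by_cases h0 : rem = 0
    · rw [h0]; simp
    · apply Polynomial.as_sum_range_C_mul_X_pow'
      rwa [Polynomial.degree_eq_natDegree h0, Nat.cast_lt] at hremdeg
  refine ⟨rem.coeff, rho j c (r * q), g2 - rho j c (α' * q) * f2, fun P hP hpd => ?_⟩
  set ξ := P j - c j with hξ
  have e1 := congrArg (eval P) hf2
  have e2 := congrArg (eval P) hg2
  have e3 := congrArg (Polynomial.eval ξ) hr
  have e4 := congrArg (Polynomial.eval ξ) hdiv
  have e5 := congrArg (Polynomial.eval ξ) hremsum
  rw [Polynomial.eval_finsetSum] at e5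
  simp only [Polynomial.eval_mul, Polynomial.eval_C, Polynomial.eval_pow, Polynomial.eval_X,
    Polynomial.eval_sub, Polynomial.eval_add] at e3 e4 e5
  simp only [map_add, map_mul, map_sub, eval_rho, eval_X, eval_C, hP] at e1 e2
  rw [← hξ] at e1 e2
  simp only [map_sub, map_mul, eval_rho, Polynomial.eval_mul]
  rw [← hξ, ← e5]
  have h1 : (p : ℤ) ^ k ∣ ξ ^ (k + m) := (pow_dvd_pow_of_dvd hpd k).trans (pow_dvd_pow _ (by omega))
  obtain ⟨z, hz⟩ := h1
  refine ⟨β'.eval ξ * z * q.eval ξ, ?_⟩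
  linear_combination e2 - e4 + (q.eval ξ) * e3 + q.eval ξ * β'.eval ξ * hz - α'.eval ξ * q.eval ξ * e1

/-- normal form on a residue class -/
lemma local_nf {p : ℕ} [Fact p.Prime] {f : MvPolynomial (Fin 2) ℤ} {j j' : Fin 2} (hjj : j ≠ j') (c : Fin 2 → ℤ)
    {m : ℕ} {u : Polynomial (ZMod p)} (hu : u.eval 0 ≠ 0)
    (hfu : (tau j c f).map (Int.castRingHom (ZMod p)) = Polynomial.X ^ m * u) (k : ℕ) :
    ∀ g : MvPolynomial (Fin 2) ℤ, ∃ (a : ℕ → ℕ → ℤ),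
      ∀ P : Fin 2 → ℤ, eval P f = 0 → (p : ℤ) ∣ P j - c j → (p : ℤ) ∣ P j' - c j' →
        (p : ℤ) ^ k ∣ eval P g - ∑ i ∈ Finset.range m, ∑ l ∈ Finset.range k,
          a i l * ((P j - c j) ^ i * (P j' - c j') ^ l) := by
  induction k with
  | zero => intro g; exact ⟨0, fun P _ _ _ => by simp⟩
  | succ k ih =>
    intro g
    obtain ⟨a, g1, g2, h⟩ := local_step hjj c hu hfu (k + 1) g
    obtain ⟨a1, h1⟩ := ih g1
    obtain ⟨a2, h2⟩ := ih g2
    refine ⟨fun i l => (if l = 0 then a i else 0) + (if l < k then p * a1 i l else 0) +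
      (if l = 0 then 0 else a2 i (l - 1)), fun P hP hj hj' => ?_⟩
    obtain ⟨z, hz⟩ := h P hP hj
    obtain ⟨z1, hz1⟩ := h1 P hP hj hj'
    obtain ⟨z2, hz2⟩ := h2 P hP hj hj'
    obtain ⟨y, hy⟩ := hj'
    set ξ := P j - c j
    set η := P j' - c j'
    have hsum : ∑ i ∈ Finset.range m, ∑ l ∈ Finset.range (k + 1),
          ((if l = 0 then a i else 0) + (if l < k then p * a1 i l else 0) +
      (if l = 0 then 0 else a2 i (l - 1))) * (ξ ^ i * η ^ l) =
      ∑ i ∈ Finset.range m, a i * ξ ^ i + p * (∑ i ∈ Finset.range m, ∑ l ∈ Finset.range k,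
          a1 i l * (ξ ^ i * η ^ l)) + η * (∑ i ∈ Finset.range m, ∑ l ∈ Finset.range k,
          a2 i l * (ξ ^ i * η ^ l)) := by
      rw [Finset.mul_sum, Finset.mul_sum, ← Finset.sum_add_distrib, ← Finset.sum_add_distrib]
      refine Finset.sum_congr rfl (fun i _ => ?_)
      simp only [add_mul, Finset.sum_add_distrib]
      congr 1
      · congr 1
        · rw [Finset.sum_range_succ']; simp
        · rw [Finset.sum_range_succ]; simp only [lt_irrefl, if_false, zero_mul, add_zero]
          rw [Finset.mul_sum]
          refine Finset.sum_congr rfl (fun l hl => ?_)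
          rw [if_pos (Finset.mem_range.1 hl)]; ring
      · rw [Finset.sum_range_succ']; simp only [if_true, zero_mul, add_zero]
        rw [Finset.mul_sum]
        refine Finset.sum_congr rfl (fun l hl => ?_)
        simp; ring
    rw [hsum]
    refine ⟨z + z1 + y * z2, ?_⟩
    rw [pow_succ] at hz ⊢
    linear_combination hz + p * hz1 + η * hz2 + p ^ k * z2 * hy
end PAC
end

-- part L2
section
open MvPolynomial
namespace PAC

section
variable {R : Type*} [CommRing R]

lemma tau_eval_zero (j : Fin 2) (c : Fin 2 → R) (g : MvPolynomial (Fin 2) R) :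
    (tau j c g).eval 0 = eval c g := by
  induction g using MvPolynomial.induction_on with
  | C a => simp [tau, Polynomial.algebraMap_eq]
  | add p q hp hq => simp [hp, hq]
  | mul_X p i hp =>
    simp only [map_mul, Polynomial.eval_mul, hp, eval_X]
    congr 1
    simp only [tau, aeval_X]
    split_ifs <;> simp

lemma tau_derivative (j : Fin 2) (c : Fin 2 → R) (g : MvPolynomial (Fin 2) R) :
    Polynomial.derivative (tau j c g) = tau j c (pderiv j g) := by
  induction g using MvPolynomial.induction_on with
  | C a => simp [tau, Polynomial.algebraMap_eq]
  | add p q hp hq => simp [hp, hq]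
  | mul_X p i hp =>
    have h1 : Polynomial.derivative (tau j c (X i)) = tau j c (pderiv j (X i)) := by
      simp only [tau, aeval_X, pderiv_X]
      by_cases h : i = j
      · simp [h]
      · rw [if_neg h]; simp [Pi.single_apply, h]
    rw [map_mul, Polynomial.derivative_mul, hp, h1, pderiv_mul, map_add, map_mul, map_mul]

lemma tau_natDegree (j : Fin 2) (c : Fin 2 → R) (g : MvPolynomial (Fin 2) R) :
    (tau j c g).natDegree ≤ g.totalDegree := by
  have := MvPolynomial.aeval_natDegree_le (F := g) (m := g.totalDegree) le_rfl
    (f := fun i => if i = j then Polynomial.X + Polynomial.C (c i) else Polynomial.C (c i)) (n := 1) (by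
      intro i
      split_ifs
      · compute_degree
      · simp)
  simpa [tau] using this
end

lemma m_exists {F L : Type*} [Field F] [Field L] (φ : F →+* L) {f : MvPolynomial (Fin 2) F}
    (hirr : Irreducible (map φ f)) (c : Fin 2 → F) (hc : eval c f = 0) :
    ∃ (j : Fin 2) (m : ℕ) (u : Polynomial F), u.eval 0 ≠ 0 ∧ tau j c f = Polynomial.X ^ m * u ∧
      1 ≤ m ∧ m ≤ f.totalDegree ∧ ((∃ i, eval c (pderiv i f) ≠ 0) → m = 1) := by
  have hf0 : f ≠ 0 := by rintro rfl; simp at hirr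
  have hd1 : 1 ≤ f.totalDegree := by
    by_contra h
    have := (isUnit_of_totalDegree_zero hf0 (by omega)).map (map φ)
    exact hirr.not_isUnit this
  by_cases hs : ∃ i, eval c (pderiv i f) ≠ 0
  · obtain ⟨j, hj⟩ := hs
    have h0 : (tau j c f).eval 0 = 0 := by rw [tau_eval_zero, hc]
    rw [← Polynomial.coeff_zero_eq_eval_zero, ← Polynomial.X_dvd_iff] at h0
    obtain ⟨u, hu⟩ := h0
    refine ⟨j, 1, u, ?_, by rw [hu, pow_one], le_rfl, hd1, fun _ => rfl⟩
    have h1 := tau_derivative j c f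
    have h2 := congrArg (Polynomial.eval 0) h1
    rw [tau_eval_zero, hu, Polynomial.derivative_mul] at h2
    simp at h2
    rw [h2]; exact hj
  · push Not at hs
    have hne : tau 0 c f ≠ 0 := by
      intro h0
      obtain ⟨g2, hg2⟩ := tau_spec (j := 0) (j' := 1) (by decide) c f
      rw [h0, map_zero, zero_add] at hg2
      rw [hg2, map_mul] at hirr
      rcases hirr.isUnit_or_isUnit rfl with h | h
      · rw [map_sub, map_X, map_C] at h
        have h3 := h.map (eval (fun _ : Fin 2 => φ (c 1)))
        simp at h3
      · have h3 := hs 1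
        rw [hg2, pderiv_mul] at h3
        simp [pderiv_X] at h3
        have h4 := h.map (eval (φ ∘ c))
        rw [← map_eval, h3, map_zero] at h4
        simp at h4
    obtain ⟨q, hq, hnd⟩ := Polynomial.exists_eq_pow_rootMultiplicity_mul_and_not_dvd _ hne 0
    rw [Polynomial.C_0, sub_zero] at hq hnd
    set m := Polynomial.rootMultiplicity 0 (tau 0 c f) with hm
    rw [Polynomial.X_dvd_iff, Polynomial.coeff_zero_eq_eval_zero] at hnd
    have hq0 : q ≠ 0 := by rintro rfl; simp at hnd
    refine ⟨0, m, q, hnd, hq, ?_, ?_, ?_⟩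
    · rw [hm, Nat.one_le_iff_ne_zero, ← Nat.pos_iff_ne_zero, Polynomial.rootMultiplicity_pos hne]
      exact (tau_eval_zero 0 c f).trans hc
    · refine le_trans ?_ (tau_natDegree 0 c f)
      rw [hq, Polynomial.natDegree_mul (by simp) hq0, Polynomial.natDegree_X_pow]
      omega
    · rintro ⟨i, hi⟩
      exact absurd (hs i) hi

/-- counting points with multiplicity -/
lemma count_mult {p : ℕ} [Fact p.Prime] {f : MvPolynomial (Fin 2) (ZMod p)} {d : ℕ} (hd : f.totalDegree ≤ d)
    (hp : 10 ^ 6 * d ^ 4 < p)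
    (hirr : Irreducible (map (algebraMap (ZMod p) (AlgebraicClosure (ZMod p))) f))
    (Z : Finset (Fin 2 → ZMod p)) (hZ : ∀ c ∈ Z, eval c f = 0) (m : (Fin 2 → ZMod p) → ℕ)
    (hm : ∀ c ∈ Z, m c ≤ d) (hm1 : ∀ c ∈ Z, (∃ i, eval c (pderiv i f) ≠ 0) → m c = 1) :
    ((∑ c ∈ Z, m c : ℕ) : ℝ) ≤ p + 65 * d ^ 2 * Real.sqrt p := by
  classical
  set L := AlgebraicClosure (ZMod p)
  set φ := algebraMap (ZMod p) L with hφ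
  have hφi : Function.Injective φ := φ.injective
  have : CharP L p := charP_of_injective_algebraMap hφi p
  set e := (map φ f).totalDegree with he
  have hed : e ≤ d := (totalDegree_map_le' _ _).trans hd
  have he0 : e ≠ 0 := fun h => hirr.not_isUnit (isUnit_of_totalDegree_zero hirr.ne_zero h)
  have hd1 : 1 ≤ d := by omega
  have hinjc : Function.Injective (fun c : Fin 2 → ZMod p => φ ∘ c) := fun a b h =>
    funext fun i => hφi (congrFun h i)
  have hdp : d < p := by
    have : d ≤ d ^ 4 := Nat.le_self_pow (by norm_num) d
    omega
  set Zs := Z.filter (fun c => ∃ i, eval c (pderiv i f) ≠ 0) with hZs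
  set Zn := Z.filter (fun c => ¬ ∃ i, eval c (pderiv i f) ≠ 0) with hZn
  have h1 : Zs.card ≤ p + 64 * d ^ 2 * Nat.sqrt p := by
    rw [← Finset.card_image_of_injective Zs hinjc]
    have h4 : e ^ 4 ≤ d ^ 4 := Nat.pow_le_pow_left hed 4
    refine le_trans (weil (p := p) hirr he0 (by rw [← he]; omega) _ ?_) ?_
    · intro P hP
      rw [Finset.mem_image] at hP
      obtain ⟨c, hc, rfl⟩ := hP
      rw [hZs, Finset.mem_filter] at hc
      obtain ⟨hc1, i, hi⟩ := hc
      refine ⟨by rw [← map_eval, hZ c hc1, map_zero], ⟨i, ?_⟩, fun i => ?_⟩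
      · rw [pderiv_map, ← map_eval]
        exact fun h => hi (hφi (by rw [h, map_zero]))
      · change φ (c i) ^ p = φ (c i)
        rw [← map_pow, ZMod.pow_card]
    · rw [← he]
      have : e ^ 2 ≤ d ^ 2 := Nat.pow_le_pow_left hed 2
      gcongr
  have h2 : Zn.card ≤ d ^ 2 := by
    rw [← Finset.card_image_of_injective Zn hinjc]
    obtain ⟨i, hi⟩ := exists_pderiv_ne_zero (f := map φ f) he0 (fun n hn hne h => by
      rw [CharP.cast_eq_zero_iff L p] at h
      have := Nat.le_of_dvd hn h
      omega)
    refine le_trans (bezout_points hirr (not_dvd_pderiv he0 hi) _ ?_) ?_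
    · intro P hP
      rw [Finset.mem_image] at hP
      obtain ⟨c, hc, rfl⟩ := hP
      rw [hZn, Finset.mem_filter] at hc
      obtain ⟨hc1, hc2⟩ := hc
      push Not at hc2
      exact ⟨by rw [← map_eval, hZ c hc1, map_zero], by rw [pderiv_map, ← map_eval, hc2 i, map_zero]⟩
    · have := totalDegree_pderiv_le i (map φ f)
      rw [sq]
      exact Nat.mul_le_mul hed (by omega)
  have h3 : ∑ c ∈ Z, m c ≤ Zs.card + d * Zn.card := by
    rw [← Finset.sum_filter_add_sum_filter_not Z (fun c => ∃ i, eval c (pderiv i f) ≠ 0)]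
    refine add_le_add ?_ ?_
    · rw [Finset.card_eq_sum_ones]
      refine Finset.sum_le_sum (fun c hc => ?_)
      rw [Finset.mem_filter] at hc
      exact (hm1 c hc.1 hc.2).le
    · rw [mul_comm, ← smul_eq_mul, ← Finset.sum_const]
      refine Finset.sum_le_sum (fun c hc => ?_)
      exact hm c (Finset.mem_filter.1 hc).1
  have h4 : (Nat.sqrt p : ℝ) ≤ Real.sqrt p := Real.nat_sqrt_le_real_sqrt
  have h5 : (d : ℝ) ≤ Real.sqrt p := by
    apply Real.le_sqrt_of_sq_le
    have : d ^ 2 ≤ d ^ 4 := Nat.pow_le_pow_right hd1 (by norm_num)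
    exact_mod_cast (by omega : d ^ 2 ≤ p)
  have h6 : ∑ c ∈ Z, m c ≤ (p + 64 * d ^ 2 * Nat.sqrt p) + d * d ^ 2 :=
    h3.trans (add_le_add h1 (Nat.mul_le_mul_left d h2))
  have h7 : ((∑ c ∈ Z, m c : ℕ) : ℝ) ≤ (p + 64 * d ^ 2 * Nat.sqrt p) + d * d ^ 2 := by exact_mod_cast h6
  have h8 : (64 : ℝ) * d ^ 2 * Nat.sqrt p ≤ 64 * d ^ 2 * Real.sqrt p := by gcongr
  have h9 : (d : ℝ) * d ^ 2 ≤ Real.sqrt p * d ^ 2 := by gcongr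
  linarith
end PAC
end

-- part L3
section
open MvPolynomial
namespace PAC

lemma sum_tri (K : ℕ) : 2 * ∑ l : Fin K, (K - (l : ℕ)) = K * (K + 1) := by
  induction K with
  | zero => simp
  | succ K ih =>
    rw [Fin.sum_univ_succ, mul_add]
    simp only [Fin.val_zero, Fin.val_succ, Nat.add_sub_add_right]
    rw [ih]; simp; ring

lemma class_ineq (s m : ℕ) (hm : 1 ≤ m) :
    (s : ℝ) ^ 2 / (2 * m) - s / 2 ≤ s * (s / m : ℕ) - m * ((s / m : ℕ) * ((s / m : ℕ) + 1)) / 2 := by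
  have h1 := Nat.div_add_mod s m
  have h2 := Nat.mod_lt s hm
  set K := s / m
  set r := s % m
  have h1' : (m : ℝ) * K + r = s := by exact_mod_cast h1
  have h2' : (r : ℝ) ≤ m := by exact_mod_cast h2.le
  have hm0 : (0 : ℝ) < m := by exact_mod_cast hm
  have hr0 : (0 : ℝ) ≤ r := by positivity
  rw [← h1', sub_le_iff_le_add, div_le_iff₀ (by positivity)]
  nlinarith

theorem local_div {p : ℕ} [Fact p.Prime] {f : MvPolynomial (Fin 2) ℤ} {d : ℕ} (hd : f.totalDegree = d)
    (hp : 10 ^ 6 * d ^ 4 < p) (hirr : Irreducible (map (Int.castRingHom (AlgebraicClosure (ZMod p))) f))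
    {ι : Type*} [Fintype ι] [DecidableEq ι] (P : ι → Fin 2 → ℤ) (hP : ∀ i, eval (P i) f = 0)
    (g : ι → MvPolynomial (Fin 2) ℤ) :
    ∃ e : ℕ, (p : ℤ) ^ e ∣ (Matrix.of fun r i => eval (P i) (g r)).det ∧
      (Fintype.card ι : ℝ) ^ 2 / (2 * (p + 65 * d ^ 2 * Real.sqrt p)) - Fintype.card ι / 2 ≤ e := by
  classical
  set fp := map (Int.castRingHom (ZMod p)) f with hfp
  have hfdeg : fp.totalDegree ≤ d := hd ▸ totalDegree_map_le' _ _
  have hirr' : Irreducible (map (algebraMap (ZMod p) (AlgebraicClosure (ZMod p))) fp) := by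
    rw [hfp, map_map]
    convert hirr
    exact RingHom.ext_int _ _
  have hpp : p.Prime := Fact.out
  -- data
  have hdata : ∀ c : Fin 2 → ZMod p, ∃ (j : Fin 2) (m : ℕ) (u : Polynomial (ZMod p)), 1 ≤ m ∧
      (eval c fp = 0 → u.eval 0 ≠ 0 ∧ tau j c fp = Polynomial.X ^ m * u ∧ m ≤ d ∧
        ((∃ i, eval c (pderiv i fp) ≠ 0) → m = 1)) := by
    intro c
    by_cases hc : eval c fp = 0
    · obtain ⟨j, m, u, h1, h2, h3, h4, h5⟩ := m_exists _ hirr' c hc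
      exact ⟨j, m, u, h3, fun _ => ⟨h1, h2, h4.trans hfdeg, h5⟩⟩
    · exact ⟨0, 1, 0, le_rfl, fun h => absurd h hc⟩
  choose jj m u hm1 hdat using hdata
  let cls : ι → Fin 2 → ZMod p := fun i l => (P i l : ZMod p)
  have hcls : ∀ i, eval (cls i) fp = 0 := by
    intro i
    have := map_eval (Int.castRingHom (ZMod p)) (P i) f
    rw [hP i, map_zero] at this
    exact this.symm
  let lft : (Fin 2 → ZMod p) → Fin 2 → ℤ := fun c l => ((c l).val : ℤ)
  have hlft : ∀ c l, ((lft c l : ℤ) : ZMod p) = c l := by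
    intro c l; simp [lft]
  have hdvd : ∀ i l, (p : ℤ) ∣ P i l - lft (cls i) l := by
    intro i l
    rw [← ZMod.intCast_zmod_eq_zero_iff_dvd, Int.cast_sub, hlft, sub_self]
  let s : (Fin 2 → ZMod p) → ℕ := fun c => (Finset.univ.filter (fun i => cls i = c)).card
  let K : (Fin 2 → ZMod p) → ℕ := fun c => s c / m c
  have hoth : ∀ j : Fin 2, j ≠ j + 1 := by decide
  let T := Σ c : Fin 2 → ZMod p, Fin (m c) × Fin (K c)
  let U : Matrix T ι ℤ := fun t i => if cls i = t.1 then
    (P i (jj t.1) - lft t.1 (jj t.1)) ^ (t.2.1 : ℕ) * (P i (jj t.1 + 1) - lft t.1 (jj t.1 + 1)) ^ (t.2.2 : ℕ) else 0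
  have key := det_dvd (Matrix.of fun r i => eval (P i) (g r)) (fun i => (p : ℤ) ^ K (cls i))
    (fun t : T => (p : ℤ) ^ (K t.1 - (t.2.2 : ℕ))) U (by
      rintro ⟨c, a, l⟩ i
      simp only [U]
      split_ifs with h
      · subst h
        have h1 : (p : ℤ) ^ (l : ℕ) ∣ (P i (jj (cls i) + 1) - lft (cls i) (jj (cls i) + 1)) ^ (l : ℕ) :=
          pow_dvd_pow_of_dvd (hdvd i _) _
        have h2 : (p : ℤ) ^ K (cls i) = (p : ℤ) ^ (K (cls i) - (l : ℕ)) * (p : ℤ) ^ (l : ℕ) := by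
          rw [← pow_add, Nat.sub_add_cancel l.2.le]
        rw [h2]
        exact mul_dvd_mul_left _ (h1.mul_left _)
      · simp) (by
      intro r
      have hnf : ∀ c : Fin 2 → ZMod p, ∃ a : ℕ → ℕ → ℤ, eval c fp = 0 → ∀ i, cls i = c →
          (p : ℤ) ^ K c ∣ eval (P i) (g r) - ∑ x ∈ Finset.range (m c), ∑ l ∈ Finset.range (K c),
            a x l * ((P i (jj c) - lft c (jj c)) ^ x * (P i (jj c + 1) - lft c (jj c + 1)) ^ l) := by
        intro c
        by_cases hc : eval c fp = 0
        · obtain ⟨h1, h2, _⟩ := hdat c hc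
          have h3 : (tau (jj c) (lft c) f).map (Int.castRingHom (ZMod p)) = Polynomial.X ^ m c * u c := by
            rw [tau_map, ← h2]
            congr 2
            funext l
            exact hlft c l
          obtain ⟨a, ha⟩ := local_nf (hoth (jj c)) (lft c) h1 h3 (K c) (g r)
          refine ⟨a, fun _ i hi => ha (P i) (hP i) ?_ ?_⟩
          · rw [← hi]; exact hdvd i _
          · rw [← hi]; exact hdvd i _
        · exact ⟨0, fun h => absurd h hc⟩
      choose a ha using hnf
      refine ⟨fun t => a t.1 t.2.1 t.2.2, fun i => ?_⟩
      have h1 := ha (cls i) (hcls i) i rfl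
      change _ ∣ eval (P i) (g r) - _
      convert h1 using 2
      rw [Fintype.sum_sigma, Finset.sum_eq_single (cls i)]
      · rw [Fintype.sum_prod_type, Finset.sum_range]
        refine Finset.sum_congr rfl (fun x _ => ?_)
        rw [Finset.sum_range]
        refine Finset.sum_congr rfl (fun l _ => ?_)
        simp [U]
      · intro c _ hc
        refine Finset.sum_eq_zero (fun x _ => ?_)
        simp only [U]
        rw [if_neg hc.symm, mul_zero]
      · simp)
  -- exponents
  have hD : ∏ i, (p : ℤ) ^ K (cls i) = (p : ℤ) ^ (∑ c, s c * K c) := by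
    rw [Finset.prod_pow_eq_pow_sum]
    congr 1
    rw [← Finset.sum_fiberwise (s := Finset.univ) (g := cls) (f := fun i => K (cls i))]
    refine Finset.sum_congr rfl (fun c _ => ?_)
    rw [← smul_eq_mul, ← Finset.sum_const]
    refine Finset.sum_congr rfl (fun i hi => ?_)
    rw [(Finset.mem_filter.1 hi).2]
  have hW : ∏ t : T, (p : ℤ) ^ (K t.1 - (t.2.2 : ℕ)) = (p : ℤ) ^ (∑ c, m c * ∑ l : Fin (K c), (K c - (l : ℕ))) := by
    rw [Finset.prod_pow_eq_pow_sum]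
    congr 1
    rw [Fintype.sum_sigma]
    refine Finset.sum_congr rfl (fun c _ => ?_)
    rw [Fintype.sum_prod_type]
    simp
  rw [hD, hW] at key
  set b := ∑ c, s c * K c with hb
  set a := ∑ c, m c * ∑ l : Fin (K c), (K c - (l : ℕ)) with ha
  refine ⟨b - a, ?_, ?_⟩
  · rcases le_total b a with h | h
    · rw [Nat.sub_eq_zero_of_le h, pow_zero]; exact one_dvd _
    · have h1 : (p : ℤ) ^ b = (p : ℤ) ^ a * (p : ℤ) ^ (b - a) := by rw [← pow_add, Nat.add_sub_cancel' h]
      rw [h1] at key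
      exact Int.dvd_of_mul_dvd_mul_left (pow_ne_zero _ (by exact_mod_cast hpp.ne_zero)) key
  · have h1 : (b : ℝ) - a ≤ ((b - a : ℕ) : ℝ) := by
      rw [sub_le_iff_le_add]; exact_mod_cast (by omega : b ≤ b - a + a)
    refine le_trans ?_ h1
    have hs : (Fintype.card ι : ℝ) = ∑ c, (s c : ℝ) := by
      have : Fintype.card ι = ∑ c, s c := by
        rw [← Finset.card_univ]
        exact Finset.card_eq_sum_card_fiberwise (fun i _ => Finset.mem_coe.2 (Finset.mem_univ (cls i)))
      exact_mod_cast this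
    have hba : (b : ℝ) - a = ∑ c, ((s c : ℝ) * K c - m c * (K c * (K c + 1)) / 2) := by
      rw [hb, ha]; push_cast
      rw [← Finset.sum_sub_distrib]
      refine Finset.sum_congr rfl (fun c _ => ?_)
      have h2 : ((2 * ∑ l : Fin (K c), (K c - (l : ℕ)) : ℕ) : ℝ) = ((K c * (K c + 1) : ℕ) : ℝ) := by
        rw [sum_tri]
      push_cast at h2
      linear_combination (-(m c : ℝ) / 2) * h2
    set Z := Finset.univ.filter (fun c => s c ≠ 0) with hZ
    have hZc : ∀ c ∈ Z, eval c fp = 0 := by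
      intro c hc
      rw [hZ, Finset.mem_filter] at hc
      obtain ⟨i, hi⟩ := Finset.card_ne_zero.1 hc.2
      rw [← (Finset.mem_filter.1 hi).2]
      exact hcls i
    have hcount := count_mult hfdeg hp hirr' Z hZc m (fun c hc => (hdat c (hZc c hc)).2.2.1)
      (fun c hc => (hdat c (hZc c hc)).2.2.2)
    rw [hba]
    have h3 : ∑ c, ((s c : ℝ) ^ 2 / (2 * m c) - s c / 2) ≤
        ∑ c, ((s c : ℝ) * K c - m c * (K c * (K c + 1)) / 2) :=
      Finset.sum_le_sum (fun c _ => class_ineq (s c) (m c) (hm1 c))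
    refine le_trans ?_ h3
    rw [Finset.sum_sub_distrib, ← Finset.sum_div, ← hs]
    refine sub_le_sub_right ?_ _
    have h4 : ∑ c, (s c : ℝ) ^ 2 / (2 * m c) = (∑ c ∈ Z, (s c : ℝ) ^ 2 / m c) / 2 := by
      rw [Finset.sum_div]
      symm
      apply Finset.sum_subset_zero_on_sdiff (Finset.subset_univ _)
      · intro c hc
        have : s c = 0 := by simpa [hZ] using hc
        simp [this]
      · intro c _
        rw [div_div, mul_comm]
    have h5 : (Fintype.card ι : ℝ) = ∑ c ∈ Z, (s c : ℝ) := by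
      rw [hs]; symm
      apply Finset.sum_subset (Finset.subset_univ _)
      intro c _ hc
      have : s c = 0 := by simpa [hZ] using hc
      simp [this]
    have h6 := Finset.sq_sum_div_le_sum_sq_div Z (fun c => (s c : ℝ)) (g := fun c => (m c : ℝ))
      (fun c _ => by exact_mod_cast hm1 c)
    rw [h4, h5]
    push_cast at hcount
    rw [mul_comm 2, ← div_div]
    refine div_le_div_of_nonneg_right (le_trans ?_ h6) (by norm_num)
    by_cases hZe : Z = ∅
    · rw [hZe]; simp
    · apply div_le_div_of_nonneg_left (sq_nonneg _) _ hcount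
      apply Finset.sum_pos (fun c _ => by exact_mod_cast hm1 c)
      exact Finset.nonempty_iff_ne_empty.2 hZe
end PAC
end

-- part G1
section
open MvPolynomial
namespace PAC

lemma tri_det {ι R : Type*} [Fintype ι] [DecidableEq ι] [CommRing R] (M : Matrix ι ι R) (y : ι → ℕ)
    (h : ∀ i j, M i j ≠ 0 → i = j ∨ y j < y i) : M.det = ∏ i, M i i := by
  rw [Matrix.det_apply, Finset.sum_eq_single 1]
  · simp
  · intro σ _ hσ
    by_contra hne
    have hall : ∀ i, M (σ i) i ≠ 0 := by
      intro i hi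
      apply hne
      have : ∏ i, M (σ i) i = 0 := Finset.prod_eq_zero (i := i) (Finset.mem_univ i) hi
      rw [this, smul_zero]
    have hle : ∀ i ∈ Finset.univ, y i ≤ y (σ i) := by
      intro i _
      rcases h _ _ (hall i) with h1 | h1
      · rw [h1]
      · exact h1.le
    have hsum : ∑ i, y i = ∑ i, y (σ i) := (Equiv.sum_comp σ y).symm
    have heq := (Finset.sum_eq_sum_iff_of_le hle).1 hsum
    apply hσ
    ext i
    rcases h _ _ (hall i) with h1 | h1
    · simpa using h1
    · exact absurd (heq i (Finset.mem_univ i)) h1.ne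
  · simp

/-- twisted monomials -/
noncomputable def phi {R : Type*} [CommRing R] (α β : R) (n : ℕ) (m : Fin 2 →₀ ℕ) : MvPolynomial (Fin 2) R :=
  (1 - C α * X 1) ^ (n - m 0 - m 1) * (X 0 - C β * X 1) ^ (m 0) * X 1 ^ (m 1)

section
variable {R : Type*} [CommRing R] (α β : R)

lemma phi_mul {a b : ℕ} {m m' : Fin 2 →₀ ℕ} (h : m ∈ TT a) (h' : m' ∈ TT b) :
    phi α β a m * phi α β b m' = phi α β (a + b) (m + m') := by
  rw [mem_TT] at h h'
  have e : a + b - (m + m') 0 - (m + m') 1 = (a - m 0 - m 1) + (b - m' 0 - m' 1) := by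
    simp; omega
  simp only [phi, e]
  simp only [Finsupp.add_apply, pow_add]
  ring

lemma phi_totalDegree [Nontrivial R] {n : ℕ} {m : Fin 2 →₀ ℕ} (h : m ∈ TT n) : (phi α β n m).totalDegree ≤ n := by
  rw [mem_TT] at h
  have hX : ∀ i : Fin 2, (X i : MvPolynomial (Fin 2) R).totalDegree = 1 := fun i => totalDegree_X i
  have h1 : (1 - C α * X 1 : MvPolynomial (Fin 2) R).totalDegree ≤ 1 := by
    refine (totalDegree_sub _ _).trans (max_le (by simp) ?_)
    refine (totalDegree_mul _ _).trans (by simp)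
  have h2 : (X 0 - C β * X 1 : MvPolynomial (Fin 2) R).totalDegree ≤ 1 := by
    refine (totalDegree_sub _ _).trans (max_le (by simp) ?_)
    refine (totalDegree_mul _ _).trans (by simp)
  have h3 := (totalDegree_pow (1 - C α * X 1 : MvPolynomial (Fin 2) R) (n - m 0 - m 1)).trans (Nat.mul_le_mul_left _ h1)
  have h4 := (totalDegree_pow (X 0 - C β * X 1 : MvPolynomial (Fin 2) R) (m 0)).trans (Nat.mul_le_mul_left _ h2)
  have h5 := (totalDegree_pow (X 1 : MvPolynomial (Fin 2) R) (m 1)).trans (Nat.mul_le_mul_left _ (hX 1).le)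
  have h6 := totalDegree_mul ((1 - C α * X 1 : MvPolynomial (Fin 2) R) ^ (n - m 0 - m 1)) ((X 0 - C β * X 1) ^ (m 0))
  have h7 := totalDegree_mul ((1 - C α * X 1 : MvPolynomial (Fin 2) R) ^ (n - m 0 - m 1) * (X 0 - C β * X 1) ^ (m 0)) (X 1 ^ (m 1))
  unfold phi
  omega

lemma phi_coeff (n : ℕ) (m m' : Fin 2 →₀ ℕ) (h : m' 1 ≤ m 1) :
    coeff m' (phi α β n m) = if m = m' then 1 else 0 := by
  obtain ⟨u, hu⟩ : (X 1 : MvPolynomial (Fin 2) R) ∣ (1 - C α * X 1) ^ (n - m 0 - m 1) - 1 := by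
    refine Dvd.dvd.trans ?_ (sub_one_dvd_pow_sub_one _ _) 
    exact ⟨- C α, by ring⟩
  obtain ⟨v, hv⟩ : (X 1 : MvPolynomial (Fin 2) R) ∣ (X 0 - C β * X 1) ^ (m 0) - X 0 ^ (m 0) := by
    refine Dvd.dvd.trans ?_ (sub_dvd_pow_sub_pow _ _ _)
    exact ⟨- C β, by ring⟩
  have e : phi α β n m = monomial m 1 + ((X 0 - C β * X 1) ^ (m 0) * u + v) * monomial (ex 0 (m 1 + 1)) 1 := by
    have e1 : (monomial m 1 : MvPolynomial (Fin 2) R) = X 0 ^ (m 0) * X 1 ^ (m 1) := by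
      rw [monomial_eq, Finsupp.prod_fintype _ _ (by simp)]
      simp
    have e2 : (monomial (ex 0 (m 1 + 1)) 1 : MvPolynomial (Fin 2) R) = X 1 ^ (m 1) * X 1 := by
      rw [monomial_eq, Finsupp.prod_fintype _ _ (by simp)]
      simp [pow_succ]
    rw [e1, e2, phi]
    linear_combination (X 0 - C β * X 1) ^ (m 0) * X 1 ^ (m 1) * hu + X 1 ^ (m 1) * hv
  rw [e, coeff_add, coeff_mul_monomial', if_neg, coeff_monomial, add_zero]
  intro hle
  have := hle 1
  simp at this
  omega

/-- span of twisted monomials with bounded `y` exponent -/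
noncomputable def WW (n k : ℕ) : Submodule R (MvPolynomial (Fin 2) R) :=
  Submodule.span R {p | ∃ m ∈ TT n, m 1 < k ∧ p = phi α β n m}

variable {α β}
lemma WW_mul_phi {n k a : ℕ} {m : Fin 2 →₀ ℕ} (hm : m ∈ TT a) {p : MvPolynomial (Fin 2) R}
    (hp : p ∈ WW α β n k) : p * phi α β a m ∈ WW α β (n + a) (k + m 1) := by
  induction hp using Submodule.span_induction with
  | mem x h =>
    obtain ⟨m', h1, h2, rfl⟩ := h
    rw [phi_mul α β h1 hm]
    refine Submodule.subset_span ⟨m' + m, ?_, by simpa using h2, rfl⟩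
    rw [mem_TT] at *
    simp; omega
  | zero => rw [zero_mul]; exact zero_mem _
  | add x y _ _ hx hy => rw [add_mul]; exact add_mem hx hy
  | smul c x _ hx => rw [smul_mul_assoc]; exact Submodule.smul_mem _ _ hx

lemma WW_mono {n k k' : ℕ} (h : k ≤ k') : WW α β n k ≤ WW α β n k' := by
  apply Submodule.span_mono
  rintro _ ⟨m, h1, h2, rfl⟩
  exact ⟨m, h1, h2.trans_le h, rfl⟩

lemma phi_y (n : ℕ) : phi α β n (ex 0 n) = X 1 ^ n := by simp [phi]

lemma ex_mem (n : ℕ) : ex 0 n ∈ TT n := by simp [mem_TT]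

lemma WW_mul {n k a k' : ℕ} {p q : MvPolynomial (Fin 2) R}
    (hp : p ∈ WW α β n k) (hq : q ∈ WW α β a k') : p * q ∈ WW α β (n + a) (k + k') := by
  induction hq using Submodule.span_induction with
  | mem x h =>
    obtain ⟨m', h1, h2, rfl⟩ := h
    exact WW_mono (by omega) (WW_mul_phi h1 hp)
  | zero => rw [mul_zero]; exact zero_mem _
  | add x y _ _ hx hy => rw [mul_add]; exact add_mem hx hy
  | smul c x _ hx => rw [mul_smul_comm]; exact Submodule.smul_mem _ _ hx

variable (α β) in
/-- `p` has top coefficient `a` in twisted basis -/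
def TopC (n : ℕ) (a : R) (p : MvPolynomial (Fin 2) R) : Prop := p - C a * X 1 ^ n ∈ WW α β n n

lemma TopC.mul {n n' : ℕ} {a a' : R} {p p' : MvPolynomial (Fin 2) R} (h : TopC α β n a p) (h' : TopC α β n' a' p') :
    TopC α β (n + n') (a * a') (p * p') := by
  unfold TopC at *
  have e : p * p' - C (a * a') * X 1 ^ (n + n') = (p - C a * X 1 ^ n) * (p' - C a' * X 1 ^ n')
     + (a' • ((p - C a * X 1 ^ n) * X 1 ^ n') + a • ((p' - C a' * X 1 ^ n') * X 1 ^ n)) := by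
    simp only [smul_eq_C_mul, C_mul]
    ring
  rw [e]
  refine add_mem (WW_mul h h') (add_mem (Submodule.smul_mem _ _ ?_) (Submodule.smul_mem _ _ ?_))
  · have := WW_mul_phi (ex_mem n') h
    rw [phi_y] at this
    simpa using this
  · have := WW_mul_phi (ex_mem n) h'
    rw [phi_y, add_comm n' n] at this
    simpa [add_comm n' n] using this

lemma TopC.one0 : TopC α β 0 1 1 := by simp [TopC]

lemma TopC.pow {a : R} {p : MvPolynomial (Fin 2) R} (h : TopC α β 1 a p) (n : ℕ) : TopC α β n (a ^ n) (p ^ n) := by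
  induction n with
  | zero => simpa using TopC.one0
  | succ n ih => rw [pow_succ, pow_succ]; exact ih.mul h

lemma TopC.one1 : TopC α β 1 α 1 := by
  apply Submodule.subset_span
  refine ⟨ex 0 0, by simp [mem_TT], by simp, by simp [phi]⟩

lemma TopC.x : TopC α β 1 β (X 0) := by
  apply Submodule.subset_span
  refine ⟨ex 1 0, by simp [mem_TT], by simp, by simp [phi]⟩

lemma TopC.y : TopC α β 1 1 (X 1) := by simp [TopC]

lemma TopC.monomial {n : ℕ} {m : Fin 2 →₀ ℕ} (hm : m ∈ TT n) (c : R) :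
    TopC α β n (c * (α ^ (n - m 0 - m 1) * β ^ (m 0))) (monomial m c) := by
  rw [mem_TT] at hm
  have h := ((TopC.one1 (α := α) (β := β)).pow (n - m 0 - m 1)).mul (((TopC.x (α := α) (β := β)).pow (m 0)).mul
    ((TopC.y (α := α) (β := β)).pow (m 1)))
  have e : n - m 0 - m 1 + (m 0 + m 1) = n := by omega
  rw [e, one_pow, one_pow, one_mul, mul_one] at h
  have e1 : (MvPolynomial.monomial m c : MvPolynomial (Fin 2) R) = C c * (X 0 ^ (m 0) * X 1 ^ (m 1)) := by
    rw [monomial_eq, Finsupp.prod_fintype _ _ (by simp)]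
    simp
  rw [e1]
  unfold TopC at *
  rw [C_mul, mul_assoc, ← mul_sub, ← smul_eq_C_mul]
  exact Submodule.smul_mem _ _ h

lemma TopC.poly {n : ℕ} {f : MvPolynomial (Fin 2) R} (hf : f.totalDegree ≤ n) :
    TopC α β n (∑ m ∈ TT n, f.coeff m * (α ^ (n - m 0 - m 1) * β ^ (m 0))) f := by
  have e : f = ∑ m ∈ TT n, MvPolynomial.monomial m (f.coeff m) := by
    conv_lhs => rw [f.as_sum]
    refine Finset.sum_subset ?_ ?_
    · intro m hm
      rw [mem_TT', Finsupp.degree_eq_sum]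
      refine le_trans ?_ hf
      have := le_totalDegree hm
      rwa [Finsupp.sum_fintype _ _ (by simp)] at this
    · intro m _ hm
      rw [notMem_support_iff.1 hm, monomial_zero]
  unfold TopC
  nth_rewrite 1 [e]
  rw [map_sum, Finset.sum_mul, ← Finset.sum_sub_distrib]
  exact sum_mem (fun m hm => TopC.monomial hm _)

lemma WW_repr {n k : ℕ} {p : MvPolynomial (Fin 2) R} (hp : p ∈ WW α β n k) :
    ∃ c : (Fin 2 →₀ ℕ) → R, (∀ m, c m ≠ 0 → m 1 < k) ∧ p = ∑ m ∈ TT n, c m • phi α β n m := by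
  classical
  induction hp using Submodule.span_induction with
  | mem x h =>
    obtain ⟨m', h1, h2, rfl⟩ := h
    refine ⟨fun m => if m = m' then 1 else 0, ?_, ?_⟩
    · intro m hm
      simp only [ne_eq, ite_eq_right_iff, Classical.not_imp] at hm
      rwa [hm.1]
    · simp [ite_smul, h1]
  | zero => exact ⟨0, by simp, by simp⟩
  | add x y _ _ hx hy =>
    obtain ⟨c, h1, h2⟩ := hx
    obtain ⟨c', h1', h2'⟩ := hy
    refine ⟨c + c', ?_, ?_⟩
    · intro m hm
      by_cases h : c m = 0
      · exact h1' m (by intro h'; apply hm; simp [h, h'])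
      · exact h1 m h
    · rw [h2, h2', ← Finset.sum_add_distrib]; simp [add_smul]
  | smul a x _ hx =>
    obtain ⟨c, h1, h2⟩ := hx
    refine ⟨a • c, ?_, ?_⟩
    · intro m hm
      exact h1 m (by intro h'; apply hm; simp [h'])
    · rw [h2, Finset.smul_sum]; simp [mul_smul]

lemma f_mul_phi {f : MvPolynomial (Fin 2) R} {d a : ℕ} (hf : f.totalDegree ≤ d) {m : Fin 2 →₀ ℕ} (hm : m ∈ TT a) :
    ∃ c : (Fin 2 →₀ ℕ) → R, (∀ m', c m' ≠ 0 → m' = m + ex 0 d ∨ m' 1 < m 1 + d) ∧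
      c (m + ex 0 d) = ∑ m ∈ TT d, f.coeff m * (α ^ (d - m 0 - m 1) * β ^ (m 0)) ∧
      f * phi α β a m = ∑ m' ∈ TT (d + a), c m' • phi α β (d + a) m' := by
  classical
  set A := ∑ m ∈ TT d, f.coeff m * (α ^ (d - m 0 - m 1) * β ^ (m 0)) with hA
  have h1 : f - C A * X 1 ^ d ∈ WW α β d d := TopC.poly hf
  obtain ⟨c, hc, he⟩ := WW_repr (WW_mul_phi hm h1)
  refine ⟨fun m' => c m' + if m' = m + ex 0 d then A else 0, ?_, ?_, ?_⟩
  · intro m' h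
    by_cases h2 : m' = m + ex 0 d
    · exact Or.inl h2
    · right
      have := hc m' (by simpa [h2] using h)
      omega
  · have : c (m + ex 0 d) = 0 := by
      by_contra h
      have := hc _ h
      simp at this
      omega
    simp [this]
  · simp only [add_smul, Finset.sum_add_distrib]
    rw [← he]
    have hmem : m + ex 0 d ∈ TT (d + a) := by
      rw [mem_TT] at *; simp; omega
    simp only [ite_smul, zero_smul]
    rw [Finset.sum_ite_eq' (TT (d + a)), if_pos hmem, add_comm m, ← phi_mul α β (ex_mem d) hm, phi_y, smul_eq_C_mul]
    ring
end
end PAC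
end

-- part G2
section
open MvPolynomial
namespace PAC

lemma exists_unit_ge (p : Polynomial ℂ) (k : ℕ) : ∃ w : ℂ, ‖w‖ = 1 ∧ ‖p.coeff k‖ ≤ ‖p.eval w‖ := by
  obtain ⟨w, hw, hmax⟩ := (isCompact_sphere (0 : ℂ) 1).exists_isMaxOn ⟨1, by simp⟩
    (f := fun z => ‖p.eval z‖) (by fun_prop)
  refine ⟨w, by simpa using hw, ?_⟩
  have h := Complex.norm_iteratedDeriv_le_of_forall_mem_sphere_norm_le (c := 0) (R := 1) (C := ‖p.eval w‖)
    (f := fun z => p.eval z) k one_pos (p.differentiable.diffContOnCl) (fun z hz => hmax hz)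
  have e : iteratedDeriv k (fun z => p.eval z) 0 = k.factorial * p.coeff k := by
    have : ∀ k : ℕ, iteratedDeriv k (fun z => p.eval z) = fun z => (Polynomial.derivative^[k] p).eval z := by
      intro k
      induction k with
      | zero => simp
      | succ k ih =>
        rw [iteratedDeriv_succ, ih]
        funext z
        rw [Function.iterate_succ_apply']
        exact Polynomial.deriv _
    rw [this]
    simp only
    rw [← Polynomial.coeff_zero_eq_eval_zero, Polynomial.coeff_iterate_derivative, zero_add,
      Nat.descFactorial_self, nsmul_eq_mul]
  rw [e, norm_mul, one_pow, div_one, Complex.norm_natCast] at h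
  exact le_of_mul_le_mul_left h (by positivity)

lemma exists_units_ge (d : ℕ) (h : (Fin 2 →₀ ℕ) → ℂ) (m : Fin 2 →₀ ℕ) (hm : m ∈ TT d) :
    ∃ w0 w1 : ℂ, ‖w0‖ = 1 ∧ ‖w1‖ = 1 ∧
      ‖h m‖ ≤ ‖∑ m' ∈ TT d, h m' * (w0 ^ (d - m' 0 - m' 1) * w1 ^ (m' 0))‖ := by
  classical
  let p : Polynomial ℂ := ∑ m' ∈ (TT d).filter (fun m' => m' 0 = m 0), Polynomial.monomial (d - m' 0 - m' 1) (h m')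
  obtain ⟨w0, hw0, h0⟩ := exists_unit_ge p (d - m 0 - m 1)
  have hp : p.coeff (d - m 0 - m 1) = h m := by
    simp only [p, Polynomial.finsetSum_coeff, Polynomial.coeff_monomial]
    rw [Finset.sum_eq_single m]
    · simp
    · intro b hb hne
      rw [Finset.mem_filter, mem_TT] at hb
      rw [mem_TT] at hm
      rw [if_neg]
      intro h
      exact hne (ext2 hb.2 (by omega))
    · intro hn
      simp [hm] at hn
  let q : Polynomial ℂ := ∑ m' ∈ TT d, Polynomial.monomial (m' 0) (h m' * w0 ^ (d - m' 0 - m' 1))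
  obtain ⟨w1, hw1, h1⟩ := exists_unit_ge q (m 0)
  have hq : q.coeff (m 0) = p.eval w0 := by
    simp only [q, p, Polynomial.finsetSum_coeff, Polynomial.coeff_monomial, Polynomial.eval_finsetSum,
      Polynomial.eval_monomial]
    rw [Finset.sum_filter]
  refine ⟨w0, w1, hw0, hw1, ?_⟩
  rw [hp] at h0
  rw [hq] at h1
  refine (h0.trans h1).trans (le_of_eq ?_)
  simp only [q, Polynomial.eval_finsetSum, Polynomial.eval_monomial]
  congr 1
  exact Finset.sum_congr rfl (fun _ _ => by ring)

/-- primitive, irreducible over `ℚ` implies prime over `ℤ`. -/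
lemma prime_int {f : MvPolynomial (Fin 2) ℤ} (hprim : Finset.gcd f.support f.coeff = 1)
    (hf : Irreducible (map (Int.castRingHom ℚ) f)) : Prime f := by
  have hinj : Function.Injective (map (σ := Fin 2) (Int.castRingHom ℚ)) :=
    map_injective _ Int.cast_injective
  have key : ∀ a b : MvPolynomial (Fin 2) ℤ, f = a * b → IsUnit (map (Int.castRingHom ℚ) a) → IsUnit a := by
    intro a b hab hu
    have h0 : a.totalDegree = 0 := by
      have h1 : (map (Int.castRingHom ℚ) a).totalDegree = 0 := by
        obtain ⟨v, hv⟩ := hu.exists_right_inv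
        have hv0 : v ≠ 0 := by rintro rfl; simp at hv
        have := congrArg totalDegree hv
        rw [totalDegree_mul_of_isDomain hu.ne_zero hv0, totalDegree_one] at this
        omega
      rwa [totalDegree, support_map_of_injective _ Int.cast_injective] at h1
    rw [totalDegree_eq_zero_iff_eq_C] at h0
    have hdv : ∀ m ∈ f.support, coeff 0 a ∣ f.coeff m := by
      intro m _
      have e : f.coeff m = coeff 0 a * coeff m b := by
        conv_lhs => rw [hab, h0]
        exact coeff_C_mul _ _ _
      exact ⟨_, e⟩
    have := Finset.dvd_gcd hdv
    rw [hprim] at this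
    rw [h0]
    exact (isUnit_of_dvd_one this).map C
  rw [← irreducible_iff_prime]
  refine ⟨fun h => hf.not_isUnit (h.map _), ?_⟩
  intro a b hab
  have h2 : map (Int.castRingHom ℚ) f = map (Int.castRingHom ℚ) a * map (Int.castRingHom ℚ) b := by
    rw [hab, map_mul]
  rcases hf.isUnit_or_isUnit h2 with h | h
  · exact Or.inl (key a b hab h)
  · exact Or.inr (key b a (by rw [hab, mul_comm]) h)

lemma lattice {f : MvPolynomial (Fin 2) ℤ} {d D : ℕ} (hf : Prime f) (hd : f.totalDegree = d) (hd1 : 1 ≤ d) (hD : d ≤ D) :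
    ∃ (s : ℕ) (σ : Fin s → MvPolynomial (Fin 2) ℤ), s + (TT (D - d)).card = (TT D).card ∧
      (∀ i, (σ i).totalDegree ≤ D) ∧
      ∀ p : MvPolynomial (Fin 2) ℤ, p.totalDegree ≤ D → ∃ (c : Fin s → ℤ) (q : MvPolynomial (Fin 2) ℤ),
        q.totalDegree ≤ D - d ∧ p = (∑ i, c i • σ i) + f * q := by
  classical
  let μ : RR ℤ (D - d) →ₗ[ℤ] RR ℤ D :=
    (LinearMap.mulLeft ℤ f).restrict (fun g hg => by
      rw [mem_RR] at *
      exact (totalDegree_mul _ _).trans (by omega))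
  have hμ : ∀ q, ((μ q : RR ℤ D) : MvPolynomial (Fin 2) ℤ) = f * q := fun q => rfl
  have hμi : Function.Injective μ := by
    intro x y hxy
    have := congrArg Subtype.val hxy
    rw [hμ, hμ] at this
    exact Subtype.ext (mul_left_cancel₀ hf.ne_zero this)
  have hbas : ∀ n, ∃ b : Module.Basis (TT n) ℤ (RR ℤ n), True := by
    intro n
    refine ⟨(basisRestrictSupport ℤ {n_1 : Fin 2 →₀ ℕ | (n_1.sum fun _ e => e) ≤ n}).reindex ?_, trivial⟩
    apply Equiv.subtypeEquivRight
    intro x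
    rw [mem_TT', Finsupp.degree_eq_sum]
    simp only [Set.mem_ofPred_eq]
    rw [Finsupp.sum_fintype]
    simp
  obtain ⟨b1, -⟩ := hbas (D - d)
  obtain ⟨b2, -⟩ := hbas D
  have hfin : Module.Finite ℤ (RR ℤ D) := Module.Finite.of_basis b2
  have htf : Module.IsTorsionFree ℤ (RR ℤ D ⧸ LinearMap.range μ) := by
    rw [Module.isTorsionFree_iff_smul_eq_zero]
    intro n x hx
    induction x using Submodule.Quotient.induction_on with
    | H p =>
      rw [← Submodule.Quotient.mk_smul, Submodule.Quotient.mk_eq_zero] at hx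
      by_cases hn : n = 0
      · exact Or.inl hn
      right
      rw [Submodule.Quotient.mk_eq_zero]
      obtain ⟨q, hq⟩ := hx
      have e := congrArg Subtype.val hq
      rw [hμ] at e
      have e' : f * (q : MvPolynomial (Fin 2) ℤ) = C n * (p : MvPolynomial (Fin 2) ℤ) := by
        rw [e, ← smul_eq_C_mul]; rfl
      have hdv : f ∣ C n * (p : MvPolynomial (Fin 2) ℤ) := ⟨_, e'.symm⟩
      rcases hf.dvd_or_dvd hdv with ⟨u, hu⟩ | ⟨u, hu⟩
      · exfalso
        have hu0 : u ≠ 0 := by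
          rintro rfl
          rw [mul_zero] at hu
          exact hn (by simpa using hu)
        have := congrArg totalDegree hu
        rw [totalDegree_C, totalDegree_mul_of_isDomain hf.ne_zero hu0] at this
        omega
      · have hud : u.totalDegree ≤ D - d := by
          by_cases hu0 : u = 0
          · simp [hu0]
          have h1 := mem_RR.1 p.2
          rw [hu, totalDegree_mul_of_isDomain hf.ne_zero hu0] at h1
          omega
        exact ⟨⟨u, mem_RR.2 hud⟩, Subtype.ext (by rw [hμ, hu])⟩
  let bQ := Module.finBasis ℤ (RR ℤ D ⧸ LinearMap.range μ)
  let bW : Module.Basis (TT (D - d)) ℤ (LinearMap.range μ) := b1.map (LinearEquiv.ofInjective μ hμi)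
  let b := bW.sumQuot bQ
  refine ⟨_, fun i => (b (Sum.inr i) : MvPolynomial (Fin 2) ℤ), ?_, fun i => mem_RR.1 (b (Sum.inr i)).2, ?_⟩
  · have h1 := Module.finrank_eq_card_basis b
    have h2 := Module.finrank_eq_card_basis b2
    rw [Fintype.card_sum, Fintype.card_coe, Fintype.card_fin] at h1
    rw [Fintype.card_coe] at h2
    omega
  · intro p hp
    let p' : RR ℤ D := ⟨p, mem_RR.2 hp⟩
    have h1 := b.sum_repr p'
    rw [Fintype.sum_sum_type] at h1
    have h2 : ∑ i, b.repr p' (Sum.inl i) • b (Sum.inl i) ∈ LinearMap.range μ := by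
      refine sum_mem (fun i _ => Submodule.smul_mem _ _ ?_)
      rw [Module.Basis.sumQuot_inl]
      exact (bW i).2
    obtain ⟨q, hq⟩ := h2
    refine ⟨fun i => b.repr p' (Sum.inr i), q, mem_RR.1 q.2, ?_⟩
    rw [← hq] at h1
    have h3 := congrArg Subtype.val h1
    rw [Submodule.coe_add, hμ, Submodule.coe_sum] at h3
    change _ = p at h3
    rw [← h3, add_comm]
    rfl
end PAC
end

-- part G3
section
open MvPolynomial
namespace PAC

/-- exponents of degree at most `D` with `y`-degree less than `d` -/
noncomputable def II (D d : ℕ) : Finset (Fin 2 →₀ ℕ) := (TT D).filter (fun m => m 1 < d)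

lemma mem_II {D d : ℕ} {m : Fin 2 →₀ ℕ} : m ∈ II D d ↔ m 0 + m 1 ≤ D ∧ m 1 < d := by
  rw [II, Finset.mem_filter, mem_TT]

abbrev Idx (D d : ℕ) := (TT (D - d)) ⊕ (II D d)

noncomputable def ee {D d : ℕ} : Idx D d → (Fin 2 →₀ ℕ) :=
  Sum.elim (fun m => (m : Fin 2 →₀ ℕ) + ex 0 d) (fun m => m)

lemma ee_inj {D d : ℕ} : Function.Injective (ee (D := D) (d := d)) := by
  rintro (⟨a, ha⟩ | ⟨a, ha⟩) (⟨b, hb⟩ | ⟨b, hb⟩) h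
  · have : a = b := by simpa [ee] using h
    subst this; rfl
  · exfalso
    have h1 : a + ex 0 d = b := by simpa [ee] using h
    rw [mem_II, ← h1] at hb
    simp at hb
  · exfalso
    have h1 : a = b + ex 0 d := by simpa [ee] using h
    rw [mem_II, h1] at ha
    simp at ha
  · have : a = b := by simpa [ee] using h
    subst this; rfl

lemma ee_mem {D d : ℕ} (hD : d ≤ D) (k : Idx D d) : ee k ∈ TT D := by
  rcases k with ⟨a, ha⟩ | ⟨a, ha⟩
  · rw [mem_TT] at *
    simp [ee]; omega
  · rw [mem_II] at ha
    rw [mem_TT]; exact ha.1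

lemma ee_surj {D d : ℕ} (hD : d ≤ D) {m : Fin 2 →₀ ℕ} (hm : m ∈ TT D) : ∃ k : Idx D d, ee k = m := by
  by_cases h : m 1 < d
  · exact ⟨Sum.inr ⟨m, mem_II.2 ⟨mem_TT.1 hm, h⟩⟩, rfl⟩
  · refine ⟨Sum.inl ⟨ex (m 0) (m 1 - d), ?_⟩, ?_⟩
    · rw [mem_TT] at *; simp; omega
    · apply ext2 <;> simp [ee]; omega

lemma sum_ee {D d : ℕ} (hD : d ≤ D) {M : Type*} [AddCommMonoid M] (F : (Fin 2 →₀ ℕ) → M) :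
    ∑ m ∈ TT D, F m = ∑ k : Idx D d, F (ee k) := by
  symm
  refine Finset.sum_bij (fun k _ => ee k) (fun k _ => ee_mem hD k) (fun a _ b _ h => ee_inj h) ?_ (fun _ _ => rfl)
  intro m hm
  obtain ⟨k, hk⟩ := ee_surj hD hm
  exact ⟨k, Finset.mem_univ _, hk⟩

lemma card_II {D d : ℕ} (hD : d ≤ D) : (II D d).card + (TT (D - d)).card = (TT D).card := by
  have := sum_ee hD (fun _ => 1)
  rw [← Finset.card_eq_sum_ones] at this
  rw [this]
  simp [Fintype.card_sum]
  omega

section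
variable {R : Type*} [CommRing R] {D d : ℕ}

lemma poly_expand {n : ℕ} {f : MvPolynomial (Fin 2) R} (hf : f.totalDegree ≤ n) :
    f = ∑ m ∈ TT n, f.coeff m • monomial m (1 : R) := by
  have : ∑ m ∈ TT n, f.coeff m • monomial m (1 : R) = ∑ m ∈ TT n, monomial m (f.coeff m) :=
    Finset.sum_congr rfl (fun m _ => by rw [smul_monomial, smul_eq_mul, mul_one])
  rw [this]
  conv_lhs => rw [f.as_sum]
  refine Finset.sum_subset ?_ ?_
  · intro m hm
    rw [mem_TT', Finsupp.degree_eq_sum]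
    refine le_trans ?_ hf
    have := le_totalDegree hm
    rwa [Finsupp.sum_fintype _ _ (by simp)] at this
  · intro m _ hm
    rw [notMem_support_iff.1 hm, monomial_zero]

noncomputable def matp (v : Idx D d → MvPolynomial (Fin 2) R) : Matrix (Idx D d) (Idx D d) R :=
  Matrix.of fun i k => coeff (ee k) (v i)

lemma matp_lin {v u : Idx D d → MvPolynomial (Fin 2) R} (N : Matrix (Idx D d) (Idx D d) R)
    (h : ∀ i, v i = ∑ k, N i k • u k) : matp v = N * matp u := by
  ext i k
  simp only [matp, Matrix.of_apply, Matrix.mul_apply]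
  rw [h i, coeff_sum]
  simp

lemma matp_map {R' : Type*} [CommRing R'] (φ : R →+* R') (v : Idx D d → MvPolynomial (Fin 2) R) :
    matp (fun i => map φ (v i)) = (matp v).map φ := by
  ext i k
  simp [matp, coeff_map]
end

lemma phi_det {R : Type*} [CommRing R] (α β : R) (n : ℕ) :
    (Matrix.of fun (i k : TT n) => coeff (k : Fin 2 →₀ ℕ) (phi α β n i)).det = 1 := by
  rw [← Matrix.det_transpose, tri_det _ (fun i : TT n => (i : Fin 2 →₀ ℕ) 1)]
  · refine Finset.prod_eq_one (fun i _ => ?_)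
    simp [phi_coeff]
  · intro i j h
    by_contra hc
    push Not at hc
    apply h
    simp only [Matrix.transpose_apply, Matrix.of_apply]
    rw [phi_coeff _ _ _ _ _ hc.2, if_neg]
    exact fun h => hc.1 (Subtype.ext h.symm)

lemma phi_det' {R : Type*} [CommRing R] (α β : R) (D d : ℕ) :
    (matp (fun k : Idx D d => phi α β D (ee k))).det = 1 := by
  rw [← Matrix.det_transpose, tri_det _ (fun i => ee i 1)]
  · refine Finset.prod_eq_one (fun i _ => ?_)
    simp [phi_coeff, matp]
  · intro i j h
    by_contra hc
    push Not at hc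
    apply h
    simp only [Matrix.transpose_apply, matp, Matrix.of_apply]
    rw [phi_coeff _ _ _ _ _ hc.2, if_neg]
    exact fun h => hc.1 (ee_inj h.symm)

noncomputable def LL {R : Type*} [CommRing R] (f : MvPolynomial (Fin 2) R) (α β : R) (D d : ℕ) :
    Idx D d → MvPolynomial (Fin 2) R :=
  Sum.elim (fun m => f * phi α β (D - d) m) (fun m => phi α β D m)

lemma LL_det {R : Type*} [CommRing R] (f : MvPolynomial (Fin 2) R) (α β : R) {D d : ℕ} (hD : d ≤ D)
    (hf : f.totalDegree ≤ d) :
    (matp (LL f α β D d)).det = (∑ m ∈ TT d, f.coeff m * (α ^ (d - m 0 - m 1) * β ^ (m 0))) ^ (TT (D - d)).card := by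
  classical
  set A := ∑ m ∈ TT d, f.coeff m * (α ^ (d - m 0 - m 1) * β ^ (m 0)) with hA
  have h1 : ∀ m : TT (D - d), ∃ c : (Fin 2 →₀ ℕ) → R, (∀ m', c m' ≠ 0 → m' = m + ex 0 d ∨ m' 1 < m.1 1 + d) ∧
      c (m + ex 0 d) = A ∧ f * phi α β (D - d) m = ∑ m' ∈ TT D, c m' • phi α β D m' := by
    intro m
    have := f_mul_phi (α := α) (β := β) hf m.2
    rwa [Nat.add_sub_cancel' hD] at this
  choose c hc1 hc2 hc3 using h1
  let N : Matrix (Idx D d) (Idx D d) R := Matrix.of (Sum.elim (fun m k => c m (ee k)) (fun m k => if Sum.inr m = k then 1 else 0))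
  rw [matp_lin (u := fun k => phi α β D (ee k)) N, Matrix.det_mul, phi_det', mul_one,
    tri_det N (fun i => ee i 1)]
  · rw [Fintype.prod_sum_type]
    simp only [N, Matrix.of_apply, Sum.elim_inl, Sum.elim_inr, if_true, Finset.prod_const_one, mul_one]
    have : ∀ m : TT (D - d), c m (ee (Sum.inl m : Idx D d)) = A := fun m => hc2 m
    simp [this]
  · rintro (i | i) k h
    · have h2 := hc1 i _ h
      rcases h2 with h2 | h2
      · left; exact ee_inj h2.symm
      · right; simpa [ee] using h2
    · left
      by_contra hne
      exact h (if_neg hne)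
  · rintro (i | i)
    · exact (hc3 i).trans (sum_ee hD (fun m => c i m • phi α β D m))
    · simp [N, LL, ee, ite_smul]
end PAC
end

-- part G4
section
open MvPolynomial
namespace PAC

theorem global_det {f : MvPolynomial (Fin 2) ℤ} {d D : ℕ} (hprim : Finset.gcd f.support f.coeff = 1)
    (hf : Irreducible (map (Int.castRingHom ℚ) f)) (hd : f.totalDegree = d) (hd1 : 1 ≤ d) (hD : d ≤ D)
    (S : Finset (Fin 2 → ℤ)) (hS : ∀ P ∈ S, eval P f = 0) (hcard : d * D < S.card) :
    ∃ (P : II D d → Fin 2 → ℤ) (σ : II D d → MvPolynomial (Fin 2) ℤ), (∀ i, P i ∈ S) ∧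
      (Matrix.of fun r i => eval (P i) (σ r)).det ≠ 0 ∧
      ∀ α β : ℂ, ‖(Matrix.of fun (r i : II D d) => eval (fun l => (P i l : ℂ)) (phi α β D r)).det‖ =
        ‖∑ m ∈ TT d, ((f.coeff m : ℤ) : ℂ) * (α ^ (d - m 0 - m 1) * β ^ (m 0))‖ ^ (TT (D - d)).card *
          ‖(((Matrix.of fun r i => eval (P i) (σ r)).det : ℤ) : ℂ)‖ := by
  classical
  obtain ⟨s, σ0, hs, hσ0, hspan0⟩ := lattice (prime_int hprim hf) hd hd1 hD
  have hcI := card_II hD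
  let eqv : II D d ≃ Fin s := Fintype.equivFinOfCardEq (by rw [Fintype.card_coe]; omega)
  let σ : II D d → MvPolynomial (Fin 2) ℤ := fun m => σ0 (eqv m)
  let b1 : Idx D d → MvPolynomial (Fin 2) ℤ := Sum.elim (fun m => f * monomial (m : Fin 2 →₀ ℕ) 1) σ
  have hspan : ∀ p : MvPolynomial (Fin 2) ℤ, p.totalDegree ≤ D → ∃ N : Idx D d → ℤ, p = ∑ k, N k • b1 k := by
    intro p hp
    obtain ⟨c, q, hq, e⟩ := hspan0 p hp
    refine ⟨Sum.elim (fun m => coeff (m : Fin 2 →₀ ℕ) q) (fun m => c (eqv m)), ?_⟩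
    rw [Fintype.sum_sum_type]
    simp only [b1, Sum.elim_inl, Sum.elim_inr, σ]
    rw [e, add_comm]
    congr 1
    · conv_lhs => rw [poly_expand hq, Finset.mul_sum]
      rw [← Finset.sum_coe_sort]
      exact Finset.sum_congr rfl (fun m _ => by rw [mul_smul_comm])
    · exact (Equiv.sum_comp eqv (fun i => c i • σ0 i)).symm
  have hmon : ∀ k : Idx D d, (monomial (ee k) (1 : ℤ)).totalDegree ≤ D := by
    intro k
    refine (totalDegree_monomial_le _ _).trans ?_
    have := mem_TT'.1 (ee_mem hD k)
    rwa [Finsupp.degree_eq_sum, ← Finsupp.sum_fintype (f := ee k) (g := fun _ e => e) (by simp)] at this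
  choose Ninv hNinv using fun k => hspan _ (hmon k)
  have hone : matp (fun k : Idx D d => monomial (ee k) (1 : ℤ)) = 1 := by
    ext i k
    simp only [matp, Matrix.of_apply, coeff_monomial, Matrix.one_apply]
    congr 1
    exact propext ee_inj.eq_iff
  have hinv : (Matrix.of Ninv) * matp b1 = 1 := by
    rw [← matp_lin (Matrix.of Ninv) (v := fun k => monomial (ee k) (1 : ℤ)) hNinv, hone]
  have hdet : IsUnit (matp b1).det := by
    have := congrArg Matrix.det hinv
    rw [Matrix.det_mul, Matrix.det_one] at this
    exact IsUnit.of_mul_eq_one_right _ this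
  -- points
  let A : Matrix S (II D d) ℚ := Matrix.of fun P m => ((eval (P : Fin 2 → ℤ) (σ m) : ℤ) : ℚ)
  have hevQ : ∀ (P : Fin 2 → ℤ) (g : MvPolynomial (Fin 2) ℤ),
      eval (fun l => (P l : ℚ)) (map (Int.castRingHom ℚ) g) = ((eval P g : ℤ) : ℚ) := fun P g =>
    (map_eval (Int.castRingHom ℚ) P g).symm
  have hevC : ∀ (P : Fin 2 → ℤ) (g : MvPolynomial (Fin 2) ℤ),
      eval (fun l => (P l : ℂ)) (map (Int.castRingHom ℂ) g) = ((eval P g : ℤ) : ℂ) := fun P g =>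
    (map_eval (Int.castRingHom ℂ) P g).symm
  have hσd : ∀ m, (σ m).totalDegree ≤ D := fun m => hσ0 _
  have hfdeg : (map (Int.castRingHom ℚ) f).totalDegree = d := by
    rw [← hd, totalDegree, support_map_of_injective _ Int.cast_injective]; rfl
  obtain ⟨r, hr⟩ := exists_minor A (by
    intro v hv
    let h : MvPolynomial (Fin 2) ℚ := ∑ m, v m • map (Int.castRingHom ℚ) (σ m)
    have hhd : h.totalDegree ≤ D := by
      refine totalDegree_finsetSum_le (fun m _ => ?_)
      exact (totalDegree_smul_le _ _).trans ((totalDegree_map_le' _ _).trans (hσd m))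
    have hdv : map (Int.castRingHom ℚ) f ∣ h := by
      by_contra hn
      have hinj : Function.Injective (fun (P : Fin 2 → ℤ) (l : Fin 2) => (P l : ℚ)) := by
        intro P Q hPQ
        funext l
        have := congrFun hPQ l
        simp only at this
        exact_mod_cast this
      have := bezout_points hf hn (S.image (fun P l => (P l : ℚ))) (by
        intro P' hP'
        obtain ⟨P, hP, rfl⟩ := Finset.mem_image.1 hP'
        refine ⟨?_, ?_⟩
        · rw [hevQ, hS P hP]; simp
        · have := hv ⟨P, hP⟩
          simp only [h, map_sum, smul_eval]
          rw [← this]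
          refine Finset.sum_congr rfl (fun m _ => ?_)
          rw [hevQ, mul_comm]; rfl)
      rw [Finset.card_image_of_injective _ hinj, hfdeg] at this
      have := this.trans (Nat.mul_le_mul_left d hhd)
      omega
    obtain ⟨q, hq⟩ := hdv
    have hqd : q.totalDegree ≤ D - d := by
      by_cases hq0 : q = 0
      · simp [hq0]
      rw [hq, totalDegree_mul_of_isDomain hf.ne_zero hq0, hfdeg] at hhd
      omega
    let w : Idx D d → ℚ := Sum.elim (fun m => - coeff (m : Fin 2 →₀ ℕ) q) v
    have hw : ∑ k, w k • map (Int.castRingHom ℚ) (b1 k) = 0 := by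
      rw [Fintype.sum_sum_type]
      simp only [w, b1, Sum.elim_inl, Sum.elim_inr]
      change _ + h = 0
      rw [hq]
      have hqe : map (Int.castRingHom ℚ) f * q = ∑ m : TT (D - d), map (Int.castRingHom ℚ) f *
          coeff (m : Fin 2 →₀ ℕ) q • monomial (m : Fin 2 →₀ ℕ) 1 := by
        conv_lhs => rw [poly_expand hqd, Finset.mul_sum]
        rw [← Finset.sum_coe_sort (TT (D - d))]
      rw [hqe, ← Finset.sum_add_distrib]
      refine Finset.sum_eq_zero (fun m _ => ?_)
      simp only [map_mul, map_monomial, map_one, mul_smul_comm, neg_smul]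
      simp
    have hw2 : Matrix.vecMul w ((matp b1).map (Int.castRingHom ℚ)) = 0 := by
      rw [← matp_map]
      funext k
      have := congrArg (coeff (ee k)) hw
      rw [coeff_sum, coeff_zero] at this
      simpa [Matrix.vecMul, dotProduct, matp] using this
    have hw3 : w = 0 := by
      refine Matrix.eq_zero_of_vecMul_eq_zero ?_ hw2
      have h1 : ((matp b1).map (Int.castRingHom ℚ)).det = Int.castRingHom ℚ (matp b1).det :=
        (RingHom.map_det _ _).symm
      rw [h1]
      exact (hdet.map (Int.castRingHom ℚ)).ne_zero
    funext m
    exact congrFun hw3 (Sum.inr m))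
  refine ⟨fun i => (r i : Fin 2 → ℤ), σ, fun i => (r i).2, ?_, ?_⟩
  · intro h0
    apply hr
    have h1 : A.submatrix r id = ((Matrix.of fun r' i => eval ((r i : S) : Fin 2 → ℤ) (σ r')).map (Int.castRingHom ℚ)).transpose := by
      ext i j; simp [A]
    rw [h1, Matrix.det_transpose]
    have h2 := (RingHom.map_det (Int.castRingHom ℚ) (Matrix.of fun r' i => eval ((r i : S) : Fin 2 → ℤ) (σ r')))
    rw [h0, map_zero] at h2
    exact h2.symm
  · intro α β
    set fC := map (Int.castRingHom ℂ) f with hfC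
    have hfCd : fC.totalDegree ≤ d := (totalDegree_map_le' _ _).trans hd.le
    have hL := LL_det fC α β hD hfCd
    -- expansions over ℂ
    have hexp : ∀ p : MvPolynomial (Fin 2) ℂ, p.totalDegree ≤ D →
        ∃ N : Idx D d → ℂ, p = ∑ k, N k • map (Int.castRingHom ℂ) (b1 k) := by
      intro p hp
      refine ⟨fun l => ∑ k : Idx D d, coeff (ee k) p * (Ninv k l : ℂ), ?_⟩
      conv_lhs => rw [poly_expand hp]
      rw [sum_ee hD (fun m => coeff m p • monomial m (1 : ℂ))]
      simp only [Finset.sum_smul]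
      rw [Finset.sum_comm]
      refine Finset.sum_congr rfl (fun k _ => ?_)
      have := congrArg (map (Int.castRingHom ℂ)) (hNinv k)
      rw [map_monomial, map_one, map_sum] at this
      rw [this, Finset.smul_sum]
      refine Finset.sum_congr rfl (fun l _ => ?_)
      rw [mul_smul]
      congr 1
      rw [zsmul_eq_mul, map_mul, map_intCast, smul_eq_C_mul]
      simp
    have hexp2 : ∀ m : II D d, ∃ N : Idx D d → ℂ, phi α β D m = ∑ k, N k • map (Int.castRingHom ℂ) (b1 k) :=
      fun m => hexp _ (phi_totalDegree α β (Finset.mem_filter.1 m.2).1)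
    choose N2 hN2 using hexp2
    let Φ : Matrix (TT (D - d)) (TT (D - d)) ℂ := Matrix.of fun i k => coeff (k : Fin 2 →₀ ℕ) (phi α β (D - d) i)
    let K : Matrix (II D d) (II D d) ℂ := Matrix.of fun i k => N2 i (Sum.inr k)
    let Y : Matrix (II D d) (TT (D - d)) ℂ := Matrix.of fun i k => N2 i (Sum.inl k)
    have hmat : matp (LL fC α β D d) = Matrix.fromBlocks Φ 0 Y K * matp (fun k => map (Int.castRingHom ℂ) (b1 k)) := by
      apply matp_lin
      rintro (i | i)
      · rw [Fintype.sum_sum_type]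
        simp only [Matrix.fromBlocks_apply₁₁, Matrix.fromBlocks_apply₁₂, Matrix.zero_apply, zero_smul,
          Finset.sum_const_zero, add_zero, b1, Sum.elim_inl, LL, Φ, Matrix.of_apply]
        conv_lhs => rw [poly_expand (phi_totalDegree α β i.2), Finset.mul_sum]
        rw [← Finset.sum_coe_sort (TT (D - d))]
        refine Finset.sum_congr rfl (fun m _ => ?_)
        rw [map_mul, map_monomial, map_one (Int.castRingHom ℂ), mul_smul_comm]
      · rw [Fintype.sum_sum_type]
        simp only [Matrix.fromBlocks_apply₂₁, Matrix.fromBlocks_apply₂₂, LL, Sum.elim_inr, K, Y, Matrix.of_apply]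
        rw [hN2 i, Fintype.sum_sum_type]
    have hK : ‖K.det‖ = ‖∑ m ∈ TT d, ((f.coeff m : ℤ) : ℂ) * (α ^ (d - m 0 - m 1) * β ^ (m 0))‖ ^ (TT (D - d)).card := by
      have h1 := congrArg (fun M => ‖Matrix.det M‖) hmat
      rw [hL, Matrix.det_mul, Matrix.det_fromBlocks_zero₁₂, phi_det, one_mul, matp_map] at h1
      have h2 : ((matp b1).map (Int.castRingHom ℂ)).det = Int.castRingHom ℂ (matp b1).det :=
        (RingHom.map_det _ _).symm
      have h3 : ‖Int.castRingHom ℂ (matp b1).det‖ = 1 := by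
        rcases Int.isUnit_iff.1 hdet with h | h <;> rw [h] <;> simp
      rw [h2, norm_mul, h3, mul_one, norm_pow] at h1
      rw [← h1]
      simp [hfC, coeff_map]
    have hev : (Matrix.of fun (r' i : II D d) => eval (fun l => (((r i : S) : Fin 2 → ℤ) l : ℂ)) (phi α β D r')) =
        K * (Matrix.of fun r' i => eval ((r i : S) : Fin 2 → ℤ) (σ r')).map (Int.castRingHom ℂ) := by
      ext i j
      simp only [Matrix.of_apply, Matrix.mul_apply, Matrix.map_apply]
      rw [hN2 i, map_sum, Fintype.sum_sum_type]
      simp only [smul_eval, hevC, b1, Sum.elim_inl, Sum.elim_inr, map_mul, hS _ (r j).2]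
      simp [K]
    rw [hev, Matrix.det_mul, norm_mul, hK]
    congr 2
    exact (RingHom.map_det (Int.castRingHom ℂ) _).symm
end PAC
end

-- part G5
section
open MvPolynomial
namespace PAC

lemma sum_II_le (D d : ℕ) : 2 * ∑ m ∈ II D d, (m 0 + m 1) ≤ d * (D * (D + 1)) := by
  classical
  have h1 : ∑ m ∈ II D d, (m 0 + m 1) = ∑ x ∈ (II D d).image (fun m => (m 1, m 0 + m 1)), x.2 := by
    rw [Finset.sum_image]
    intro a _ b _ h
    simp only [Prod.mk.injEq] at h
    exact ext2 (by omega) h.1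
  have h2 : (II D d).image (fun m => (m 1, m 0 + m 1)) ⊆ Finset.range d ×ˢ Finset.range (D + 1) := by
    intro x hx
    obtain ⟨m, hm, rfl⟩ := Finset.mem_image.1 hx
    rw [mem_II] at hm
    simp
    omega
  have h3 := Finset.sum_le_sum_of_subset (f := fun x : ℕ × ℕ => x.2) h2
  rw [Finset.sum_product] at h3
  simp only [Finset.sum_const, Finset.card_range, smul_eq_mul] at h3
  have h4 := Finset.sum_range_id_mul_two (D + 1)
  rw [h1]
  calc 2 * _ ≤ 2 * (d * ∑ i ∈ Finset.range (D + 1), i) := Nat.mul_le_mul_left _ h3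
    _ = d * ((∑ i ∈ Finset.range (D + 1), i) * 2) := by ring
    _ = d * (D * (D + 1)) := by rw [h4, Nat.add_sub_cancel]; ring

lemma norm_det_le {ι : Type*} [Fintype ι] [DecidableEq ι] (M : Matrix ι ι ℂ) (b : ι → ℝ)
    (h : ∀ i j, ‖M i j‖ ≤ b i) : ‖M.det‖ ≤ (Fintype.card ι).factorial * ∏ i, b i := by
  rw [Matrix.det_apply]
  refine (norm_sum_le _ _).trans ?_
  have : ∀ σ ∈ (Finset.univ : Finset (Equiv.Perm ι)), ‖Equiv.Perm.sign σ • ∏ i, M (σ i) i‖ ≤ ∏ i, b i := by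
    intro σ _
    have h1 : ‖Equiv.Perm.sign σ • ∏ i, M (σ i) i‖ = ∏ i, ‖M (σ i) i‖ := by
      rw [← norm_prod]
      rcases Int.units_eq_one_or (Equiv.Perm.sign σ) with h | h <;> rw [h] <;> simp
    rw [h1, ← Equiv.prod_comp σ b]
    exact Finset.prod_le_prod (fun _ _ => norm_nonneg _) (fun i _ => h _ _)
  refine (Finset.sum_le_sum this).trans ?_
  rw [Finset.sum_const, nsmul_eq_mul, Finset.card_univ, Fintype.card_perm]

lemma phi_bound {B : ℝ} (hB : 1 ≤ B) {w0 w1 : ℂ} (h0 : ‖w0‖ = 1) (h1 : ‖w1‖ = 1) {D : ℕ} {m : Fin 2 →₀ ℕ}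
    (hm : m ∈ TT D) (P : Fin 2 → ℤ) (hP : ∀ l, |(P l : ℝ)| ≤ B) :
    ‖eval (fun l => (P l : ℂ)) (phi (w0 / B) w1 D m)‖ ≤ 2 ^ D * B ^ (m 0 + m 1) := by
  rw [mem_TT] at hm
  have hB0 : 0 < B := by linarith
  have hP' : ∀ l, ‖(P l : ℂ)‖ ≤ B := fun l => by
    rw [Complex.norm_intCast]; exact hP l
  have e : eval (fun l => (P l : ℂ)) (phi (w0 / B) w1 D m) =
      (1 - w0 / B * P 1) ^ (D - m 0 - m 1) * (P 0 - w1 * P 1) ^ (m 0) * (P 1 : ℂ) ^ (m 1) := by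
    simp [phi]
  have b1 : ‖(1 - w0 / B * P 1 : ℂ)‖ ≤ 2 := by
    refine (norm_sub_le _ _).trans ?_
    rw [norm_one, norm_mul, norm_div, h0, Complex.norm_real, Real.norm_of_nonneg hB0.le]
    have : 1 / B * ‖(P 1 : ℂ)‖ ≤ 1 := by
      rw [one_div, inv_mul_le_iff₀ hB0, mul_one]; exact hP' 1
    linarith
  have b2 : ‖(P 0 - w1 * P 1 : ℂ)‖ ≤ 2 * B := by
    refine (norm_sub_le _ _).trans ?_
    rw [norm_mul, h1, one_mul]
    linarith [hP' 0, hP' 1]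
  rw [e, norm_mul, norm_mul, norm_pow, norm_pow, norm_pow]
  calc _ ≤ 2 ^ (D - m 0 - m 1) * (2 * B) ^ (m 0) * B ^ (m 1) := by
        gcongr
        exact hP' 1
    _ = 2 ^ (D - m 0 - m 1 + m 0) * B ^ (m 0 + m 1) := by rw [mul_pow, pow_add, pow_add]; ring
    _ ≤ 2 ^ D * B ^ (m 0 + m 1) := by
        gcongr
        · norm_num
        · omega

theorem det_ineq {f : MvPolynomial (Fin 2) ℤ} {d D : ℕ} (hprim : Finset.gcd f.support f.coeff = 1)
    (hf : Irreducible (map (Int.castRingHom ℚ) f)) (hd : f.totalDegree = d) (hd1 : 1 ≤ d) (hD : d ≤ D)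
    {B : ℝ} (hB : 1 ≤ B)
    (S : Finset (Fin 2 → ℤ)) (hS : ∀ P ∈ S, eval P f = 0 ∧ ∀ l, |(P l : ℝ)| ≤ B) (hcard : d * D < S.card)
    {m : Fin 2 →₀ ℕ} (hm : m ∈ TT d) (Q : ℕ)
    (hQ : ∀ (P : II D d → Fin 2 → ℤ) (σ : II D d → MvPolynomial (Fin 2) ℤ), (∀ i, eval (P i) f = 0) →
      (Matrix.of fun r i => eval (P i) (σ r)).det ≠ 0 →
      (Q : ℤ) ∣ (Matrix.of fun r i => eval (P i) (σ r)).det) :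
    (Q : ℝ) * (|((f.coeff m : ℤ) : ℝ)| * B ^ (m 0 + m 1) / B ^ d) ^ (TT (D - d)).card ≤
      (II D d).card.factorial * (2 ^ D) ^ (II D d).card * B ^ (∑ m ∈ II D d, (m 0 + m 1)) := by
  classical
  obtain ⟨P, σ, hPS, hdet, hkey⟩ := global_det hprim hf hd hd1 hD S (fun P hP => (hS P hP).1) hcard
  have hB0 : 0 < B := by linarith
  have hBC : (B : ℂ) ≠ 0 := by exact_mod_cast hB0.ne'
  obtain ⟨w0, w1, h0, h1, hge⟩ := exists_units_ge d (fun m => ((f.coeff m : ℤ) : ℂ) * (B : ℂ) ^ (m 0 + m 1)) m hm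
  have hk := hkey (w0 / B) w1
  set A := ∑ m ∈ TT d, ((f.coeff m : ℤ) : ℂ) * ((w0 / B) ^ (d - m 0 - m 1) * w1 ^ (m 0)) with hA
  have hAe : ∑ m ∈ TT d, ((f.coeff m : ℤ) : ℂ) * (B : ℂ) ^ (m 0 + m 1) * (w0 ^ (d - m 0 - m 1) * w1 ^ (m 0)) =
      (B : ℂ) ^ d * A := by
    rw [hA, Finset.mul_sum]
    refine Finset.sum_congr rfl (fun m hm => ?_)
    rw [mem_TT] at hm
    have : (B : ℂ) ^ d = B ^ (m 0 + m 1) * B ^ (d - m 0 - m 1) := by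
      rw [← pow_add]; congr 1; omega
    rw [this, div_pow]
    field_simp
  have hAge : |((f.coeff m : ℤ) : ℝ)| * B ^ (m 0 + m 1) / B ^ d ≤ ‖A‖ := by
    rw [hAe, norm_mul, norm_mul, norm_pow, norm_pow, Complex.norm_real, Complex.norm_intCast,
      Real.norm_of_nonneg hB0.le] at hge
    rw [div_le_iff₀ (by positivity)]
    linarith
  have hQd := hQ P σ (fun i => (hS _ (hPS i)).1) hdet
  have hQle : (Q : ℝ) ≤ ‖(((Matrix.of fun r i => eval (P i) (σ r)).det : ℤ) : ℂ)‖ := by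
    rw [Complex.norm_intCast]
    have := Int.le_of_dvd (abs_pos.2 hdet) ((dvd_abs _ _).2 hQd)
    exact_mod_cast this
  have hub : ‖(Matrix.of fun (r i : II D d) => eval (fun l => (P i l : ℂ)) (phi (w0 / B) w1 D r)).det‖ ≤
      (II D d).card.factorial * (2 ^ D) ^ (II D d).card * B ^ (∑ m ∈ II D d, (m 0 + m 1)) := by
    refine (norm_det_le _ (fun r : II D d => 2 ^ D * B ^ ((r : Fin 2 →₀ ℕ) 0 + (r : Fin 2 →₀ ℕ) 1)) ?_).trans (le_of_eq ?_)
    · intro r i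
      exact phi_bound hB h0 h1 (Finset.mem_filter.1 r.2).1 (P i) (hS _ (hPS i)).2
    · rw [Fintype.card_coe, Finset.prod_mul_distrib, Finset.prod_const, Finset.prod_pow_eq_pow_sum,
        Finset.card_univ, Fintype.card_coe, Finset.sum_coe_sort (II D d) (fun r => r 0 + r 1), mul_assoc]
  rw [hk] at hub
  refine le_trans ?_ hub
  rw [mul_comm]
  gcongr
end PAC
end

-- part G6
section
open MvPolynomial
namespace PAC

/-- `p`-adic exponent -/
noncomputable def ep (s d p : ℕ) : ℕ := ⌈(s : ℝ) ^ 2 / (2 * (p + 65 * d ^ 2 * Real.sqrt p)) - s / 2⌉₊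

noncomputable def GP (s d : ℕ) (Bd : Finset ℕ) : Finset ℕ :=
  (Nat.primesLE s).filter (fun p => 10 ^ 6 * d ^ 4 < p ∧ p ∉ Bd)

noncomputable def Qgl (s d : ℕ) (Bd : Finset ℕ) : ℕ := ∏ p ∈ GP s d Bd, p ^ ep s d p

lemma mem_GP {s d p : ℕ} {Bd : Finset ℕ} : p ∈ GP s d Bd ↔ (p ≤ s ∧ p.Prime) ∧ 10 ^ 6 * d ^ 4 < p ∧ p ∉ Bd := by
  rw [GP, Finset.mem_filter, Nat.mem_primesLE]

lemma Qgl_dvd {f : MvPolynomial (Fin 2) ℤ} {d : ℕ} (hd : f.totalDegree = d) {Bd : Finset ℕ}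
    (hirr : ∀ (p : ℕ) [Fact p.Prime], 27 * d ^ 4 < p → p ∉ Bd →
      Irreducible (map (Int.castRingHom (AlgebraicClosure (ZMod p))) f))
    {ι : Type*} [Fintype ι] [DecidableEq ι] (P : ι → Fin 2 → ℤ) (hP : ∀ i, eval (P i) f = 0)
    (g : ι → MvPolynomial (Fin 2) ℤ) :
    (Qgl (Fintype.card ι) d Bd : ℤ) ∣ (Matrix.of fun r i => eval (P i) (g r)).det := by
  rw [Qgl, Nat.cast_prod]
  apply Finset.prod_dvd_of_coprime
  · intro p hp q hq hpq
    have hp := mem_GP.1 hp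
    have hq := mem_GP.1 hq
    rw [Function.onFun, Nat.isCoprime_iff_coprime]
    exact Nat.Coprime.pow _ _ ((Nat.coprime_primes hp.1.2 hq.1.2).2 hpq)
  · intro p hp
    have hp := mem_GP.1 hp
    have : Fact p.Prime := ⟨hp.1.2⟩
    obtain ⟨e, h1, h2⟩ := local_div hd hp.2.1 (hirr p (by omega) hp.2.2) P hP g
    rw [Nat.cast_pow]
    exact (pow_dvd_pow _ (Nat.ceil_le.2 h2)).trans h1

lemma Qgl_pos (s d : ℕ) (Bd : Finset ℕ) : 0 < Qgl s d Bd :=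
  Finset.prod_pos (fun _ hp => pow_pos (mem_GP.1 hp).1.2.pos _)

lemma Qgl_log : ∃ C : ℝ, 0 ≤ C ∧ ∀ (s d : ℕ) (Bd : Finset ℕ), 1 ≤ d → 1 ≤ s → (∀ p ∈ Bd, p.Prime) →
    (s : ℝ) ^ 2 / 2 * (Real.log s - 4 * Real.log d - ∑ p ∈ Bd, Real.log p / p - C) ≤ Real.log (Qgl s d Bd) := by
  obtain ⟨C, hC, h⟩ := good_sum
  refine ⟨C + Real.log 4, add_nonneg hC (Real.log_nonneg (by norm_num)), ?_⟩
  intro s d Bd hd hs hBd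
  have h1 := h d s Bd (fun p => p + 65 * d ^ 2 * Real.sqrt p) hd hs hBd (by
    intro p hp _ _
    have := hp.pos
    exact ⟨by positivity, le_rfl⟩)
  have h2 : ∑ p ∈ GP s d Bd, Real.log p ≤ Real.log 4 * s := by
    refine le_trans ?_ (Chebyshev.theta_le_log4_mul_x (x := s) (by positivity))
    rw [Chebyshev.theta_eq_sum_primesLE_log]
    refine Finset.sum_le_sum_of_subset_of_nonneg (Finset.filter_subset _ _) ?_
    intro p hp _
    exact Real.log_natCast_nonneg p
  have h3 : Real.log (Qgl s d Bd) = ∑ p ∈ GP s d Bd, ep s d p * Real.log p := by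
    rw [Qgl, Nat.cast_prod, Real.log_prod]
    · refine Finset.sum_congr rfl (fun p _ => ?_)
      rw [Nat.cast_pow, Real.log_pow]
    · intro p hp
      have := (mem_GP.1 hp).1.2.pos
      positivity
  have h4 : ∑ p ∈ GP s d Bd, ((s : ℝ) ^ 2 / (2 * (p + 65 * d ^ 2 * Real.sqrt p)) - s / 2) * Real.log p ≤
      ∑ p ∈ GP s d Bd, ep s d p * Real.log p := by
    refine Finset.sum_le_sum (fun p hp => ?_)
    exact mul_le_mul_of_nonneg_right (Nat.le_ceil _) (Real.log_natCast_nonneg p)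
  have h5 : ∑ p ∈ GP s d Bd, ((s : ℝ) ^ 2 / (2 * (p + 65 * d ^ 2 * Real.sqrt p)) - s / 2) * Real.log p =
      (s : ℝ) ^ 2 / 2 * ∑ p ∈ GP s d Bd, Real.log p / (p + 65 * d ^ 2 * Real.sqrt p) -
        s / 2 * ∑ p ∈ GP s d Bd, Real.log p := by
    rw [Finset.mul_sum, Finset.mul_sum, ← Finset.sum_sub_distrib]
    refine Finset.sum_congr rfl (fun p hp => ?_)
    have := (mem_GP.1 hp).1.2.pos
    have : (p + 65 * d ^ 2 * Real.sqrt p : ℝ) ≠ 0 := by positivity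
    field_simp
  have h6 := mul_le_mul_of_nonneg_left h1 (by positivity : (0 : ℝ) ≤ (s : ℝ) ^ 2 / 2)
  have h7 := mul_le_mul_of_nonneg_left h2 (by positivity : (0 : ℝ) ≤ (s : ℝ) / 2)
  rw [h3]
  refine le_trans ?_ h4
  rw [h5]
  change (s : ℝ) ^ 2 / 2 * _ ≤ (s : ℝ) ^ 2 / 2 * ∑ p ∈ GP s d Bd, Real.log p / (p + 65 * d ^ 2 * Real.sqrt p) at h6
  nlinarith

theorem log_ineq : ∃ C : ℝ, 0 ≤ C ∧ ∀ (f : MvPolynomial (Fin 2) ℤ) (d D : ℕ) (B : ℝ) (Bd : Finset ℕ)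
    (S : Finset (Fin 2 → ℤ)) (m : Fin 2 →₀ ℕ), Finset.gcd f.support f.coeff = 1 →
    Irreducible (map (Int.castRingHom ℚ) f) → f.totalDegree = d → 1 ≤ d → d ≤ D → 1 ≤ B →
    (∀ p ∈ Bd, p.Prime) →
    (∀ (p : ℕ) [Fact p.Prime], 27 * d ^ 4 < p → p ∉ Bd →
      Irreducible (map (Int.castRingHom (AlgebraicClosure (ZMod p))) f)) →
    (∀ P ∈ S, eval P f = 0 ∧ ∀ l, |(P l : ℝ)| ≤ B) → d * D < S.card → m ∈ TT d → f.coeff m ≠ 0 →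
    ((II D d).card : ℝ) ^ 2 / 2 * (Real.log (II D d).card - 4 * Real.log d - ∑ p ∈ Bd, Real.log p / p - C) +
      (TT (D - d)).card * Real.log (|((f.coeff m : ℤ) : ℝ)| * B ^ (m 0 + m 1) / B ^ d) ≤
      (II D d).card * Real.log (II D d).card + D * (II D d).card + d * D * (D + 1) / 2 * Real.log B := by
  obtain ⟨C, hC, h⟩ := Qgl_log
  refine ⟨C, hC, ?_⟩
  intro f d D B Bd S m hprim hf hd hd1 hD hB hBd hirr hS hcard hm hcm
  have hB0 : 0 < B := by linarith
  set s := (II D d).card with hs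
  have hs1 : 1 ≤ s := Finset.card_pos.2 ⟨0, mem_II.2 ⟨by simp, by simp; omega⟩⟩
  have h1 := det_ineq hprim hf hd hd1 hD hB S hS hcard hm (Qgl s d Bd) (by
    intro P σ hP _
    have := Qgl_dvd hd hirr P hP σ
    rwa [Fintype.card_coe] at this)
  have h2 := h s d Bd hd1 hs1 hBd
  set η := |((f.coeff m : ℤ) : ℝ)| * B ^ (m 0 + m 1) / B ^ d with hη
  have hη0 : 0 < η := by
    have : (0 : ℝ) < |((f.coeff m : ℤ) : ℝ)| := abs_pos.2 (by exact_mod_cast hcm)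
    positivity
  have hQ0 : (0 : ℝ) < Qgl s d Bd := by exact_mod_cast Qgl_pos s d Bd
  have h3 := Real.log_le_log (by positivity) h1
  rw [Real.log_mul hQ0.ne' (by positivity), Real.log_pow, Real.log_mul (by positivity) (by positivity),
    Real.log_mul (by positivity) (by positivity), Real.log_pow, Real.log_pow, Real.log_pow] at h3
  have h4 : Real.log (s.factorial : ℝ) ≤ s * Real.log s := by
    rw [← Real.log_pow]
    apply Real.log_le_log (by positivity)
    exact_mod_cast Nat.factorial_le_pow s
  have h5 : ((∑ m ∈ II D d, (m 0 + m 1) : ℕ) : ℝ) ≤ d * D * (D + 1) / 2 := by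
    have := sum_II_le D d
    have : (2 : ℝ) * ((∑ m ∈ II D d, (m 0 + m 1) : ℕ) : ℝ) ≤ d * (D * (D + 1)) := by exact_mod_cast this
    linarith
  have h6 := mul_le_mul_of_nonneg_right h5 (Real.log_nonneg hB)
  have h7 : (s : ℝ) * (D * Real.log 2) ≤ D * s := by
    have : Real.log 2 ≤ 1 := by linarith [Real.log_two_lt_d9]
    have h0 : (0 : ℝ) ≤ D * s := by positivity
    nlinarith
  linarith
end PAC
end

-- part N1
section
open MvPolynomial
namespace PAC

lemma num_a {d D s x : ℝ} (hd : 1 ≤ d) (hD : 4 * d ≤ D) (hx : 0 ≤ x) (hxD : x ≤ D)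
    (hs : 2 * s = d * (2 * D + 3 - d)) : d * D * (D + 1) * x / s ^ 2 ≤ x / d + 3 := by
  have hs0 : 0 < s := by nlinarith
  have hE : 0 < D + 1 := by linarith
  set q := (d - 1) / (2 * (D + 1)) with hq
  have hq0 : 0 ≤ q := div_nonneg (by linarith) (by linarith)
  have hq1 : q ≤ 1 / 8 := by
    rw [hq, div_le_iff₀ (by linarith)]
    linarith
  have hqE : q * (D + 1) * 2 = d - 1 := by
    rw [hq]
    field_simp
  have hs1 : d * (D + 1) * (1 - q) = s := by
    have : d * (q * (D + 1) * 2) = d * (d - 1) := by rw [hqE]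
    nlinarith
  have h1 : 1 ≤ (1 + 6 * q) * (1 - q) ^ 2 := by nlinarith [mul_nonneg hq0 hq0, mul_nonneg hq0 (mul_nonneg hq0 hq0)]
  have h2 : (d * D * (D + 1)) * d ≤ (1 + 6 * q) * s ^ 2 := by
    rw [← hs1]
    have : d * D * (D + 1) * d ≤ (d * (D + 1)) ^ 2 := by
      have : 0 ≤ d ^ 2 * (D + 1) := by positivity
      nlinarith
    have h3 := mul_le_mul_of_nonneg_left h1 (sq_nonneg (d * (D + 1)))
    calc _ ≤ (d * (D + 1)) ^ 2 * ((1 + 6 * q) * (1 - q) ^ 2) := by linarith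
      _ = _ := by ring
  have h4 : x * q ≤ d / 2 := by
    have : x * q ≤ (D + 1) * q := mul_le_mul_of_nonneg_right (by linarith) hq0
    linarith
  have h5 : d * D * (D + 1) * x / s ^ 2 ≤ (1 + 6 * q) * x / d := by
    rw [div_le_div_iff₀ (by positivity) (by positivity)]
    have := mul_le_mul_of_nonneg_right h2 hx
    linarith
  refine h5.trans ?_
  have : x / d + 3 = (x + 3 * d) / d := by field_simp
  rw [this]
  apply div_le_div_of_nonneg_right _ (by linarith)
  linarith

lemma num_b {d D s r : ℝ} (hd : 1 ≤ d) (hD : 4 * d ≤ D)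
    (hs : 2 * s = d * (2 * D + 3 - d)) (hr : 2 * r = (D - d + 1) * (D - d + 2)) :
    (1 - 2 * d / (D + 1)) / d ^ 2 ≤ 2 * r / s ^ 2 := by
  have hs0 : 0 < s := by nlinarith
  have hE : 0 < D + 1 := by linarith
  have hs1 : s ≤ d * (D + 1) := by nlinarith
  have hr1 : (D + 1 - d) ^ 2 ≤ 2 * r := by nlinarith
  have h1 : (D + 1) ^ 2 * (1 - 2 * d / (D + 1)) ≤ 2 * r := by
    refine le_trans ?_ hr1
    have : (D + 1) ^ 2 * (1 - 2 * d / (D + 1)) = (D + 1) ^ 2 - 2 * d * (D + 1) := by field_simp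
    rw [this]
    nlinarith [sq_nonneg d]
  have h0 : 0 ≤ 1 - 2 * d / (D + 1) := by
    rw [sub_nonneg, div_le_one hE]
    linarith
  rw [div_le_div_iff₀ (by positivity) (by positivity)]
  have h2 : s ^ 2 ≤ (d * (D + 1)) ^ 2 := pow_le_pow_left₀ hs0.le hs1 2
  calc _ ≤ (1 - 2 * d / (D + 1)) * (d * (D + 1)) ^ 2 := mul_le_mul_of_nonneg_left h2 h0
    _ = ((D + 1) ^ 2 * (1 - 2 * d / (D + 1))) * d ^ 2 := by ring
    _ ≤ _ := mul_le_mul_of_nonneg_right h1 (sq_nonneg d)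

lemma num_c {d D s r x h K : ℝ} (hd : 1 ≤ d) (hD : 4 * d ≤ D) (hx : 0 ≤ x) (hxD : x ≤ D) (hh : 0 ≤ h)
    (hs : 2 * s = d * (2 * D + 3 - d)) (hr : 2 * r = (D - d + 1) * (D - d + 2))
    (H : s ^ 2 / 2 * (Real.log s - K) + r * h ≤ s * Real.log s + D * s + d * D * (D + 1) / 2 * x) :
    (h ≤ 4 * d * x → Real.log s ≤ K + 17 + x / d - h / d ^ 2) ∧
      (4 * d * x < h → Real.log s ≤ K + 17 - h / (4 * d ^ 2)) := by
  have hs0 : 0 < s := by nlinarith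
  have hE : 0 < D + 1 := by linarith
  have ha := num_a hd hD hx hxD hs
  have hb := mul_le_mul_of_nonneg_right (num_b hd hD hs hr) hh
  have hDs : D ≤ 2 * s := by nlinarith
  have hL : Real.log s ≤ s := by linarith [Real.log_le_sub_one_of_pos hs0]
  have H2 : Real.log s - K + 2 * r / s ^ 2 * h ≤ 6 + d * D * (D + 1) * x / s ^ 2 := by
    have e1 : Real.log s - K + 2 * r / s ^ 2 * h = (s ^ 2 / 2 * (Real.log s - K) + r * h) / (s ^ 2 / 2) := by
      field_simp
    have e2 : 6 + d * D * (D + 1) * x / s ^ 2 = (s * s + 2 * s * s + d * D * (D + 1) / 2 * x) / (s ^ 2 / 2) := by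
      field_simp
      ring
    rw [e1, e2]
    apply div_le_div_of_nonneg_right _ (by positivity)
    refine H.trans ?_
    nlinarith
  have e3 : (1 - 2 * d / (D + 1)) / d ^ 2 * h = h / d ^ 2 - 2 * h / (d * (D + 1)) := by
    field_simp
  have hd0 : 0 < d := by linarith
  constructor
  · intro h1
    have : 2 * h / (d * (D + 1)) ≤ 8 := by
      rw [div_le_iff₀ (by positivity)]
      nlinarith
    linarith
  · intro h1
    have h2 : 2 * h / (d * (D + 1)) ≤ h / (2 * d ^ 2) := by
      rw [div_le_div_iff₀ (by positivity) (by positivity)]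
      have : 0 ≤ h * d * (D - 4 * d) := mul_nonneg (by positivity) (by linarith)
      nlinarith [mul_nonneg hh hd0.le]
    have h3 : x / d ≤ h / (4 * d ^ 2) := by
      rw [div_le_div_iff₀ (by positivity) (by positivity)]
      nlinarith
    have e4 : h / (2 * d ^ 2) = 2 * (h / (4 * d ^ 2)) := by field_simp; norm_num
    have e5 : h / d ^ 2 = 4 * (h / (4 * d ^ 2)) := by field_simp
    linarith

lemma mul_exp_neg_le (w : ℝ) : w * Real.exp (-w) ≤ 1 := by
  have h1 : w ≤ Real.exp w := by linarith [Real.add_one_le_exp w]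
  have := mul_le_mul_of_nonneg_right h1 (Real.exp_pos (-w)).le
  rwa [← Real.exp_add, add_neg_cancel, Real.exp_zero] at this

lemma exp_K {d b C y : ℝ} (hd : 1 ≤ d) :
    Real.exp (4 * Real.log d + b + C + y) = d ^ 4 * Real.exp b * Real.exp C * Real.exp y := by
  rw [Real.exp_add, Real.exp_add, Real.exp_add]
  congr 3
  rw [mul_comm, Real.exp_mul, Real.exp_log (by linarith)]
  norm_cast

lemma fin_two {d b M C1 h x N : ℝ} (hd : 1 ≤ d) (hM : 0 ≤ M) (hC1 : 0 ≤ C1) (hh : 4 * d * x < h)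
    (hh0 : 0 ≤ h)
    (hb : Real.exp b ≤ C1 * (11 + 2 * (h + d * x) / d ^ 2))
    (hN : N ≤ M * (d ^ 4 * Real.exp b * Real.exp (-(h / (4 * d ^ 2))))) : N ≤ 21 * M * C1 * d ^ 4 := by
  set w := h / (4 * d ^ 2) with hw
  have hw0 : 0 ≤ w := by positivity
  have h1 : 2 * (h + d * x) / d ^ 2 ≤ 10 * w := by
    have : 10 * w = (10 * h / 4) / d ^ 2 := by rw [hw]; field_simp
    rw [this]
    apply div_le_div_of_nonneg_right _ (by positivity)
    linarith
  have h2 : Real.exp b * Real.exp (-w) ≤ 21 * C1 := by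
    calc _ ≤ C1 * (11 + 10 * w) * Real.exp (-w) :=
          mul_le_mul_of_nonneg_right (hb.trans (mul_le_mul_of_nonneg_left (by linarith) hC1)) (Real.exp_pos _).le
      _ = C1 * (11 * Real.exp (-w) + 10 * (w * Real.exp (-w))) := by ring
      _ ≤ C1 * 21 := by
          apply mul_le_mul_of_nonneg_left _ hC1
          have := mul_exp_neg_le w
          have : Real.exp (-w) ≤ 1 := Real.exp_le_one_iff.2 (by linarith)
          linarith
      _ = _ := by ring
  calc _ ≤ _ := hN
    _ = M * d ^ 4 * (Real.exp b * Real.exp (-w)) := by ring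
    _ ≤ M * d ^ 4 * (21 * C1) := mul_le_mul_of_nonneg_left h2 (by positivity)
    _ = _ := by ring

lemma fin_one {d b M C1 h x a N : ℝ} (hd : 1 ≤ d) (hM : 0 ≤ M) (hC1 : 0 ≤ C1) (hx : 0 ≤ x) (ha : 0 ≤ a)
    (hah : a ≤ h)
    (hb : Real.exp b ≤ C1 * (11 + 2 * (h + d * x) / d ^ 2))
    (hN : N ≤ M * (d ^ 4 * Real.exp b * Real.exp (x / d - h / d ^ 2))) :
    N ≤ M * (1 + 13 * C1) * Real.exp (x / d) * min (d ^ 2 * a + d ^ 3 * x + d ^ 4) (d ^ 4 * Real.exp b) *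
      Real.exp (-(a / d ^ 2)) := by
  set u := h / d ^ 2 with hu
  set u0 := a / d ^ 2 with hu0
  set v := x / d with hv
  have hd0 : 0 < d := by linarith
  have huu : u0 ≤ u := div_le_div_of_nonneg_right hah (by positivity)
  have hu00 : 0 ≤ u0 := by positivity
  have hv0 : 0 ≤ v := by positivity
  have e1 : 2 * (h + d * x) / d ^ 2 = 2 * (u + v) := by rw [hu, hv]; field_simp
  rw [e1] at hb
  have h1 : Real.exp b * Real.exp (-u) ≤ (1 + 13 * C1) * (1 + u0 + v) * Real.exp (-u0) := by
    have h2 : Real.exp (-u) ≤ Real.exp (-u0) := Real.exp_le_exp.2 (by linarith)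
    have h3 := mul_exp_neg_le (u - u0)
    have h4 : (u - u0) * Real.exp (-u) ≤ Real.exp (-u0) := by
      have := mul_le_mul_of_nonneg_right h3 (Real.exp_pos (-u0)).le
      rwa [mul_assoc, ← Real.exp_add, one_mul, show -(u - u0) + -u0 = -u by ring] at this
    calc _ ≤ C1 * (11 + 2 * (u + v)) * Real.exp (-u) := mul_le_mul_of_nonneg_right hb (Real.exp_pos _).le
      _ = C1 * ((11 + 2 * (u0 + v)) * Real.exp (-u) + 2 * ((u - u0) * Real.exp (-u))) := by ring
      _ ≤ C1 * ((11 + 2 * (u0 + v)) * Real.exp (-u0) + 2 * Real.exp (-u0)) := by gcongr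
      _ = C1 * (13 + 2 * (u0 + v)) * Real.exp (-u0) := by ring
      _ ≤ _ := by
        apply mul_le_mul_of_nonneg_right _ (Real.exp_pos _).le
        nlinarith [mul_nonneg hC1 hu00, mul_nonneg hC1 hv0]
  have e2 : d ^ 2 * a + d ^ 3 * x + d ^ 4 = d ^ 4 * (1 + u0 + v) := by
    rw [hu0, hv]
    field_simp
    ring
  rw [e2, ← mul_min_of_nonneg _ _ (by positivity : (0:ℝ) ≤ d ^ 4)]
  have key : Real.exp b * Real.exp (-u) ≤ (1 + 13 * C1) * min (1 + u0 + v) (Real.exp b) * Real.exp (-u0) := by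
    rcases le_total (1 + u0 + v) (Real.exp b) with h5 | h5
    · rw [min_eq_left h5]; exact h1
    · rw [min_eq_right h5]
      have h2 : Real.exp (-u) ≤ Real.exp (-u0) := Real.exp_le_exp.2 (by linarith)
      calc _ ≤ Real.exp b * Real.exp (-u0) := mul_le_mul_of_nonneg_left h2 (Real.exp_pos _).le
        _ ≤ (1 + 13 * C1) * (Real.exp b * Real.exp (-u0)) := le_mul_of_one_le_left (by positivity) (by linarith)
        _ = _ := by ring
  calc _ ≤ _ := hN
    _ = M * d ^ 4 * Real.exp v * (Real.exp b * Real.exp (-u)) := by rw [sub_eq_add_neg, Real.exp_add]; ring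
    _ ≤ M * d ^ 4 * Real.exp v * ((1 + 13 * C1) * min (1 + u0 + v) (Real.exp b) * Real.exp (-u0)) :=
      mul_le_mul_of_nonneg_left key (by positivity)
    _ = _ := by ring
end PAC
end

-- part N2
section
open MvPolynomial
namespace PAC

lemma exists_smooth {f : MvPolynomial (Fin 2) ℤ} {d : ℕ} (hd1 : 1 ≤ d) (hd : f.totalDegree = d)
    (hf : Irreducible (map (Int.castRingHom ℚ) f)) (S : Finset (Fin 2 → ℤ)) (hS : ∀ P ∈ S, eval P f = 0)
    (hc : d * d < S.card) : ∃ P ∈ S, ∃ j, eval P (pderiv j f) ≠ 0 := by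
  classical
  by_contra hcon
  push Not at hcon
  set g := map (Int.castRingHom ℚ) f with hg
  have hgd : g.totalDegree = d := by
    rw [← hd]
    unfold totalDegree
    rw [hg, support_map_of_injective _ Int.cast_injective]
  obtain ⟨j, hj⟩ := exists_pderiv_ne_zero (f := g) (by omega) (fun n hn _ => by exact_mod_cast hn.ne')
  have hnd := not_dvd_pderiv (by omega) hj
  have h1 := bezout_points hf hnd (S.image (fun P => fun i => (P i : ℚ))) (by
    intro Q hQ
    obtain ⟨P, hP, rfl⟩ := Finset.mem_image.1 hQ
    have e1 := map_eval (Int.castRingHom ℚ) P f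
    have e2 := map_eval (Int.castRingHom ℚ) P (pderiv j f)
    rw [hS P hP] at e1
    rw [hcon P hP j, ← pderiv_map] at e2
    rw [map_zero] at e1 e2
    exact ⟨e1.symm, e2.symm⟩)
  rw [Finset.card_image_of_injective] at h1
  · have h2 := totalDegree_pderiv_le j g
    rw [hgd] at h1 h2
    have := Nat.mul_le_mul_left d (h2.trans (Nat.sub_le d 1))
    omega
  · intro P Q hPQ
    funext i
    have := congrFun hPQ i
    exact Int.cast_injective (α := ℚ) this

lemma normMax_top {f : MvPolynomial (Fin 2) ℤ} {d : ℕ} (hd : f.totalDegree = d) (hf0 : f ≠ 0) :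
    1 ≤ normMax (homogeneousComponent d f) ∧ ∃ m : Fin 2 →₀ ℕ, m 0 + m 1 = d ∧
      normMax (homogeneousComponent d f) = |((f.coeff m : ℤ) : ℝ)| := by
  classical
  set g := homogeneousComponent d f with hg
  have hsum : ∀ m : Fin 2 →₀ ℕ, m.degree = m 0 + m 1 := by
    intro m
    rw [Finsupp.degree_eq_sum, Fin.sum_univ_two]
  have hne : g.support.Nonempty := by
    obtain ⟨m, hm, hm2⟩ := Finset.exists_mem_eq_sup f.support (support_nonempty.2 hf0) (fun m => m.sum fun _ e => e)
    refine ⟨m, ?_⟩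
    rw [mem_support_iff, hg, coeff_homogeneousComponent, if_pos]
    · exact mem_support_iff.1 hm
    · rw [← hd]
      exact hm2.symm
  obtain ⟨m, hm, hm2⟩ := Finset.exists_mem_eq_sup g.support hne (fun m => (g.coeff m).natAbs)
  have hN : normMax g = ((g.coeff m).natAbs : ℝ) := by
    unfold normMax
    rw [hm2]
  have hm3 := mem_support_iff.1 hm
  have hdeg : m.degree = d := by
    by_contra hh
    rw [hg, coeff_homogeneousComponent, if_neg hh] at hm3
    exact hm3 rfl
  refine ⟨?_, m, by rw [← hsum, hdeg], ?_⟩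
  · rw [hN]
    exact_mod_cast Int.natAbs_pos.2 hm3
  · rw [hN, hg, coeff_homogeneousComponent, if_pos hdeg, Nat.cast_natAbs]
    push_cast
    rfl

set_option maxHeartbeats 1000000 in
theorem main_bound : ∃ c : ℝ, 0 < c ∧ ∀ (d : ℕ) (f : MvPolynomial (Fin 2) ℤ) (B : ℝ) (S : Finset (Fin 2 → ℤ)),
    1 ≤ d → f.totalDegree = d → Finset.gcd f.support f.coeff = 1 → Irreducible (map (Int.castRingHom ℚ) f) →
    1 ≤ B → (∀ P ∈ S, eval P f = 0 ∧ ∀ l, |(P l : ℝ)| ≤ B) →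
    (S.card : ℝ) ≤ c * (d * Real.log B) + c * (d : ℝ) ^ 4 ∨
    (S.card : ℝ) ≤ c * Real.exp (Real.log B / d) *
      min ((d : ℝ) ^ 2 * Real.log (normMax (homogeneousComponent d f)) + (d : ℝ) ^ 3 * Real.log B + (d : ℝ) ^ 4)
        ((d : ℝ) ^ 4 * badness f) * Real.exp (-(Real.log (normMax (homogeneousComponent d f)) / (d : ℝ) ^ 2)) := by
  classical
  obtain ⟨C, hC, hlog⟩ := log_ineq
  obtain ⟨C1, hC1, hbu⟩ := b_upper
  set M := 2 * (Real.exp C * Real.exp 17) with hM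
  have hM0 : 0 < M := by positivity
  refine ⟨5 + 21 * M * C1 + M * (1 + 13 * C1), by positivity, ?_⟩
  intro d f B S hd1 hd hprim hf hB hS
  have hd1' : (1 : ℝ) ≤ d := by exact_mod_cast hd1
  have hB0 : 0 < B := by linarith
  set x := Real.log B with hx
  have hx0 : 0 ≤ x := Real.log_nonneg hB
  set D0 := max (4 * d) ⌈x⌉₊ with hD0
  have hd4 : (d : ℝ) ^ 2 ≤ (d : ℝ) ^ 4 := pow_le_pow_right₀ hd1' (by norm_num)
  have hd41 : (d : ℝ) ≤ (d : ℝ) ^ 4 := le_self_pow₀ hd1' (by norm_num)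
  have hp1 : 0 ≤ M * C1 := by positivity
  by_cases hcase : S.card ≤ d * D0
  · left
    have h1 : (S.card : ℝ) ≤ d * D0 := by exact_mod_cast hcase
    have h2 : (D0 : ℝ) ≤ 4 * d + (x + 1) := by
      rw [hD0, Nat.cast_max]
      apply max_le
      · push_cast; linarith
      · have := (Nat.ceil_lt_add_one hx0).le
        linarith
    have h3 : (d : ℝ) * D0 ≤ d * (4 * d + (x + 1)) := mul_le_mul_of_nonneg_left h2 (by linarith)
    have h4 : (S.card : ℝ) ≤ 5 * (d * x) + 5 * (d : ℝ) ^ 4 := by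
      have : 0 ≤ (d : ℝ) * x := by positivity
      nlinarith
    refine h4.trans ?_
    have h5 : (5 : ℝ) ≤ 5 + 21 * M * C1 + M * (1 + 13 * C1) := by nlinarith
    gcongr
  push Not at hcase
  have hD4 : 4 * d ≤ D0 := le_max_left _ _
  have hDx : x ≤ D0 := (Nat.le_ceil x).trans (by exact_mod_cast le_max_right _ _)
  obtain ⟨P, hPS, j, hj⟩ := exists_smooth hd1 hd hf S (fun P hP => (hS P hP).1) (by nlinarith)
  have hf0 : f ≠ 0 := by rintro rfl; simp at hj
  -- the degree
  set D := (S.card - 1) / d with hDdef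
  have hDD : D0 ≤ D := by
    rw [hDdef, Nat.le_div_iff_mul_le (by omega), mul_comm]
    omega
  have hDlt : d * D < S.card := by
    have := Nat.mul_div_le (S.card - 1) d
    rw [← hDdef] at this
    omega
  have hDup : S.card ≤ d * (D + 1) := by
    have := Nat.lt_mul_div_succ (S.card - 1) (by omega : 0 < d)
    rw [← hDdef] at this
    omega
  have hdD : d ≤ D := by omega
  -- sizes
  have hcs := card_II hdD
  have hcT := card_TT D
  have hcr := card_TT (D - d)
  set s := (II D d).card with hs
  set r := (TT (D - d)).card with hr
  obtain ⟨e, he⟩ := Nat.exists_eq_add_of_le hdD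
  have hDe : D - d = e := by omega
  have hr2 : 2 * (r : ℝ) = ((D : ℝ) - d + 1) * (D - d + 2) := by
    rw [hDe] at hcr
    have : 2 * (r : ℝ) = ((e : ℝ) + 1) * (e + 2) := by exact_mod_cast hcr
    rw [this, he]; push_cast; ring
  have hs2 : 2 * (s : ℝ) = d * (2 * D + 3 - d) := by
    have h1 : (s : ℝ) + r = (TT D).card := by exact_mod_cast hcs
    have h2 : 2 * ((TT D).card : ℝ) = (D + 1) * (D + 2) := by exact_mod_cast hcT
    linarith
  -- coefficients
  obtain ⟨hA1, m0, hm0, hm0A⟩ := normMax_top hd hf0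
  set A := normMax (homogeneousComponent d f) with hA
  obtain ⟨m, hm, hmax⟩ := Finset.exists_max_image (TT d)
    (fun m => |((f.coeff m : ℤ) : ℝ)| * B ^ (m 0 + m 1)) ⟨m0, mem_TT.2 hm0.le⟩
  have hmA : A * B ^ d ≤ |((f.coeff m : ℤ) : ℝ)| * B ^ (m 0 + m 1) := by
    have := hmax m0 (mem_TT.2 hm0.le)
    simp only [hm0, ← hm0A] at this
    exact this
  have hcm : f.coeff m ≠ 0 := by
    intro h0
    rw [h0] at hmA
    simp at hmA
    have : 0 < A * B ^ d := by positivity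
    linarith
  set Hm := |((f.coeff m : ℤ) : ℝ)| * B ^ (m 0 + m 1) with hHm
  have hHm0 : 0 < Hm := lt_of_lt_of_le (by positivity) hmA
  set h := Real.log (Hm / B ^ d) with hh
  have hah : Real.log A ≤ h := by
    apply Real.log_le_log (by linarith)
    rwa [le_div_iff₀ (by positivity)]
  have ha0 : 0 ≤ Real.log A := Real.log_nonneg hA1
  have hh0 : 0 ≤ h := ha0.trans hah
  have hHlog : Real.log Hm = h + d * x := by
    rw [hh, Real.log_div hHm0.ne' (by positivity), Real.log_pow]
    ring
  set H' := f.support.sup (fun m => (f.coeff m).natAbs) with hH'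
  have hH'1 : ∀ m, |f.coeff m| ≤ (H' : ℤ) := by
    intro n
    by_cases hn : n ∈ f.support
    · have := Finset.le_sup (f := fun m => (f.coeff m).natAbs) hn
      rw [Int.abs_eq_natAbs]
      exact_mod_cast this
    · rw [notMem_support_iff.1 hn]
      simp
  have hH'2 : (H' : ℝ) ≤ Hm := by
    obtain ⟨n, hn, hn2⟩ := Finset.exists_mem_eq_sup f.support (support_nonempty.2 hf0) (fun m => (f.coeff m).natAbs)
    have h1 : (H' : ℝ) = |((f.coeff n : ℤ) : ℝ)| := by
      rw [hH', hn2, Nat.cast_natAbs]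
      push_cast
      rfl
    have h2 : n ∈ TT d := by
      rw [mem_TT']
      rw [← hd]
      exact le_totalDegree hn
    refine le_trans ?_ (hmax n h2)
    rw [h1]
    exact le_mul_of_one_le_right (abs_nonneg _) (one_le_pow₀ hB)
  have hH'0 : 0 < (H' : ℝ) := by
    have h1 := hH'1 m
    have h2 := abs_pos.2 hcm
    exact_mod_cast lt_of_lt_of_le h2 h1
  have hH'log : Real.log H' ≤ h + d * x := by
    rw [← hHlog]
    exact Real.log_le_log hH'0 hH'2
  obtain ⟨Bd, hBd1, hBd2, hBd3, hBd4⟩ := bad_primes hd1 hd hprim hf hH'1 (hS P hPS).1 hj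
  set b := ∑ p ∈ Bd, Real.log p / p with hb
  have hbb : Real.exp b ≤ C1 * (11 + 2 * (h + d * x) / (d : ℝ) ^ 2) := by
    have h1 := hbu d Bd _ hd1 (fun p hp => ⟨(hBd1 p hp).1, by have := (hBd1 p hp).2; omega⟩) hBd4
    refine h1.trans (mul_le_mul_of_nonneg_left ?_ hC1)
    have e1 : (10 * (d : ℝ) ^ 4 + 2 * d ^ 2 * Real.log H') / d ^ 4 = 10 + 2 * Real.log H' / d ^ 2 := by
      field_simp
    rw [e1]
    have : 2 * Real.log H' / (d : ℝ) ^ 2 ≤ 2 * (h + d * x) / (d : ℝ) ^ 2 :=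
      div_le_div_of_nonneg_right (by linarith) (by positivity)
    linarith
  have key := hlog f d D B Bd S m hprim hf hd hd1 hdD hB (fun p hp => (hBd1 p hp).1) hBd2 hS hDlt hm hcm
  have hD4' : 4 * (d : ℝ) ≤ D := by exact_mod_cast hD4.trans hDD
  have hxD' : x ≤ D := hDx.trans (by exact_mod_cast hDD)
  have nc := num_c (K := 4 * Real.log d + b + C) hd1' hD4' hx0 hxD' hh0 hs2 hr2 (by
    rw [show Real.log (s : ℝ) - (4 * Real.log d + b + C) = Real.log s - 4 * Real.log d - b - C by ring]
    exact key)
  clear key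
  have hs0 : 0 < (s : ℝ) := by nlinarith
  have hN2s : (S.card : ℝ) ≤ 2 * s := by
    have : (S.card : ℝ) ≤ d * (D + 1) := by exact_mod_cast hDup
    nlinarith
  have hexp : ∀ y, Real.log s ≤ 4 * Real.log d + b + C + 17 + y →
      (S.card : ℝ) ≤ M * ((d : ℝ) ^ 4 * Real.exp b * Real.exp y) := by
    intro y hy
    have h1 : (s : ℝ) ≤ Real.exp (4 * Real.log d + b + C + (17 + y)) := by
      rw [← Real.log_le_iff_le_exp hs0]
      linarith
    rw [exp_K hd1', Real.exp_add] at h1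
    rw [hM]
    calc _ ≤ _ := hN2s
      _ ≤ _ := mul_le_mul_of_nonneg_left h1 (by norm_num)
      _ = _ := by ring
  rcases le_or_gt h (4 * d * x) with hcs1 | hcs1
  · right
    have h1 := hexp (x / d - h / (d : ℝ) ^ 2) (by linarith [nc.1 hcs1])
    have h2 := fin_one hd1' hM0.le hC1 hx0 ha0 hah hbb h1
    rw [hBd3]
    refine h2.trans ?_
    have h3 : M * (1 + 13 * C1) ≤ 5 + 21 * M * C1 + M * (1 + 13 * C1) := by nlinarith
    have h4 : 0 ≤ min ((d : ℝ) ^ 2 * Real.log A + (d : ℝ) ^ 3 * x + (d : ℝ) ^ 4) ((d : ℝ) ^ 4 * Real.exp b) :=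
      le_min (by positivity) (by positivity)
    gcongr
  · left
    have h1 := hexp (-(h / (4 * (d : ℝ) ^ 2))) (by linarith [nc.2 hcs1])
    have h2 := fin_two hd1' hM0.le hC1 hcs1 hh0 hbb h1
    refine h2.trans ?_
    have h3 : 21 * M * C1 ≤ 5 + 21 * M * C1 + M * (1 + 13 * C1) := by nlinarith
    have h4 : 21 * M * C1 * (d : ℝ) ^ 4 ≤ (5 + 21 * M * C1 + M * (1 + 13 * C1)) * (d : ℝ) ^ 4 :=
      mul_le_mul_of_nonneg_right h3 (by positivity)
    have h5 : 0 ≤ (5 + 21 * M * C1 + M * (1 + 13 * C1)) * (d * x) := by positivity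
    linarith

lemma badness_nonneg {σ : Type*} (f : MvPolynomial σ ℤ) : 0 ≤ badness f := by
  unfold badness
  split_ifs
  · exact finprod_nonneg (fun p => finprod_nonneg (fun _ => (Real.exp_pos _).le))
  · exact le_rfl
end PAC
end


/-- **Precise affine bound for plane curves.** There is an absolute constant `c > 0`
such that for every primitive `f ∈ ℤ[x_1,x_2]` of degree `d ≥ 1` irreducible over `ℚ`,
with degree-`d` homogeneous part `f_d`, and every `B ≥ 1`, one has
`N_aff(f,B) ≤ c·B^(1/d)·min(d²·log‖f_d‖ + d³·log B + d⁴, d⁴·b(f))/‖f_d‖^(1/d²)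
+ c·d·log B + c·d⁴`. -/
theorem precise_affine_plane_curve :
    ∃ c : ℝ, 0 < c ∧
      ∀ (d : ℕ) (f : MvPolynomial (Fin 2) ℤ) (B : ℝ),
        1 ≤ d → f.totalDegree = d →
        Finset.gcd f.support f.coeff = 1 →
        Irreducible (MvPolynomial.map (Int.castRingHom ℚ) f) →
        1 ≤ B →
        (Naff f B : ℝ) ≤
          c * B ^ ((1 : ℝ) / d) *
              min ((d : ℝ) ^ 2 * Real.log (normMax (MvPolynomial.homogeneousComponent d f)) +
                    (d : ℝ) ^ 3 * Real.log B + (d : ℝ) ^ 4)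
                  ((d : ℝ) ^ 4 * badness f) /
              (normMax (MvPolynomial.homogeneousComponent d f)) ^ ((1 : ℝ) / (d : ℝ) ^ 2)
            + c * (d : ℝ) * Real.log B + c * (d : ℝ) ^ 4 := by
  obtain ⟨c, hc, hmain⟩ := PAC.main_bound
  refine ⟨c, hc, ?_⟩
  intro d f B hd1 hd hprim hf hB
  have hf0 : f ≠ 0 := by
    rintro rfl
    simp at hf
  have hB0 : 0 < B := by linarith
  obtain ⟨hA1, -⟩ := PAC.normMax_top hd hf0
  set A := normMax (MvPolynomial.homogeneousComponent d f) with hA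
  have hA0 : 0 < A := by linarith
  have hlA := Real.log_nonneg hA1
  have hlB := Real.log_nonneg hB
  have hbad := PAC.badness_nonneg f
  have e1 : B ^ ((1 : ℝ) / d) = Real.exp (Real.log B / d) := by
    rw [Real.rpow_def_of_pos hB0]
    congr 1
    ring
  have e2 : ∀ y : ℝ, y / A ^ ((1 : ℝ) / (d : ℝ) ^ 2) = y * Real.exp (-(Real.log A / (d : ℝ) ^ 2)) := by
    intro y
    rw [Real.rpow_def_of_pos hA0, Real.exp_neg, div_eq_mul_inv]
    congr 3
    ring
  rw [e1, e2]
  have hmin : 0 ≤ min ((d : ℝ) ^ 2 * Real.log A + (d : ℝ) ^ 3 * Real.log B + (d : ℝ) ^ 4) ((d : ℝ) ^ 4 * badness f) :=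
    le_min (by positivity) (by positivity)
  have ht1 : 0 ≤ c * Real.exp (Real.log B / d) *
      min ((d : ℝ) ^ 2 * Real.log A + (d : ℝ) ^ 3 * Real.log B + (d : ℝ) ^ 4) ((d : ℝ) ^ 4 * badness f) *
      Real.exp (-(Real.log A / (d : ℝ) ^ 2)) := by positivity
  have ht2 : 0 ≤ c * (d : ℝ) * Real.log B := by positivity
  have ht3 : 0 ≤ c * (d : ℝ) ^ 4 := by positivity
  by_cases hfin : Set.Finite {x : Fin 2 → ℤ | (∀ i, |(x i : ℝ)| ≤ B) ∧ MvPolynomial.eval x f = 0}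
  · have hn : Naff f B = hfin.toFinset.card := Set.ncard_eq_toFinset_card _ hfin
    rw [hn]
    have := hmain d f B hfin.toFinset hd1 hd hprim hf hB (by
      intro P hP
      have := (Set.Finite.mem_toFinset hfin).1 hP
      exact ⟨this.2, this.1⟩)
    rcases this with h | h <;> linarith
  · have hn : Naff f B = 0 := Set.Infinite.ncard hfin
    rw [hn, Nat.cast_zero]
    linarith
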